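/- arXiv:0904.0299 — 6 statements merged into one kernel-verified Lean document; each statement's English description precedes it below -/
import Mathlib

section
/- Let ε, δ > 0, t₀ ∈ ℝ and a > 0. Let f : (t₀−ε, t₀+ε) → ℝ and y : (−δ, δ) × (t₀−ε, t₀+ε) → ℝ be smooth functions such that f(t₀) = f′(t₀) = 0 and f″(t₀) = −2a < 0. Suppose that for every sufficiently small c > 0 there are points t₁(c) < t₀ < t₂(c) in (t₀−ε, t₀+ε) with f(t₁(c)) + c = 0 = f(t₂(c)) + c and f(t) + c > 0 for t ∈ (t₁(c), t₂(c)). Then lim_{c→0⁺} ∫_{t₁(c)}^{t₂(c)} y(c,t)/√(f(t)+c) dt = y(0,t₀)·π/√a. -/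
open Real Set Filter MeasureTheory

section ArcsineKernel

variable {t₀ s : ℝ}

lemma hasDerivAt_arcsin_sub_div {t : ℝ} (ht : t ∈ Ioo t₀ s) :
    HasDerivAt (fun t => arcsin ((t - t₀) / (s - t₀)))
      (1 / √((s - t₀) ^ 2 - (t - t₀) ^ 2)) t := by
  obtain ⟨h1, h2⟩ := ht
  have hw : 0 < s - t₀ := by linarith
  have hu : 0 < (t - t₀) / (s - t₀) := div_pos (by linarith) hw
  have hu1 : (t - t₀) / (s - t₀) < 1 := (div_lt_one hw).2 (by linarith)
  have hlin : HasDerivAt (fun t => (t - t₀) / (s - t₀)) (1 / (s - t₀)) t :=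
    ((hasDerivAt_id t).sub_const t₀).div_const _
  refine ((hasDerivAt_arcsin (by linarith) hu1.ne).comp t hlin).congr_deriv ?_
  have hsq : (s - t₀) ^ 2 - (t - t₀) ^ 2
      = (s - t₀) ^ 2 * (1 - ((t - t₀) / (s - t₀)) ^ 2) := by
    field_simp
  rw [hsq, Real.sqrt_mul (sq_nonneg _), Real.sqrt_sq hw.le, div_mul_div_comm, one_mul,
    mul_comm]

lemma continuousOn_arcsin_sub_div :
    ContinuousOn (fun t => arcsin ((t - t₀) / (s - t₀))) (Icc t₀ s) :=
  (continuous_arcsin.comp ((continuous_id.sub continuous_const).div_const _)).continuousOn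

lemma intervalIntegrable_one_div_sqrt_sq_sub_sq (h : t₀ ≤ s) :
    IntervalIntegrable (fun t => 1 / √((s - t₀) ^ 2 - (t - t₀) ^ 2)) volume t₀ s :=
  (intervalIntegrable_iff_integrableOn_Ioc_of_le h).2
    (intervalIntegral.integrableOn_deriv_of_nonneg continuousOn_arcsin_sub_div
      (fun _ ht => hasDerivAt_arcsin_sub_div ht) fun _ _ => by positivity)

lemma integral_one_div_sqrt_sq_sub_sq (h : t₀ < s) :
    ∫ t in t₀..s, 1 / √((s - t₀) ^ 2 - (t - t₀) ^ 2) = π / 2 := by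
  rw [intervalIntegral.integral_eq_sub_of_hasDerivAt_of_le h.le continuousOn_arcsin_sub_div
    (fun _ ht => hasDerivAt_arcsin_sub_div ht)
    (intervalIntegrable_one_div_sqrt_sq_sub_sq h.le)]
  simp [div_self (sub_pos.2 h).ne']

/-- A function close to `L` times the arcsine kernel is integrable, with integral close to
`L * (π / 2)`. -/
lemma intervalIntegrable_and_abs_integral_sub_le {g : ℝ → ℝ} {L e : ℝ} (h : t₀ < s)
    (hg : AEStronglyMeasurable g (volume.restrict (Ioo t₀ s)))
    (hgL : ∀ t ∈ Ioo t₀ s, |g t - L * (1 / √((s - t₀) ^ 2 - (t - t₀) ^ 2))|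
      ≤ e * (1 / √((s - t₀) ^ 2 - (t - t₀) ^ 2))) :
    IntervalIntegrable g volume t₀ s ∧ |(∫ t in t₀..s, g t) - L * (π / 2)| ≤ e * (π / 2) := by
  set k : ℝ → ℝ := fun t => 1 / √((s - t₀) ^ 2 - (t - t₀) ^ 2) with hk
  have hkint : IntervalIntegrable k volume t₀ s := intervalIntegrable_one_div_sqrt_sq_sub_sq h.le
  have hkIoo : IntegrableOn k (Ioo t₀ s) :=
    (intervalIntegrable_iff_integrableOn_Ioo_of_le h.le).1 hkint
  have hbound : ∀ᵐ t ∂volume.restrict (Ioo t₀ s), ‖g t - L * k t‖ ≤ e * k t :=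
    (ae_restrict_iff' measurableSet_Ioo).2 (ae_of_all _ hgL)
  have hdiff : IntervalIntegrable (fun t => g t - L * k t) volume t₀ s :=
    (intervalIntegrable_iff_integrableOn_Ioo_of_le h.le).2 <|
      (hkIoo.const_mul e).mono' (hg.sub (hkIoo.const_mul L).aestronglyMeasurable) hbound
  have hgint : IntervalIntegrable g volume t₀ s := by
    simpa using hdiff.add (hkint.const_mul L)
  refine ⟨hgint, ?_⟩
  rw [← integral_one_div_sqrt_sq_sub_sq h, ← intervalIntegral.integral_const_mul,
    ← intervalIntegral.integral_const_mul,
    ← intervalIntegral.integral_sub hgint (hkint.const_mul L)]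
  simp only [intervalIntegral.integral_of_le h.le, integral_Ioc_eq_integral_Ioo]
  exact norm_integral_le_of_norm_le (hkIoo.const_mul e) hbound

end ArcsineKernel

lemma exists_sub_eq_sq_sub_sq_mul_deriv {f : ℝ → ℝ} {t₀ t s : ℝ} (h0 : t₀ < t) (hts : t < s)
    (hf : ∀ x ∈ Icc t s, DifferentiableAt ℝ f x) :
    ∃ ξ ∈ Ioo t s,
      f t - f s = ((s - t₀) ^ 2 - (t - t₀) ^ 2) * (-(deriv f ξ / (ξ - t₀)) / 2) := by
  have hsq (x : ℝ) : HasDerivAt (fun x => (x - t₀) ^ 2) (2 * (x - t₀)) x := by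
    simpa using ((hasDerivAt_id x).sub_const t₀).fun_pow 2
  obtain ⟨ξ, hξ, hmv⟩ := exists_ratio_hasDerivAt_eq_ratio_slope f (deriv f) hts
    (fun x hx => (hf x hx).continuousAt.continuousWithinAt)
    (fun x hx => (hf x (Ioo_subset_Icc_self hx)).hasDerivAt)
    (fun x => (x - t₀) ^ 2) (fun x => 2 * (x - t₀))
    (fun x _ => (hsq x).continuousAt.continuousWithinAt) (fun x _ => hsq x)
  refine ⟨ξ, hξ, ?_⟩
  have : ξ - t₀ ≠ 0 := by linarith [hξ.1]
  field_simp
  linarith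

/-- The half of the limit coming from one side of the maximum. -/
lemma tendsto_integral_div_sqrt_right {t₀ a : ℝ} (ha : 0 < a) {f : ℝ → ℝ} {y : ℝ → ℝ → ℝ}
    (hf : ∀ᶠ x in nhds t₀, DifferentiableAt ℝ f x)
    (hf1 : deriv f t₀ = 0) (hf2 : HasDerivAt (deriv f) (-2 * a) t₀)
    (hy : ∀ᶠ p : ℝ × ℝ in nhds (0, t₀), ContinuousAt (fun p : ℝ × ℝ => y p.1 p.2) p)
    {s : ℝ → ℝ} (hs : Tendsto s (nhdsWithin 0 (Ioi 0)) (nhds t₀))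
    (hroot : ∀ᶠ c in nhdsWithin (0 : ℝ) (Ioi 0), t₀ < s c ∧ f (s c) + c = 0) :
    (∀ᶠ c in nhdsWithin (0 : ℝ) (Ioi 0),
      IntervalIntegrable (fun t => y c t / √(f t + c)) volume t₀ (s c)) ∧
    Tendsto (fun c => ∫ t in t₀..s c, y c t / √(f t + c)) (nhdsWithin 0 (Ioi 0))
      (nhds (y 0 t₀ / √a * (π / 2))) := by
  have hq : Tendsto (fun ξ => -(deriv f ξ / (ξ - t₀)) / 2) (nhdsWithin t₀ (Ioi t₀))
      (nhds a) := by
    have h := (hasDerivAt_iff_tendsto_slope.1 hf2).mono_left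
      (nhdsWithin_mono t₀ fun x (hx : t₀ < x) => hx.ne')
    have h' := h.neg.div_const 2
    rw [show -(-2 * a) / 2 = a by ring] at h'
    refine h'.congr fun ξ => ?_
    rw [slope_def_field, hf1, sub_zero]
  have hyq : Tendsto (fun z : (ℝ × ℝ) × ℝ =>
      y z.1.1 z.1.2 / √(-(deriv f z.2 / (z.2 - t₀)) / 2))
      (nhds (0, t₀) ×ˢ nhdsWithin t₀ (Ioi t₀)) (nhds (y 0 t₀ / √a)) :=
    (hy.self_of_nhds.tendsto.comp tendsto_fst).div (hq.sqrt.comp tendsto_snd)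
      (Real.sqrt_pos.2 ha).ne'
  have key : ∀ e > 0, ∀ᶠ c in nhdsWithin (0 : ℝ) (Ioi 0),
      IntervalIntegrable (fun t => y c t / √(f t + c)) volume t₀ (s c) ∧
      |(∫ t in t₀..s c, y c t / √(f t + c)) - y 0 t₀ / √a * (π / 2)| ≤ e * (π / 2) := by
    intro e he
    obtain ⟨P, hP, Q, hQ, hPQ⟩ := eventually_prod_iff.1
      (hyq.eventually (Metric.closedBall_mem_nhds _ he))
    obtain ⟨C, hC, T, hT, hCT⟩ := eventually_prod_iff.1 ((hP.and hy).filter_mono nhds_prod_eq.ge)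
    obtain ⟨r₁, hr₁, hr₁'⟩ := mem_nhdsGT_iff_exists_Ioo_subset.1 hQ
    obtain ⟨r₂, hr₂, hr₂'⟩ := mem_nhdsGE_iff_exists_Ico_subset.1
      (nhdsWithin_le_nhds (s := Ici t₀) (hT.and hf))
    filter_upwards [hroot, nhdsWithin_le_nhds hC, hs.eventually (gt_mem_nhds hr₁),
      hs.eventually (gt_mem_nhds hr₂)] with c ⟨hsc, hfc⟩ hc hs₁ hs₂
    have hnear {t : ℝ} (ht : t ∈ Icc t₀ (s c)) : T t ∧ DifferentiableAt ℝ f t :=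
      hr₂' ⟨ht.1, ht.2.trans_lt hs₂⟩
    refine intervalIntegrable_and_abs_integral_sub_le hsc ?_ fun t ht => ?_
    · have hyc : ContinuousOn (y c) (Ioo t₀ (s c)) := fun t ht =>
        ((hCT hc (hnear (Ioo_subset_Icc_self ht)).1).2.comp
          (f := fun t : ℝ => (c, t)) (by fun_prop)).continuousWithinAt
      have hfc : ContinuousOn (fun t => √(f t + c)) (Ioo t₀ (s c)) := fun t ht =>
        ((hnear (Ioo_subset_Icc_self ht)).2.continuousAt.add_const c).sqrt.continuousWithinAt
      exact ((hyc.aemeasurable measurableSet_Ioo).div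
        (hfc.aemeasurable measurableSet_Ioo)).aestronglyMeasurable
    · obtain ⟨ξ, hξ, hfξ⟩ := exists_sub_eq_sq_sub_sq_mul_deriv ht.1 ht.2
        fun x hx => (hnear ⟨ht.1.le.trans hx.1, hx.2⟩).2
      have hpt := hPQ (hCT hc (hnear (Ioo_subset_Icc_self ht)).1).1
        (hr₁' ⟨ht.1.trans hξ.1, hξ.2.trans hs₁⟩)
      have hnn : 0 ≤ (s c - t₀) ^ 2 - (t - t₀) ^ 2 := by nlinarith [ht.1, ht.2]
      rw [Real.dist_eq] at hpt
      rw [show f t + c = f t - f (s c) by linarith, hfξ, Real.sqrt_mul hnn]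
      calc _ = |(y c t / √(-(deriv f ξ / (ξ - t₀)) / 2) - y 0 t₀ / √a) *
              (1 / √((s c - t₀) ^ 2 - (t - t₀) ^ 2))| := by
            rw [sub_mul, mul_comm (√_) (√(-_ / _)), ← div_div, ← mul_one_div (y c t / _)]
        _ ≤ _ := by
            rw [abs_mul, abs_of_nonneg (a := 1 / √_) (by positivity)]
            gcongr
  refine ⟨(key 1 one_pos).mono fun _ h => h.1, Metric.tendsto_nhds.2 fun e he => ?_⟩
  filter_upwards [key (e / π) (by positivity)] with c hc
  refine hc.2.trans_lt ?_
  field_simp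
  norm_num

/-- Points joined to `t₀` by a segment on which `f + c` is positive converge to `t₀`. -/
lemma tendsto_of_pos_add {t₀ : ℝ} {f t₁ t₂ : ℝ → ℝ}
    (hneg : ∀ᶠ x in nhdsWithin t₀ {t₀}ᶜ, f x < 0)
    (h : ∀ᶠ c in nhdsWithin (0 : ℝ) (Ioi 0), t₁ c < t₀ ∧ t₀ < t₂ c ∧
      ∀ t ∈ Ioo (t₁ c) (t₂ c), 0 < f t + c) :
    Tendsto t₁ (nhdsWithin 0 (Ioi 0)) (nhds t₀) ∧
      Tendsto t₂ (nhdsWithin 0 (Ioi 0)) (nhds t₀) := by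
  have hsmall {x : ℝ} (hx : f x < 0) : ∀ᶠ c in nhdsWithin (0 : ℝ) (Ioi 0), f x + c < 0 :=
    nhdsWithin_le_nhds ((gt_mem_nhds (neg_pos.2 hx)).mono fun c hc => by linarith)
  constructor
  · refine tendsto_order.2 ⟨fun b hb => ?_, fun b hb => h.mono fun c hc => hc.1.trans hb⟩
    obtain ⟨x, hx, hbx⟩ := ((hneg.filter_mono (nhdsLT_le_nhdsNE t₀)).and
      (Ioo_mem_nhdsLT hb)).exists
    filter_upwards [h, hsmall hx] with c ⟨h1, h2, h3⟩ hc
    by_contra! hle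
    linarith [h3 x ⟨hle.trans_lt hbx.1, hbx.2.trans h2⟩]
  · refine tendsto_order.2 ⟨fun b hb => h.mono fun c hc => hb.trans hc.2.1, fun b hb => ?_⟩
    obtain ⟨x, hx, hbx⟩ := ((hneg.filter_mono (nhdsGT_le_nhdsNE t₀)).and
      (Ioo_mem_nhdsGT hb)).exists
    filter_upwards [h, hsmall hx] with c ⟨h1, h2, h3⟩ hc
    by_contra! hle
    linarith [h3 x ⟨h1.trans hbx.1, hbx.2.trans_le hle⟩]

lemma eventually_neg_of_deriv_deriv_neg {f : ℝ → ℝ} {t₀ : ℝ} (hf0 : f t₀ = 0)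
    (hf1 : deriv f t₀ = 0) (hf2 : deriv (deriv f) t₀ < 0)
    (hf : ∀ᶠ x in nhds t₀, DifferentiableAt ℝ f x) :
    ∀ᶠ x in nhdsWithin t₀ {t₀}ᶜ, f x < 0 := by
  obtain ⟨r, hr, hball⟩ := Metric.eventually_nhds_iff_ball.1
    ((eventually_nhdsWithin_sign_eq_of_deriv_neg hf2 hf1).and hf)
  rw [Real.ball_eq_Ioo] at hball
  filter_upwards [self_mem_nhdsWithin, nhdsWithin_le_nhds (Ioo_mem_nhds
    (show t₀ - r < t₀ by linarith) (show t₀ < t₀ + r by linarith))] with x hx ⟨hx1, hx2⟩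
  rcases lt_or_gt_of_ne (show x ≠ t₀ from hx) with hlt | hlt
  · have hsub {z : ℝ} (hz : z ∈ Icc x t₀) : z ∈ Ioo (t₀ - r) (t₀ + r) :=
      ⟨hx1.trans_le hz.1, by linarith [hz.2]⟩
    obtain ⟨ξ, hξ, h⟩ := exists_deriv_eq_slope f hlt
      (fun z hz => (hball z (hsub hz)).2.continuousAt.continuousWithinAt)
      (fun z hz => (hball z (hsub (Ioo_subset_Icc_self hz))).2.differentiableWithinAt)
    have hsign := (hball ξ (hsub (Ioo_subset_Icc_self hξ))).1
    rw [sign_pos (sub_pos.2 hξ.2), sign_eq_one_iff, h, hf0, zero_sub,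
      div_pos_iff_of_pos_right (sub_pos.2 hlt)] at hsign
    linarith
  · have hsub {z : ℝ} (hz : z ∈ Icc t₀ x) : z ∈ Ioo (t₀ - r) (t₀ + r) :=
      ⟨by linarith [hz.1], hz.2.trans_lt hx2⟩
    obtain ⟨ξ, hξ, h⟩ := exists_deriv_eq_slope f hlt
      (fun z hz => (hball z (hsub hz)).2.continuousAt.continuousWithinAt)
      (fun z hz => (hball z (hsub (Ioo_subset_Icc_self hz))).2.differentiableWithinAt)
    have hsign := (hball ξ (hsub (Ioo_subset_Icc_self hξ))).1
    rw [sign_neg (sub_neg.2 hξ.1), sign_eq_neg_one_iff, h, hf0, sub_zero,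
      div_neg_iff] at hsign
    rcases hsign with h | h <;> linarith [h.1, h.2]

/-- Lemma 5.1 (Perdomo): limit of an integral with inverse-square-root singularity
created by a nondegenerate maximum of `f` at `t₀`. -/
theorem perdomo_limit_lemma (ε δ t₀ a : ℝ) (hε : 0 < ε) (hδ : 0 < δ) (ha : 0 < a)
    (f : ℝ → ℝ) (y : ℝ → ℝ → ℝ)
    (hf : ContDiffOn ℝ (⊤ : ℕ∞) f (Set.Ioo (t₀ - ε) (t₀ + ε)))
    (hy : ContDiffOn ℝ (⊤ : ℕ∞) (fun p : ℝ × ℝ => y p.1 p.2)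
      (Set.Ioo (-δ) δ ×ˢ Set.Ioo (t₀ - ε) (t₀ + ε)))
    (hf0 : f t₀ = 0) (hf1 : deriv f t₀ = 0) (hf2 : deriv (deriv f) t₀ = -2 * a)
    (t₁ t₂ : ℝ → ℝ)
    (hroots : ∀ᶠ c in nhdsWithin (0 : ℝ) (Set.Ioi 0),
      t₀ - ε < t₁ c ∧ t₁ c < t₀ ∧ t₀ < t₂ c ∧ t₂ c < t₀ + ε ∧
      f (t₁ c) + c = 0 ∧ f (t₂ c) + c = 0 ∧
      ∀ t ∈ Set.Ioo (t₁ c) (t₂ c), 0 < f t + c) :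
    Filter.Tendsto (fun c : ℝ => ∫ t in (t₁ c)..(t₂ c), y c t / Real.sqrt (f t + c))
      (nhdsWithin (0 : ℝ) (Set.Ioi 0)) (nhds (y 0 t₀ * π / Real.sqrt a)) := by
  have hI : Ioo (t₀ - ε) (t₀ + ε) ∈ nhds t₀ := Ioo_mem_nhds (by linarith) (by linarith)
  have hfd : ∀ᶠ x in nhds t₀, DifferentiableAt ℝ f x :=
    (eventually_mem_nhds_iff.2 hI).mono fun x hx =>
      (hf.contDiffAt hx).differentiableAt (by simp)
  have hd2 : HasDerivAt (deriv f) (-2 * a) t₀ :=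
    hf2 ▸ (differentiableAt_of_deriv_ne_zero (by rw [hf2]; linarith)).hasDerivAt
  have hyc : ∀ᶠ p : ℝ × ℝ in nhds (0, t₀), ContinuousAt (fun p : ℝ × ℝ => y p.1 p.2) p :=
    (eventually_mem_nhds_iff.2
      (prod_mem_nhds (Ioo_mem_nhds (by linarith) (by linarith)) hI)).mono fun p hp =>
        hy.continuousOn.continuousAt hp
  obtain ⟨ht₁, ht₂⟩ := tendsto_of_pos_add
    (eventually_neg_of_deriv_deriv_neg hf0 hf1 (by rw [hf2]; linarith) hfd)
    (hroots.mono fun c ⟨_, h1, h2, _, _, _, h3⟩ => ⟨h1, h2, h3⟩)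
  obtain ⟨hR, hRlim⟩ := tendsto_integral_div_sqrt_right ha hfd hf1 hd2 hyc ht₂
    (hroots.mono fun c ⟨_, _, h2, _, _, h, _⟩ => ⟨h2, h⟩)
  have hrefl : Tendsto (fun x => 2 * t₀ - x) (nhds t₀) (nhds t₀) := by
    have : ContinuousAt (fun x => 2 * t₀ - x) t₀ := by fun_prop
    simpa [ContinuousAt, two_mul] using this
  have hderiv : deriv (fun x => f (2 * t₀ - x)) = fun x => -deriv f (2 * t₀ - x) :=
    funext fun x => deriv_comp_const_sub (f := f) (2 * t₀) x
  have h2t : 2 * t₀ - t₀ = t₀ := by ring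
  obtain ⟨hL, hLlim⟩ := tendsto_integral_div_sqrt_right (t₀ := t₀) ha
    (f := fun x => f (2 * t₀ - x)) (y := fun c x => y c (2 * t₀ - x))
    (s := fun c => 2 * t₀ - t₁ c)
    ((hrefl.eventually hfd).mono fun x hx =>
      hx.comp (f := fun x => 2 * t₀ - x) x (by fun_prop))
    (by rw [hderiv]; simp [h2t, hf1])
    (by
      rw [hderiv]
      have := HasDerivAt.comp_const_sub (f := deriv f) (2 * t₀) t₀ (by rwa [h2t])
      simpa using this.fun_neg)
    (by
      have hp : Tendsto (fun p : ℝ × ℝ => (p.1, 2 * t₀ - p.2)) (nhds (0, t₀))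
          (nhds (0, t₀)) := by
        rw [nhds_prod_eq]
        exact tendsto_id.prodMap hrefl
      exact (hp.eventually hyc).mono fun p hp => hp.comp
        (f := fun p : ℝ × ℝ => (p.1, 2 * t₀ - p.2)) (by fun_prop))
    (hrefl.comp ht₁)
    (hroots.mono fun c ⟨_, h1, _, _, h, _, _⟩ => ⟨by linarith, by simpa using h⟩)
  have hsum := hLlim.add hRlim
  rw [h2t, ← mul_add, add_halves, div_mul_eq_mul_div] at hsum
  refine hsum.congr' ?_
  filter_upwards [hL, hR] with c hLc hRc
  have hLc' : IntervalIntegrable (fun t => y c t / √(f t + c)) volume (t₁ c) t₀ := by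
    have := hLc.comp_sub_left (2 * t₀)
    simp only [sub_sub_cancel, h2t] at this
    exact this.symm
  rw [← intervalIntegral.integral_add_adjacent_intervals hLc' hRc,
    intervalIntegral.integral_comp_sub_left (fun t => y c t / √(f t + c)), sub_sub_cancel, h2t]
end

section
/- Let n ≥ 5 be an integer, m = 4, H = 1, and define q_C(v) = C − v²(v^{−n}+1)^{1/2} − v² for v > 0, with unique positive critical point v₀ and c₀ = v₀²(v₀^{−n}+1)^{1/2} + v₀². For C > c₀ let t₁(C) < v₀ < t₂(C) be the two positive zeros of q_C and define P(C) = 2∫_{t₁(C)}^{t₂(C)} √C · t · (t^{−n}+1)^{1/4} / ((C−t²)·√(q_C(t))) dt. Then lim_{C→c₀⁺} P(C) = 2π/√(n−2). -/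
open Real Set Filter MeasureTheory

/-- The arcsine weight on `(x, y)` is integrable, with integral `π`. -/
lemma arcsine_weight_integral {x y : ℝ} (hxy : x < y) :
    IntervalIntegrable (fun t : ℝ => 1 / √((t - x) * (y - t))) volume x y ∧
      ∫ t in x..y, 1 / √((t - x) * (y - t)) = π := by
  have hd : 0 < y - x := sub_pos.2 hxy
  have hcont : Continuous fun t : ℝ => arcsin ((2 * t - x - y) / (y - x)) :=
    continuous_arcsin.comp (by fun_prop)
  have hderiv : ∀ t ∈ Ioo x y, HasDerivAt (fun t : ℝ => arcsin ((2 * t - x - y) / (y - x)))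
      (1 / √((t - x) * (y - t))) t := by
    rintro t ⟨h1, h2⟩
    have hne1 : (2 * t - x - y) / (y - x) ≠ -1 := by
      rw [Ne, div_eq_iff hd.ne']; intro h; linarith
    have hne2 : (2 * t - x - y) / (y - x) ≠ 1 := by
      rw [Ne, div_eq_iff hd.ne']; intro h; linarith
    have hlin : HasDerivAt (fun t : ℝ => (2 * t - x - y) / (y - x)) (2 / (y - x)) t := by
      simpa using ((((hasDerivAt_id t).const_mul 2).sub_const x).sub_const y).div_const (y - x)
    have hpos : 0 < (t - x) * (y - t) := mul_pos (by linarith) (by linarith)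
    have hsq : 1 - ((2 * t - x - y) / (y - x)) ^ 2
        = (2 / (y - x)) ^ 2 * ((t - x) * (y - t)) := by
      field_simp; ring
    have h := (hasDerivAt_arcsin hne1 hne2).comp t hlin
    rw [hsq, sqrt_mul (sq_nonneg _), sqrt_sq (by positivity)] at h
    refine h.congr_deriv ?_
    have := (sqrt_pos.2 hpos).ne'
    field_simp
  have hint : IntervalIntegrable (fun t : ℝ => 1 / √((t - x) * (y - t))) volume x y := by
    refine intervalIntegral.intervalIntegrable_deriv_of_nonneg
      (g := fun t : ℝ => arcsin ((2 * t - x - y) / (y - x))) hcont.continuousOn ?_ ?_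
    · rw [min_eq_left hxy.le, max_eq_right hxy.le]; exact hderiv
    · intro t _; positivity
  refine ⟨hint, ?_⟩
  rw [intervalIntegral.integral_eq_sub_of_hasDerivAt_of_le hxy.le hcont.continuousOn hderiv hint]
  have e1 : (2 * y - x - y) / (y - x) = 1 := by rw [div_eq_one_iff_eq hd.ne']; ring
  have e2 : (2 * x - x - y) / (y - x) = -1 := by rw [div_eq_iff hd.ne']; ring
  simp only [e1, e2, arcsin_one, arcsin_neg_one]
  ring

/-- A function with second derivative at least `2 * b` and equal values at the endpoints lies
below the corresponding parabola. -/
lemma parabola_le_of_second_deriv_ge {f f' f'' : ℝ → ℝ} {x y b c : ℝ} (hxy : x < y)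
    (hf : ∀ t ∈ Icc x y, HasDerivAt f (f' t) t)
    (hf' : ∀ t ∈ Icc x y, HasDerivAt f' (f'' t) t)
    (hb : ∀ t ∈ Icc x y, 2 * b ≤ f'' t) (hx : f x = c) (hy : f y = c)
    {t : ℝ} (ht : t ∈ Icc x y) : b * ((t - x) * (y - t)) ≤ c - f t := by
  have hsub : interior (Icc x y) ⊆ Icc x y := interior_subset
  have hconv : ConvexOn ℝ (Icc x y) (fun t => f t + b * ((t - x) * (y - t))) := by
    refine convexOn_of_hasDerivWithinAt2_nonneg (convex_Icc x y)
      (f' := fun t => f' t + b * (x + y - 2 * t)) (f'' := fun t => f'' t + b * (-2)) ?_ ?_ ?_ ?_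
    · refine ContinuousOn.add (fun t ht => (hf t ht).continuousAt.continuousWithinAt) ?_
      fun_prop
    · intro t ht
      have h1 : HasDerivAt (fun t : ℝ => (t - x) * (y - t)) (x + y - 2 * t) t :=
        (((hasDerivAt_id t).sub_const x).mul ((hasDerivAt_id t).const_sub y)).congr_deriv
          (by simp; ring)
      exact ((hf t (hsub ht)).add (h1.const_mul b)).hasDerivWithinAt
    · intro t ht
      have h1 : HasDerivAt (fun t : ℝ => x + y - 2 * t) (-2) t :=
        (((hasDerivAt_id t).const_mul 2).const_sub (x + y)).congr_deriv (by simp)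
      exact ((hf' t (hsub ht)).add (h1.const_mul b)).hasDerivWithinAt
    · intro t ht
      linarith [hb t (hsub ht)]
  have h := hconv.le_max_of_mem_Icc (left_mem_Icc.2 hxy.le) (right_mem_Icc.2 hxy.le) ht
  simp only [hx, hy, sub_self, zero_mul, mul_zero, add_zero, max_self] at h
  linarith

/-- The reverse bound, for a second derivative at most `2 * b`. -/
lemma le_parabola_of_second_deriv_le {f f' f'' : ℝ → ℝ} {x y b c : ℝ} (hxy : x < y)
    (hf : ∀ t ∈ Icc x y, HasDerivAt f (f' t) t)
    (hf' : ∀ t ∈ Icc x y, HasDerivAt f' (f'' t) t)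
    (hb : ∀ t ∈ Icc x y, f'' t ≤ 2 * b) (hx : f x = c) (hy : f y = c)
    {t : ℝ} (ht : t ∈ Icc x y) : c - f t ≤ b * ((t - x) * (y - t)) := by
  have h := parabola_le_of_second_deriv_ge (f := fun t => -f t) (f' := fun t => -f' t)
    (f'' := fun t => -f'' t) (b := -b) (c := -c) hxy (fun t ht => (hf t ht).neg)
    (fun t ht => (hf' t ht).neg) (fun t ht => by linarith [hb t ht]) (by simp [hx])
    (by simp [hy]) ht
  linarith

/-- A critical point is a strict minimum on an interval where the second derivative is
positive. -/
lemma lt_of_second_deriv_pos {f f' f'' : ℝ → ℝ} {v t : ℝ} (hv : f' v = 0) (hne : t ≠ v)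
    (hf : ∀ u ∈ uIcc v t, HasDerivAt f (f' u) u)
    (hf' : ∀ u ∈ uIcc v t, HasDerivAt f' (f'' u) u)
    (hpos : ∀ u ∈ uIcc v t, 0 < f'' u) : f v < f t := by
  rcases lt_or_gt_of_ne hne with h | h
  · rw [uIcc_of_ge h.le] at hf hf' hpos
    obtain ⟨ξ, hξ, e⟩ := exists_hasDerivAt_eq_slope f f' h
      (fun u hu => (hf u hu).continuousAt.continuousWithinAt)
      (fun u hu => hf u (Ioo_subset_Icc_self hu))
    obtain ⟨ζ, hζ, e'⟩ := exists_hasDerivAt_eq_slope f' f'' hξ.2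
      (fun u hu => (hf' u ⟨hξ.1.le.trans hu.1, hu.2⟩).continuousAt.continuousWithinAt)
      (fun u hu => hf' u ⟨hξ.1.le.trans hu.1.le, hu.2.le⟩)
    have hp := hpos ζ ⟨hξ.1.le.trans hζ.1.le, hζ.2.le⟩
    rw [eq_div_iff (by linarith [hξ.2]), hv] at e'
    rw [eq_div_iff (by linarith)] at e
    have := mul_pos hp (sub_pos.2 hξ.2)
    have := mul_pos (show 0 < -f' ξ by linarith) (sub_pos.2 h)
    linarith
  · rw [uIcc_of_le h.le] at hf hf' hpos
    obtain ⟨ξ, hξ, e⟩ := exists_hasDerivAt_eq_slope f f' h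
      (fun u hu => (hf u hu).continuousAt.continuousWithinAt)
      (fun u hu => hf u (Ioo_subset_Icc_self hu))
    obtain ⟨ζ, hζ, e'⟩ := exists_hasDerivAt_eq_slope f' f'' hξ.1
      (fun u hu => (hf' u ⟨hu.1, hu.2.trans hξ.2.le⟩).continuousAt.continuousWithinAt)
      (fun u hu => hf' u ⟨hu.1.le, hu.2.le.trans hξ.2.le⟩)
    have hp := hpos ζ ⟨hζ.1.le, hζ.2.le.trans hξ.2.le⟩
    rw [eq_div_iff (by linarith [hξ.1]), hv] at e'
    rw [eq_div_iff (by linarith)] at e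
    have := mul_pos hp (sub_pos.2 hξ.1)
    have := mul_pos (show 0 < f' ξ by linarith) (sub_pos.2 h)
    linarith

/-- Comparison of an integral on `(x, y)` with a multiple of the arcsine weight. -/
lemma abs_integral_sub_mul_pi_le {F : ℝ → ℝ} {x y L ε : ℝ} (hxy : x < y) (hF : Measurable F)
    (h : ∀ t ∈ Ioc x y, |F t - L * (1 / √((t - x) * (y - t)))|
      ≤ ε * (1 / √((t - x) * (y - t)))) :
    |(∫ t in x..y, F t) - L * π| ≤ ε * π := by
  obtain ⟨hw, hwi⟩ := arcsine_weight_integral hxy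
  have hD : IntervalIntegrable (fun t => F t - L * (1 / √((t - x) * (y - t)))) volume x y := by
    rw [intervalIntegrable_iff_integrableOn_Ioc_of_le hxy.le] at hw ⊢
    refine Integrable.mono' (hw.const_mul ε) ?_ ?_
    · exact Measurable.aestronglyMeasurable (by fun_prop)
    · exact (ae_restrict_iff' measurableSet_Ioc).2 (Eventually.of_forall h)
  have hFi : IntervalIntegrable F volume x y := by
    simpa using hD.add (hw.const_mul L)
  have e : (∫ t in x..y, F t) - L * π
      = ∫ t in x..y, (F t - L * (1 / √((t - x) * (y - t)))) := by
    rw [intervalIntegral.integral_sub hFi (hw.const_mul L), intervalIntegral.integral_const_mul,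
      hwi]
  have e' : ε * π = ∫ t in x..y, ε * (1 / √((t - x) * (y - t))) := by
    rw [intervalIntegral.integral_const_mul, hwi]
  rw [e, e', ← Real.norm_eq_abs]
  exact intervalIntegral.norm_integral_le_of_norm_le hxy.le (Eventually.of_forall h)
    (hw.const_mul ε)

/-- Limit of the period-type integral `∫ G / √(C - f)` over the potential well of `f` at a
nondegenerate minimum `v`. -/
lemma tendsto_well_integral {f f' f'' : ℝ → ℝ} {G : ℝ → ℝ → ℝ} {v a : ℝ} {t₁ t₂ : ℝ → ℝ}
    (hf : ∀ᶠ t in nhds v, HasDerivAt f (f' t) t)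
    (hf' : ∀ᶠ t in nhds v, HasDerivAt f' (f'' t) t)
    (hcrit : f' v = 0) (ha : 0 < a) (hfa : f'' v = 2 * a) (hf''c : ContinuousAt f'' v)
    (hfm : Measurable f) (hGm : ∀ C, Measurable (G C))
    (hGc : ContinuousAt (fun p : ℝ × ℝ => G p.1 p.2) (f v, v))
    (hroots : ∀ C, f v < C → t₁ C < v ∧ v < t₂ C ∧ f (t₁ C) = C ∧ f (t₂ C) = C ∧
      ∀ t ∈ Ioo (t₁ C) (t₂ C), f t < C) :
    Tendsto (fun C => ∫ t in (t₁ C)..(t₂ C), G C t / √(C - f t))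
      (nhdsWithin (f v) (Ioi (f v))) (nhds (G (f v) v / √a * π)) := by
  rw [Metric.tendsto_nhds]
  intro ε hε
  set L := G (f v) v / √a with hL
  have hquot : ContinuousAt (fun p : ℝ × ℝ => p.1 / √p.2) (G (f v) v, a) :=
    ContinuousAt.div (by fun_prop) (by fun_prop) (sqrt_pos.2 ha).ne'
  obtain ⟨δ, hδ, hquot⟩ := Metric.continuousAt_iff.1 hquot (ε / (2 * π)) (by positivity)
  obtain ⟨δ', hδ', hδδ, hδa⟩ : ∃ δ', 0 < δ' ∧ δ' < δ ∧ δ' < a :=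
    ⟨min δ a / 2, by positivity, by linarith [min_le_left δ a, lt_min hδ ha],
      by linarith [min_le_right δ a, lt_min hδ ha]⟩
  obtain ⟨η₁, hη₁, hGη⟩ := Metric.continuousAt_iff.1 hGc δ hδ
  obtain ⟨η₂, hη₂, hfη⟩ := Metric.continuousAt_iff.1 hf''c (2 * δ') (by positivity)
  obtain ⟨η₃, hη₃, hdη⟩ := Metric.eventually_nhds_iff.1 (hf.and hf')
  obtain ⟨η, hη, h1, h2, h3⟩ : ∃ η, 0 < η ∧ η < η₁ ∧ η < η₂ ∧ η < η₃ := by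
    obtain ⟨η, h, h'⟩ := exists_between (lt_min hη₁ (lt_min hη₂ hη₃))
    simp only [lt_min_iff] at h'
    exact ⟨η, h, h'.1, h'.2.1, h'.2.2⟩
  have hball : ∀ t ∈ Icc (v - η) (v + η), |t - v| ≤ η := by
    rintro t ⟨h, h'⟩; rw [abs_le]; constructor <;> linarith
  have hd : ∀ t ∈ Icc (v - η) (v + η), HasDerivAt f (f' t) t := fun t ht =>
    (hdη (by rw [Real.dist_eq]; linarith [hball t ht])).1
  have hd' : ∀ t ∈ Icc (v - η) (v + η), HasDerivAt f' (f'' t) t := fun t ht =>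
    (hdη (by rw [Real.dist_eq]; linarith [hball t ht])).2
  have hd'' : ∀ t ∈ Icc (v - η) (v + η), 2 * (a - δ') ≤ f'' t ∧ f'' t ≤ 2 * (a + δ') := by
    intro t ht
    have := hfη (x := t) (by rw [Real.dist_eq]; linarith [hball t ht])
    rw [Real.dist_eq, hfa, abs_lt] at this
    constructor <;> linarith
  have hvmem : v ∈ Icc (v - η) (v + η) := ⟨by linarith, by linarith⟩
  have hmin : ∀ t ∈ Icc (v - η) (v + η), t ≠ v → f v < f t := by
    intro t ht hne
    have hs : uIcc v t ⊆ Icc (v - η) (v + η) := uIcc_subset_Icc hvmem ht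
    exact lt_of_second_deriv_pos hcrit hne (fun u hu => hd u (hs hu))
      (fun u hu => hd' u (hs hu)) (fun u hu => by linarith [(hd'' u (hs hu)).1])
  have hl := hmin (v - η) ⟨le_rfl, by linarith⟩ (by linarith)
  have hr := hmin (v + η) ⟨by linarith, le_rfl⟩ (by linarith)
  have hC : ∀ᶠ C in nhdsWithin (f v) (Ioi (f v)),
      f v < C ∧ C < f (v - η) ∧ C < f (v + η) ∧ C < f v + η₁ := by
    refine (eventually_mem_nhdsWithin).and (eventually_nhdsWithin_of_eventually_nhds ?_)
    exact (eventually_lt_nhds hl).and ((eventually_lt_nhds hr).and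
      (eventually_lt_nhds (by linarith)))
  filter_upwards [hC] with C ⟨hC0, hCl, hCr, hCη⟩
  obtain ⟨hr1, hr2, hr3, hr4, hr5⟩ := hroots C hC0
  have hlt : t₁ C < t₂ C := hr1.trans hr2
  have ht1 : v - η < t₁ C := by
    by_contra! hc
    rcases hc.eq_or_lt with hc | hc
    · rw [hc] at hr3; linarith
    · linarith [hr5 (v - η) ⟨hc, by linarith⟩]
  have ht2 : t₂ C < v + η := by
    by_contra! hc
    rcases hc.eq_or_lt with hc | hc
    · rw [← hc] at hr4; linarith
    · linarith [hr5 (v + η) ⟨by linarith, hc⟩]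
  have hsub : Icc (t₁ C) (t₂ C) ⊆ Icc (v - η) (v + η) := Icc_subset_Icc ht1.le ht2.le
  have key : |(∫ t in (t₁ C)..(t₂ C), G C t / √(C - f t)) - L * π| ≤ ε / (2 * π) * π := by
    refine abs_integral_sub_mul_pi_le hlt (by have := hGm C; fun_prop) ?_
    rintro t ⟨hta, htb⟩
    rcases htb.eq_or_lt with rfl | htb
    · simp [hr4]
    have htI : t ∈ Icc (t₁ C) (t₂ C) := ⟨hta.le, htb.le⟩
    have hp : 0 < (t - t₁ C) * (t₂ C - t) := mul_pos (by linarith) (by linarith)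
    have hlow := parabola_le_of_second_deriv_ge hlt (fun u hu => hd u (hsub hu))
      (fun u hu => hd' u (hsub hu)) (fun u hu => (hd'' u (hsub hu)).1) hr3 hr4 htI
    have hupp := le_parabola_of_second_deriv_le hlt (fun u hu => hd u (hsub hu))
      (fun u hu => hd' u (hsub hu)) (fun u hu => (hd'' u (hsub hu)).2) hr3 hr4 htI
    set p := (t - t₁ C) * (t₂ C - t)
    obtain ⟨k, hk⟩ : ∃ k, k = (C - f t) / p := ⟨_, rfl⟩
    have hkp : C - f t = k * p := by rw [hk, div_mul_cancel₀ _ hp.ne']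
    rw [hkp] at hlow hupp ⊢
    have hk1 := le_of_mul_le_mul_right hlow hp
    have hk2 := le_of_mul_le_mul_right hupp hp
    have hG := hGη (x := (C, t)) (by
      rw [Prod.dist_eq, max_lt_iff, Real.dist_eq, Real.dist_eq]
      exact ⟨by rw [abs_lt]; constructor <;> linarith, by linarith [hball t (hsub htI)]⟩)
    have hq := hquot (x := (G C t, k)) (by
      rw [Prod.dist_eq, max_lt_iff]
      refine ⟨hG, ?_⟩
      rw [Real.dist_eq, abs_lt]; constructor <;> simp only <;> linarith)
    rw [Real.dist_eq] at hq
    have e : G C t / √(k * p) - L * (1 / √p) = (G C t / √k - L) * (1 / √p) := by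
      rw [sqrt_mul (by linarith)]
      ring
    rw [e, abs_mul, abs_of_nonneg (show 0 ≤ 1 / √p by positivity)]
    exact mul_le_mul_of_nonneg_right hq.le (by positivity)
  rw [Real.dist_eq]
  have : ε / (2 * π) * π = ε / 2 := by field_simp
  linarith

/-- Derivative of the profile `s(t) = (t⁻ⁿ + 1)^(1/2)`, expressed through `s` itself. -/
lemma hasDerivAt_profile (n : ℕ) {t : ℝ} (ht : 0 < t) :
    HasDerivAt (fun u : ℝ => (u ^ (-(n : ℝ)) + 1) ^ ((1 : ℝ) / 2))
      (-n * (((t ^ (-(n : ℝ)) + 1) ^ ((1 : ℝ) / 2)) ^ 2 - 1) /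
        (2 * (t ^ (-(n : ℝ)) + 1) ^ ((1 : ℝ) / 2) * t)) t := by
  have hp : 0 < t ^ (-(n : ℝ)) := rpow_pos_of_pos ht _
  have h1 : HasDerivAt (fun u : ℝ => u ^ (-(n : ℝ)) + 1) (-n * (t ^ (-(n : ℝ)) / t)) t := by
    rw [← rpow_sub_one ht.ne']
    exact (hasDerivAt_rpow_const (Or.inl ht.ne')).add_const 1
  simp only [← sqrt_eq_rpow]
  refine (h1.sqrt (by positivity)).congr_deriv ?_
  rw [sq_sqrt (by positivity)]
  have : 0 < √(t ^ (-(n : ℝ)) + 1) := by positivity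
  field_simp
  ring

/-- First derivative of the potential `t² s(t) + t²`. -/
lemma hasDerivAt_potential {s : ℝ → ℝ} {N t : ℝ} (hs : 0 < s t)
    (hd : HasDerivAt s (-N * (s t ^ 2 - 1) / (2 * s t * t)) t) :
    HasDerivAt (fun u => u ^ 2 * s u + u ^ 2)
      (t * (2 * s t - N / 2 * (s t - 1 / s t) + 2)) t := by
  have h := ((hasDerivAt_pow 2 t).mul hd).add (hasDerivAt_pow 2 t)
  refine h.congr_deriv ?_
  field_simp
  push_cast
  ring

/-- Second derivative of the potential `t² s(t) + t²`. -/
lemma hasDerivAt_deriv_potential {s : ℝ → ℝ} {N t : ℝ} (ht : 0 < t) (hs : 0 < s t)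
    (hd : HasDerivAt s (-N * (s t ^ 2 - 1) / (2 * s t * t)) t) :
    HasDerivAt (fun u => u * (2 * s u - N / 2 * (s u - 1 / s u) + 2))
      ((2 * s t - N / 2 * (s t - 1 / s t) + 2) -
        N * (s t ^ 2 - 1) / (2 * s t) * (2 - N / 2 * (1 + 1 / s t ^ 2))) t := by
  have hinv : HasDerivAt (fun u => 1 / s u)
      (-(-N * (s t ^ 2 - 1) / (2 * s t * t)) / s t ^ 2) t := by
    simpa only [one_div] using hd.fun_inv hs.ne'
  have h := (hasDerivAt_id t).mul
    (((hd.const_mul 2).sub ((hd.sub hinv).const_mul (N / 2))).add_const 2)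
  refine h.congr_deriv ?_
  simp only [id, Pi.sub_apply]
  field_simp
  ring

/-- Formula (5.10): for `m = 4`, `H₄ = 1`, `n ≥ 5`, the period
`P(C) = 2∫_{t₁(C)}^{t₂(C)} √C t (t^{-n}+1)^{1/4} / ((C-t²)√(q_C(t))) dt`
tends to `2π/√(n-2)` as `C → c₀⁺`, where `v₀` is the unique positive critical
point of `q_C(v) = C - v²(v^{-n}+1)^{1/2} - v²`, `c₀ = v₀²(v₀^{-n}+1)^{1/2}+v₀²`,
and `t₁(C) < v₀ < t₂(C)` are the two positive zeros of `q_C` for `C > c₀`. -/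
theorem limit_of_period_m4_H1 (n : ℕ) (hn : 5 ≤ n)
    (v₀ : ℝ) (hv₀ : 0 < v₀)
    (hcrit : ∀ C : ℝ,
      deriv (fun u : ℝ => C - u ^ 2 * (u ^ (-(n : ℝ)) + 1) ^ ((1 : ℝ) / 2) - u ^ 2) v₀ = 0)
    (huniq : ∀ C v : ℝ, 0 < v →
      deriv (fun u : ℝ => C - u ^ 2 * (u ^ (-(n : ℝ)) + 1) ^ ((1 : ℝ) / 2) - u ^ 2) v = 0 →
      v = v₀)
    (t₁ t₂ : ℝ → ℝ)
    (hroots : ∀ C : ℝ, v₀ ^ 2 * (v₀ ^ (-(n : ℝ)) + 1) ^ ((1 : ℝ) / 2) + v₀ ^ 2 < C →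
      0 < t₁ C ∧ t₁ C < v₀ ∧ v₀ < t₂ C ∧
      C - (t₁ C) ^ 2 * ((t₁ C) ^ (-(n : ℝ)) + 1) ^ ((1 : ℝ) / 2) - (t₁ C) ^ 2 = 0 ∧
      C - (t₂ C) ^ 2 * ((t₂ C) ^ (-(n : ℝ)) + 1) ^ ((1 : ℝ) / 2) - (t₂ C) ^ 2 = 0 ∧
      ∀ t ∈ Set.Ioo (t₁ C) (t₂ C),
        0 < C - t ^ 2 * (t ^ (-(n : ℝ)) + 1) ^ ((1 : ℝ) / 2) - t ^ 2) :
    Filter.Tendsto (fun C : ℝ =>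
        2 * ∫ t in (t₁ C)..(t₂ C),
          Real.sqrt C * t * (t ^ (-(n : ℝ)) + 1) ^ ((1 : ℝ) / 4) /
            ((C - t ^ 2) *
              Real.sqrt (C - t ^ 2 * (t ^ (-(n : ℝ)) + 1) ^ ((1 : ℝ) / 2) - t ^ 2)))
      (nhdsWithin (v₀ ^ 2 * (v₀ ^ (-(n : ℝ)) + 1) ^ ((1 : ℝ) / 2) + v₀ ^ 2)
        (Set.Ioi (v₀ ^ 2 * (v₀ ^ (-(n : ℝ)) + 1) ^ ((1 : ℝ) / 2) + v₀ ^ 2)))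
      (nhds (2 * π / Real.sqrt ((n : ℝ) - 2))) := by
  set s : ℝ → ℝ := fun u => (u ^ (-(n : ℝ)) + 1) ^ ((1 : ℝ) / 2) with hs_def
  set N : ℝ := (n : ℝ) with hN
  have hN5 : 5 ≤ N := by rw [hN]; exact_mod_cast hn
  have hspos : ∀ t, 0 < t → 0 < s t := fun t ht => by
    have := rpow_pos_of_pos ht (-N)
    exact rpow_pos_of_pos (by linarith) _
  have hsd : ∀ t, 0 < t → HasDerivAt s (-N * (s t ^ 2 - 1) / (2 * s t * t)) t :=
    fun t ht => hasDerivAt_profile n ht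
  have hquart : ∀ t, 0 < t → (t ^ (-N) + 1) ^ ((1 : ℝ) / 4) = √(s t) := fun t ht => by
    have := rpow_pos_of_pos ht (-N)
    rw [sqrt_eq_rpow, hs_def]
    simp only
    rw [← rpow_mul (by linarith)]
    norm_num
  have hcrit' : v₀ * (2 * s v₀ - N / 2 * (s v₀ - 1 / s v₀) + 2) = 0 := by
    have h := ((hasDerivAt_potential (hspos _ hv₀) (hsd _ hv₀)).const_sub 0).deriv
    have h0 := hcrit 0
    simp only [sub_sub] at h0
    rw [h] at h0
    linarith
  have hs0 : s v₀ = N / (N - 4) := by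
    have hp := hspos _ hv₀
    have h := (mul_eq_zero.1 hcrit').resolve_left hv₀.ne'
    field_simp at h
    have h' : (s v₀ + 1) * (s v₀ * (N - 4) - N) = 0 := by linarith
    rw [eq_div_iff (by linarith)]
    linarith [(mul_eq_zero.1 h').resolve_left (by linarith)]
  have hsc : ContinuousAt s v₀ := (hsd _ hv₀).continuousAt
  have hN4 : N - 4 ≠ 0 := by linarith
  have hN0 : N ≠ 0 := by linarith
  have hev : ∀ᶠ t in nhds v₀, 0 < t := lt_mem_nhds hv₀
  have main := tendsto_well_integral
    (f := fun u => u ^ 2 * s u + u ^ 2)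
    (f' := fun u => u * (2 * s u - N / 2 * (s u - 1 / s u) + 2))
    (f'' := fun t => (2 * s t - N / 2 * (s t - 1 / s t) + 2) -
        N * (s t ^ 2 - 1) / (2 * s t) * (2 - N / 2 * (1 + 1 / s t ^ 2)))
    (G := fun C t => √C * t * (t ^ (-N) + 1) ^ ((1 : ℝ) / 4) / (C - t ^ 2))
    (v := v₀) (a := 2 * (N - 2) ^ 2 / N) (t₁ := t₁) (t₂ := t₂)
    (hev.mono fun t ht => hasDerivAt_potential (hspos t ht) (hsd t ht))
    (hev.mono fun t ht => hasDerivAt_deriv_potential ht (hspos t ht) (hsd t ht))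
    hcrit' (div_pos (mul_pos two_pos (pow_pos (by linarith) 2)) (by linarith))
    (by simp only [hs0]; field_simp; ring)
    (by
      have h1 := (hspos _ hv₀).ne'
      fun_prop (disch := first | assumption | positivity))
    (by fun_prop) (by intro C; fun_prop)
    (by
      have h1 := hspos _ hv₀
      have h2 := rpow_pos_of_pos hv₀ (-N)
      refine ContinuousAt.div ?_ (by fun_prop) ?_
      · refine ContinuousAt.mul (by fun_prop) ?_
        exact ((continuousAt_snd.rpow_const (Or.inl hv₀.ne')).add_const 1).rpow_const
          (Or.inl (by simp only; linarith))
      · simp only [add_sub_cancel_right]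
        positivity)
    (by
      intro C hC
      obtain ⟨-, h1, h2, h3, h4, h5⟩ := hroots C hC
      refine ⟨h1, h2, by simp only [hs_def]; linarith, by simp only [hs_def]; linarith, ?_⟩
      intro t ht
      have := h5 t ht
      simp only [hs_def]
      linarith)
  have hval : √(v₀ ^ 2 * s v₀ + v₀ ^ 2) * v₀ * (v₀ ^ (-N) + 1) ^ ((1 : ℝ) / 4) /
      (v₀ ^ 2 * s v₀ + v₀ ^ 2 - v₀ ^ 2) / √(2 * (N - 2) ^ 2 / N) = 1 / √(N - 2) := by
    have hp := hspos _ hv₀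
    have hN2 : 0 < N - 2 := by linarith
    have hN4' : 0 < N - 4 := by linarith
    have hNp : 0 < N := by linarith
    rw [hquart _ hv₀, add_sub_cancel_right]
    refine (pow_left_inj₀ (by positivity) (by positivity) two_ne_zero).1 ?_
    simp only [div_pow, mul_pow]
    rw [sq_sqrt (by positivity), sq_sqrt hp.le, sq_sqrt (by positivity), sq_sqrt hN2.le, hs0]
    field_simp
    ring
  have hfin := main.const_mul 2
  simp only [hval] at hfin
  convert hfin using 2
  · congr 1
    refine intervalIntegral.integral_congr fun t _ => ?_
    simp only [hs_def, div_div, sub_sub]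
  · ring
end

section
/- Let n > m ≥ 1 be integers, H > 0 a real number, and define q_C(v) = C − v²(v^{−n}+H)^{2/m} − v² for v > 0, with unique positive critical point v₀ and c₀ = v₀²(v₀^{−n}+H)^{2/m}+v₀². For C > c₀ let t₁(C) < v₀ < t₂(C) be the two positive zeros of q_C and define P(H,m,n,C) = 2∫_{t₁(C)}^{t₂(C)} √C·t·(t^{−n}+H)^{1/m}/((C−t²)·√(q_C(t))) dt. Then lim_{C→+∞} P(H,m,n,C) = 2·arctan(1/H^{1/m}). -/
open Real Set Filter MeasureTheory

theorem hasDerivAt_arctan_inv {k : ℝ → ℝ} {k' t : ℝ} (hk : HasDerivAt k k' t) (hpos : 0 < k t) :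
    HasDerivAt (fun u => arctan (k u)⁻¹) (-k' / (1 + k t ^ 2)) t := by
  convert (hk.fun_inv hpos.ne').arctan using 1
  field_simp
  ring

theorem hasDerivAt_energy {k : ℝ → ℝ} {k' t : ℝ} (hk : HasDerivAt k k' t) :
    HasDerivAt (fun u => u ^ 2 * (1 + k u ^ 2))
      (2 * t * (1 + k t ^ 2) + 2 * t ^ 2 * k t * k') t := by
  refine (((hasDerivAt_id' t).fun_pow 2).fun_mul ((hk.fun_pow 2).const_add 1)).congr_deriv ?_
  push_cast
  ring

theorem hasDerivAt_arctan_sqrt {k : ℝ → ℝ} {k' t C : ℝ} (hk : HasDerivAt k k' t)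
    (hpos : 0 < k t) (hC : 0 < C) (hq : 0 < C - t ^ 2 * (1 + k t ^ 2)) :
    HasDerivAt (fun u => arctan (√(C - u ^ 2 * (1 + k u ^ 2)) / (√C * k u)))
      (√C / √(C - t ^ 2 * (1 + k t ^ 2)) * (-k' / (1 + k t ^ 2)) -
        √C * t * k t / ((C - t ^ 2) * √(C - t ^ 2 * (1 + k t ^ 2)))) t := by
  have h1 := ((hasDerivAt_energy hk).const_sub C).sqrt hq.ne'
  have hs : 0 < √(C - t ^ 2 * (1 + k t ^ 2)) := sqrt_pos.2 hq
  have hc : 0 < √C := sqrt_pos.2 hC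
  have h2 := (h1.fun_div (hk.const_mul √C) (by positivity)).arctan
  have hs2 := sq_sqrt hq.le
  have hc2 := sq_sqrt hC.le
  convert h2 using 1
  set s := √(C - t ^ 2 * (1 + k t ^ 2))
  set c := √C
  have hD : 0 < C - t ^ 2 := by nlinarith [mul_nonneg (sq_nonneg t) (sq_nonneg (k t))]
  have e : 1 + (s / (c * k t)) ^ 2 = (C - t ^ 2) * (1 + k t ^ 2) / (c ^ 2 * k t ^ 2) := by
    field_simp
    rw [hs2, hc2]; ring
  rw [e]
  field_simp
  rw [hs2]
  ring

theorem hasDerivAt_sqrt_div_sub_one {G : ℝ → ℝ} {G' t C : ℝ} (hG : HasDerivAt G G' t)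
    (hpos : 0 < G t) (hq : 0 < C - G t) :
    HasDerivAt (fun u => √(C / G u - 1))
      (-(C * G' / (2 * (G t * √(G t)) * √(C - G t)))) t := by
  have h0 : 0 < C / G t - 1 := by
    rw [sub_pos, lt_div_iff₀ hpos]; linarith
  simp only [div_eq_mul_inv C] at h0 ⊢
  convert ((hG.fun_inv hpos.ne').const_mul C |>.sub_const 1).sqrt h0.ne' using 1
  have e : C * (G t)⁻¹ - 1 = (C - G t) / G t := by field_simp
  rw [e, sqrt_div hq.le]
  have : 0 < √(G t) := sqrt_pos.2 hpos
  have : 0 < √(C - G t) := sqrt_pos.2 hq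
  have e2 := sq_sqrt hpos.le
  field_simp
  rw [e2]

theorem integral_bounds_of_deriv_bounds {f A A' B B' : ℝ → ℝ} {a b : ℝ} (hab : a ≤ b)
    (hA : ContinuousOn A (Icc a b)) (hA' : ∀ t ∈ Ioo a b, HasDerivAt A (A' t) t)
    (hB : ContinuousOn B (Icc a b)) (hB' : ∀ t ∈ Ioo a b, HasDerivAt B (B' t) t)
    (hf : ContinuousOn f (Ioo a b)) (hf0 : ∀ t ∈ Ioo a b, 0 ≤ f t)
    (hAf : ∀ t ∈ Ioo a b, A' t ≤ f t) (hfB : ∀ t ∈ Ioo a b, f t ≤ B' t) :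
    IntervalIntegrable f volume a b ∧ A b - A a ≤ ∫ t in a..b, f t ∧
      ∫ t in a..b, f t ≤ B b - B a := by
  have hi : IntegrableOn B' (Ioc a b) :=
    intervalIntegral.integrableOn_deriv_of_nonneg hB hB'
      fun t ht => (hf0 t ht).trans (hfB t ht)
  have hfi : IntegrableOn f (Ioo a b) := by
    refine Integrable.mono' (hi.mono_set Ioo_subset_Ioc_self)
      (hf.aestronglyMeasurable measurableSet_Ioo) ?_
    filter_upwards [ae_restrict_mem measurableSet_Ioo] with t ht
    rw [norm_of_nonneg (hf0 t ht)]
    exact hfB t ht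
  have hfc : IntegrableOn f (Icc a b) := by
    rwa [integrableOn_Icc_iff_integrableOn_Ioo]
  exact ⟨(intervalIntegrable_iff_integrableOn_Ioo_of_le hab).2 hfi,
    intervalIntegral.sub_le_integral_of_hasDeriv_right_of_le hab hA
      (fun t ht => (hA' t ht).hasDerivWithinAt) hfc hAf,
    intervalIntegral.integral_le_sub_of_hasDeriv_right_of_le hab hB
      (fun t ht => (hB' t ht).hasDerivWithinAt) hfc hfB⟩

theorem weight_le_of_tail {t k k' C K x : ℝ} (ht : 0 < t) (hC : 0 < C)
    (hq : 0 < C - t ^ 2 * (1 + k ^ 2)) (h : -k' * t ^ 2 * √(1 + k ^ 2) ≤ 2 * K * x) :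
    √C / √(C - t ^ 2 * (1 + k ^ 2)) * (-k' / (1 + k ^ 2)) ≤
      2 * K / √C * (C * (2 * t * x) / (2 * (t ^ 2 * (1 + k ^ 2) * √(t ^ 2 * (1 + k ^ 2))) *
        √(C - t ^ 2 * (1 + k ^ 2)))) := by
  have hs : 0 < √(C - t ^ 2 * (1 + k ^ 2)) := sqrt_pos.2 hq
  have hc : 0 < √C := sqrt_pos.2 hC
  have hc2 := sq_sqrt hC.le
  have hr : 0 < √(1 + k ^ 2) := sqrt_pos.2 (by positivity)
  have e : √(t ^ 2 * (1 + k ^ 2)) = t * √(1 + k ^ 2) := by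
    rw [sqrt_mul (sq_nonneg t), sqrt_sq ht.le]
  rw [e]
  have e1 : √C / √(C - t ^ 2 * (1 + k ^ 2)) * (-k' / (1 + k ^ 2)) =
      √C / (√(C - t ^ 2 * (1 + k ^ 2)) * (1 + k ^ 2) * t ^ 2 * √(1 + k ^ 2)) *
        (-k' * t ^ 2 * √(1 + k ^ 2)) := by
    field_simp
  have e2 : 2 * K / √C * (C * (2 * t * x) / (2 * (t ^ 2 * (1 + k ^ 2) * (t * √(1 + k ^ 2))) *
        √(C - t ^ 2 * (1 + k ^ 2)))) =
      √C / (√(C - t ^ 2 * (1 + k ^ 2)) * (1 + k ^ 2) * t ^ 2 * √(1 + k ^ 2)) * (2 * K * x) := by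
    field_simp
    rw [hc2]
  rw [e1, e2]
  gcongr

theorem two_mul_div_sqrt_mul_sqrt_le {K C G : ℝ} (hK : 0 ≤ K) (hC : 0 < C) (hG : 0 < G) :
    2 * K / √C * √(C / G - 1) ≤ 2 * K / √G := by
  have hc : 0 < √C := sqrt_pos.2 hC
  calc 2 * K / √C * √(C / G - 1) ≤ 2 * K / √C * √(C / G) := by gcongr; linarith
    _ = 2 * K / √G := by rw [sqrt_div hC.le]; field_simp

theorem period_bounds {k k' : ℝ → ℝ} (hk : ∀ t, 0 < t → HasDerivAt k (k' t) t)
    (hpos : ∀ t, 0 < t → 0 < k t) (hneg : ∀ t, 0 < t → k' t ≤ 0)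
    {a b δ L C K M : ℝ} (ha : 0 < a) (haδ : a ≤ δ) (hδL : δ ≤ L) (hLb : L ≤ b) (hC : 0 < C)
    (hq : ∀ t ∈ Ioo a b, 0 < C - t ^ 2 * (1 + k t ^ 2))
    (hqa : C - a ^ 2 * (1 + k a ^ 2) = 0) (hqb : C - b ^ 2 * (1 + k b ^ 2) = 0) (hK : 0 ≤ K)
    (h0 : ∀ t, 0 < t → t < δ →
      -k' t * t ^ 2 * √(1 + k t ^ 2) ≤ 2 * K * (-(1 + k t ^ 2 + t * k t * k' t)))
    (h1 : ∀ t, L < t →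
      -k' t * t ^ 2 * √(1 + k t ^ 2) ≤ 2 * K * (1 + k t ^ 2 + t * k t * k' t))
    (hM : ∀ t ∈ Icc δ L, t ^ 2 * (1 + k t ^ 2) ≤ M) (hMC : M < C) :
    arctan (k L)⁻¹ - arctan (k δ)⁻¹ ≤ ∫ t in a..b, √C * t * k t /
        ((C - t ^ 2) * √(C - t ^ 2 * (1 + k t ^ 2))) ∧
      ∫ t in a..b, √C * t * k t / ((C - t ^ 2) * √(C - t ^ 2 * (1 + k t ^ 2))) ≤
        √C / √(C - M) * (arctan (k L)⁻¹ - arctan (k δ)⁻¹) +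
          (2 * K / √(δ ^ 2 * (1 + k δ ^ 2)) + 2 * K / √(L ^ 2 * (1 + k L ^ 2))) := by
  have hc : 0 < √C := sqrt_pos.2 hC
  have hδ : 0 < δ := ha.trans_le haδ
  have hL : 0 < L := hδ.trans_le hδL
  have hkc : ∀ s ⊆ Ioi (0 : ℝ), ContinuousOn k s := fun s hs t ht =>
    (hk t (hs ht)).continuousAt.continuousWithinAt
  have hG : ∀ t, 0 < t → 0 < t ^ 2 * (1 + k t ^ 2) := fun t ht => by positivity
  set f : ℝ → ℝ := fun t => √C * t * k t / ((C - t ^ 2) * √(C - t ^ 2 * (1 + k t ^ 2))) with hf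
  set A : ℝ → ℝ := fun u => arctan (√(C - u ^ 2 * (1 + k u ^ 2)) / (√C * k u)) with hA
  set J : ℝ → ℝ := fun t => √C / √(C - t ^ 2 * (1 + k t ^ 2)) * (-k' t / (1 + k t ^ 2)) with hJ
  set U : ℝ → ℝ := fun t => arctan (k t)⁻¹ with hU
  set B : ℝ → ℝ := fun u => √(C / (u ^ 2 * (1 + k u ^ 2)) - 1) with hB
  have hAc : ∀ s ⊆ Ioi (0 : ℝ), ContinuousOn A s := fun s hs => by
    have := hkc s hs
    refine continuous_arctan.comp_continuousOn (ContinuousOn.div (by fun_prop) (by fun_prop) ?_)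
    exact fun t ht => (mul_pos hc (hpos t (hs ht))).ne'
  have hBc : ∀ s ⊆ Ioi (0 : ℝ), ContinuousOn B s := fun s hs => by
    have := hkc s hs
    refine ContinuousOn.sqrt (ContinuousOn.sub (ContinuousOn.div (by fun_prop) (by fun_prop) ?_)
      (by fun_prop))
    exact fun t ht => (hG t (hs ht)).ne'
  have hUd : ∀ t, 0 < t → HasDerivAt U (-k' t / (1 + k t ^ 2)) t := fun t ht =>
    hasDerivAt_arctan_inv (hk t ht) (hpos t ht)
  have hUc : ∀ s ⊆ Ioi (0 : ℝ), ContinuousOn U s := fun s hs t ht =>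
    (hUd t (hs ht)).continuousAt.continuousWithinAt
  have hAd : ∀ t ∈ Ioo a b, HasDerivAt A (J t - f t) t := fun t ht =>
    hasDerivAt_arctan_sqrt (hk t (ha.trans ht.1)) (hpos t (ha.trans ht.1)) hC (hq t ht)
  have hBd : ∀ t ∈ Ioo a b, HasDerivAt B _ t := fun t ht =>
    hasDerivAt_sqrt_div_sub_one (hasDerivAt_energy (hk t (ha.trans ht.1)))
      (hG t (ha.trans ht.1)) (hq t ht)
  have hw : ∀ t, 0 < t → 0 ≤ -k' t / (1 + k t ^ 2) := fun t ht =>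
    div_nonneg (neg_nonneg.2 (hneg t ht)) (by positivity)
  have hJ0 : ∀ t, 0 < t → 0 ≤ J t := fun t ht => mul_nonneg (by positivity) (hw t ht)
  have hD : ∀ t ∈ Ioo a b, 0 < C - t ^ 2 := fun t ht => by
    nlinarith [hq t ht, mul_nonneg (sq_nonneg t) (sq_nonneg (k t))]
  have hf0 : ∀ t ∈ Ioo a b, 0 ≤ f t := fun t ht => by
    have := hD t ht
    have := hpos t (ha.trans ht.1)
    have := ha.trans ht.1
    positivity
  have hfc : ContinuousOn f (Ioo a b) := by
    have := hkc (Ioo a b) fun t ht => ha.trans ht.1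
    refine ContinuousOn.div (by fun_prop) (by fun_prop) ?_
    exact fun t ht => (mul_pos (hD t ht) (sqrt_pos.2 (hq t ht))).ne'
  have hAa : A a = 0 := by simp [hA, hqa]
  have hAb : A b = 0 := by simp [hA, hqb]
  have s1 : Ioo a δ ⊆ Ioo a b := Ioo_subset_Ioo_right (hδL.trans hLb)
  have s2 : Ioo δ L ⊆ Ioo a b := Ioo_subset_Ioo haδ hLb
  have s3 : Ioo L b ⊆ Ioo a b := Ioo_subset_Ioo_left (haδ.trans hδL)
  have p1 : Icc a δ ⊆ Ioi 0 := fun t ht => ha.trans_le ht.1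
  have p2 : Icc δ L ⊆ Ioi 0 := fun t ht => hδ.trans_le ht.1
  have p3 : Icc L b ⊆ Ioi 0 := fun t ht => hL.trans_le ht.1
  obtain ⟨i1, l1, u1⟩ := integral_bounds_of_deriv_bounds (f := f) haδ (hAc _ p1).fun_neg
    (fun t ht => (hAd t (s1 ht)).fun_neg)
    (((hBc _ p1).const_mul (2 * K / √C)).fun_sub (hAc _ p1))
    (fun t ht => ((hBd t (s1 ht)).const_mul (2 * K / √C)).fun_sub (hAd t (s1 ht)))
    (hfc.mono s1) (fun t ht => hf0 t (s1 ht))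
    (fun t ht => by linarith [hJ0 t (ha.trans ht.1)])
    (fun t ht => by
      have := weight_le_of_tail (ha.trans ht.1) hC (hq t (s1 ht)) (h0 t (ha.trans ht.1) ht.2)
      refine le_of_sub_nonneg ?_
      rw [← sub_nonneg] at this
      convert this using 1
      simp only [hJ]
      ring)
  obtain ⟨i2, l2, u2⟩ := integral_bounds_of_deriv_bounds (f := f) hδL
    ((hUc _ p2).fun_sub (hAc _ p2))
    (fun t ht => (hUd t (hδ.trans ht.1)).fun_sub (hAd t (s2 ht)))
    (((hUc _ p2).const_mul (√C / √(C - M))).fun_sub (hAc _ p2))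
    (fun t ht => ((hUd t (hδ.trans ht.1)).const_mul (√C / √(C - M))).fun_sub (hAd t (s2 ht)))
    (hfc.mono s2) (fun t ht => hf0 t (s2 ht))
    (fun t ht => by
      have : 1 ≤ √C / √(C - t ^ 2 * (1 + k t ^ 2)) := by
        rw [one_le_div (sqrt_pos.2 (hq t (s2 ht)))]
        exact sqrt_le_sqrt (by linarith [hG t (hδ.trans ht.1)])
      have := mul_le_mul_of_nonneg_right this (hw t (hδ.trans ht.1))
      simp only [hJ]
      linarith)
    (fun t ht => by
      have : √C / √(C - t ^ 2 * (1 + k t ^ 2)) ≤ √C / √(C - M) := by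
        have : 0 < √(C - M) := sqrt_pos.2 (by linarith)
        have := hM t (Ioo_subset_Icc_self ht)
        gcongr
      have := mul_le_mul_of_nonneg_right this (hw t (hδ.trans ht.1))
      simp only [hJ]
      linarith)
  obtain ⟨i3, l3, u3⟩ := integral_bounds_of_deriv_bounds (f := f) hLb (hAc _ p3).fun_neg
    (fun t ht => (hAd t (s3 ht)).fun_neg)
    (((hBc _ p3).const_mul (-(2 * K / √C))).fun_sub (hAc _ p3))
    (fun t ht => ((hBd t (s3 ht)).const_mul (-(2 * K / √C))).fun_sub (hAd t (s3 ht)))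
    (hfc.mono s3) (fun t ht => hf0 t (s3 ht))
    (fun t ht => by linarith [hJ0 t (hL.trans ht.1)])
    (fun t ht => by
      have := weight_le_of_tail (hL.trans ht.1) hC (hq t (s3 ht)) (h1 t ht.1)
      refine le_of_sub_nonneg ?_
      rw [← sub_nonneg] at this
      convert this using 1
      simp only [hJ]
      ring)
  have hBa : 0 ≤ 2 * K / √C * B a := by positivity
  have hBb : 0 ≤ 2 * K / √C * B b := by positivity
  have b1 := two_mul_div_sqrt_mul_sqrt_le hK hC (hG δ hδ)
  have b2 := two_mul_div_sqrt_mul_sqrt_le hK hC (hG L hL)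
  have hsum : ∫ t in a..b, f t = (∫ t in a..δ, f t) + (∫ t in δ..L, f t) + ∫ t in L..b, f t := by
    rw [intervalIntegral.integral_add_adjacent_intervals i1 i2,
      intervalIntegral.integral_add_adjacent_intervals (i1.trans i2) i3]
  rw [hsum]
  constructor <;> linarith

theorem eventually_period_bounds {k k' : ℝ → ℝ} (hk : ∀ t, 0 < t → HasDerivAt k (k' t) t)
    (hpos : ∀ t, 0 < t → 0 < k t) (hneg : ∀ t, 0 < t → k' t ≤ 0)
    {v₀ c₀ δ L K : ℝ} {t₁ t₂ : ℝ → ℝ}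
    (hroots : ∀ C, c₀ < C → 0 < t₁ C ∧ t₁ C < v₀ ∧ v₀ < t₂ C ∧
      C - t₁ C ^ 2 * (1 + k (t₁ C) ^ 2) = 0 ∧ C - t₂ C ^ 2 * (1 + k (t₂ C) ^ 2) = 0 ∧
      ∀ t ∈ Ioo (t₁ C) (t₂ C), 0 < C - t ^ 2 * (1 + k t ^ 2))
    (hδ : 0 < δ) (hδv : δ < v₀) (hvL : v₀ < L) (hK : 0 ≤ K)
    (h0 : ∀ t, 0 < t → t < δ →
      -k' t * t ^ 2 * √(1 + k t ^ 2) ≤ 2 * K * (-(1 + k t ^ 2 + t * k t * k' t)))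
    (h1 : ∀ t, L < t →
      -k' t * t ^ 2 * √(1 + k t ^ 2) ≤ 2 * K * (1 + k t ^ 2 + t * k t * k' t)) :
    ∃ M : ℝ, ∀ᶠ C in atTop,
      arctan (k L)⁻¹ - arctan (k δ)⁻¹ ≤ ∫ t in t₁ C..t₂ C, √C * t * k t /
          ((C - t ^ 2) * √(C - t ^ 2 * (1 + k t ^ 2))) ∧
        ∫ t in t₁ C..t₂ C, √C * t * k t / ((C - t ^ 2) * √(C - t ^ 2 * (1 + k t ^ 2))) ≤
          √C / √(C - M) * (arctan (k L)⁻¹ - arctan (k δ)⁻¹) +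
            (2 * K / √(δ ^ 2 * (1 + k δ ^ 2)) + 2 * K / √(L ^ 2 * (1 + k L ^ 2))) := by
  have hkc : ContinuousOn k (Icc δ L) := fun t ht =>
    (hk t (hδ.trans_le ht.1)).continuousAt.continuousWithinAt
  obtain ⟨M, hM⟩ := isCompact_Icc.exists_bound_of_continuousOn
    (f := fun t => t ^ 2 * (1 + k t ^ 2)) (s := Icc δ L) (by fun_prop)
  have hM' : ∀ t ∈ Icc δ L, t ^ 2 * (1 + k t ^ 2) ≤ M := fun t ht =>
    (le_norm_self _).trans (hM t ht)
  refine ⟨M, ?_⟩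
  filter_upwards [eventually_gt_atTop c₀, eventually_gt_atTop M, eventually_gt_atTop 0]
    with C hC hMC hC0
  obtain ⟨ha, hav, hvb, hqa, hqb, hq⟩ := hroots C hC
  have haδ : t₁ C ≤ δ := by
    by_contra! h
    linarith [hM' _ ⟨h.le, (hav.trans hvL).le⟩]
  have hLb : L ≤ t₂ C := by
    by_contra! h
    linarith [hM' _ ⟨(hδv.trans hvb).le, h.le⟩]
  exact period_bounds hk hpos hneg ha haδ (hδv.trans hvL).le hLb hC0 hq hqa hqb hK h0 h1 hM' hMC

theorem tendsto_sqrt_div_sqrt_sub (M : ℝ) : Tendsto (fun C => √C / √(C - M)) atTop (nhds 1) := by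
  have h : Tendsto (fun C : ℝ => (√(1 - M / C))⁻¹) atTop (nhds (√(1 - 0))⁻¹) :=
    ((tendsto_const_nhds.sub (tendsto_const_nhds.div_atTop tendsto_id)).sqrt).inv₀ (by simp)
  rw [sub_zero, sqrt_one, inv_one] at h
  refine h.congr' ?_
  filter_upwards [eventually_gt_atTop 0, eventually_gt_atTop M] with C hC hM
  rw [one_sub_div hC.ne', sqrt_div (by linarith), inv_div]

theorem tendsto_half_period {k k' : ℝ → ℝ} (hk : ∀ t, 0 < t → HasDerivAt k (k' t) t)
    (hpos : ∀ t, 0 < t → 0 < k t) (hneg : ∀ t, 0 < t → k' t ≤ 0)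
    {v₀ c₀ K a : ℝ} {t₁ t₂ : ℝ → ℝ} (hv₀ : 0 < v₀)
    (hroots : ∀ C, c₀ < C → 0 < t₁ C ∧ t₁ C < v₀ ∧ v₀ < t₂ C ∧
      C - t₁ C ^ 2 * (1 + k (t₁ C) ^ 2) = 0 ∧ C - t₂ C ^ 2 * (1 + k (t₂ C) ^ 2) = 0 ∧
      ∀ t ∈ Ioo (t₁ C) (t₂ C), 0 < C - t ^ 2 * (1 + k t ^ 2))
    (hK : 0 ≤ K) (ha : 0 < a)
    (hk0 : Tendsto k (nhdsWithin 0 (Ioi 0)) atTop) (hk1 : Tendsto k atTop (nhds a))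
    (hG0 : Tendsto (fun t => t * k t) (nhdsWithin 0 (Ioi 0)) atTop)
    (h0 : ∀ᶠ t in nhdsWithin 0 (Ioi 0),
      -k' t * t ^ 2 * √(1 + k t ^ 2) ≤ 2 * K * (-(1 + k t ^ 2 + t * k t * k' t)))
    (h1 : ∀ᶠ t in atTop,
      -k' t * t ^ 2 * √(1 + k t ^ 2) ≤ 2 * K * (1 + k t ^ 2 + t * k t * k' t)) :
    Tendsto (fun C => ∫ t in t₁ C..t₂ C, √C * t * k t /
      ((C - t ^ 2) * √(C - t ^ 2 * (1 + k t ^ 2)))) atTop (nhds (arctan a⁻¹)) := by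
  have hU0 : Tendsto (fun t => arctan (k t)⁻¹) (nhdsWithin 0 (Ioi 0)) (nhds 0) := by
    have h := (continuous_arctan.tendsto _).comp hk0.inv_tendsto_atTop
    rw [arctan_zero] at h
    exact h
  have hU1 : Tendsto (fun t => arctan (k t)⁻¹) atTop (nhds (arctan a⁻¹)) :=
    (continuous_arctan.tendsto _).comp (hk1.inv₀ ha.ne')
  have hB0 : Tendsto (fun t => 2 * K / √(t ^ 2 * (1 + k t ^ 2))) (nhdsWithin 0 (Ioi 0))
      (nhds 0) := by
    refine tendsto_const_nhds.div_atTop (tendsto_atTop_mono (fun t => ?_) hG0)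
    exact le_sqrt_of_sq_le (by nlinarith [sq_nonneg t])
  have hB1 : Tendsto (fun t => 2 * K / √(t ^ 2 * (1 + k t ^ 2))) atTop (nhds 0) := by
    refine tendsto_const_nhds.div_atTop (tendsto_atTop_mono (fun t => ?_) tendsto_id)
    exact le_sqrt_of_sq_le (by
      simp only [id]
      nlinarith [mul_nonneg (sq_nonneg t) (sq_nonneg (k t))])
  have hU : Tendsto (fun p : ℝ × ℝ => arctan (k p.2)⁻¹ - arctan (k p.1)⁻¹)
      (nhdsWithin 0 (Ioi 0) ×ˢ atTop) (nhds (arctan a⁻¹)) := by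
    simpa using (hU1.comp tendsto_snd).sub (hU0.comp tendsto_fst)
  have hUB : Tendsto (fun p : ℝ × ℝ => arctan (k p.2)⁻¹ - arctan (k p.1)⁻¹ +
      (2 * K / √(p.1 ^ 2 * (1 + k p.1 ^ 2)) + 2 * K / √(p.2 ^ 2 * (1 + k p.2 ^ 2))))
      (nhdsWithin 0 (Ioi 0) ×ˢ atTop) (nhds (arctan a⁻¹)) := by
    simpa using hU.add ((hB0.comp tendsto_fst).add (hB1.comp tendsto_snd))
  obtain ⟨δ₀, hδ₀, h0⟩ := (nhdsGT_basis (0 : ℝ)).eventually_iff.1 h0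
  obtain ⟨L₀, h1⟩ := eventually_atTop.1 h1
  have hgood : ∀ᶠ p : ℝ × ℝ in nhdsWithin 0 (Ioi 0) ×ˢ atTop, ∃ M : ℝ, ∀ᶠ C in atTop,
      arctan (k p.2)⁻¹ - arctan (k p.1)⁻¹ ≤ ∫ t in t₁ C..t₂ C, √C * t * k t /
          ((C - t ^ 2) * √(C - t ^ 2 * (1 + k t ^ 2))) ∧
        ∫ t in t₁ C..t₂ C, √C * t * k t / ((C - t ^ 2) * √(C - t ^ 2 * (1 + k t ^ 2))) ≤
          √C / √(C - M) * (arctan (k p.2)⁻¹ - arctan (k p.1)⁻¹) +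
            (2 * K / √(p.1 ^ 2 * (1 + k p.1 ^ 2)) + 2 * K / √(p.2 ^ 2 * (1 + k p.2 ^ 2))) := by
    have e0 : ∀ᶠ δ : ℝ in nhdsWithin 0 (Ioi 0), 0 < δ ∧ δ < min v₀ δ₀ :=
      Ioo_mem_nhdsGT (lt_min hv₀ hδ₀)
    have e1 : ∀ᶠ L in atTop, max v₀ L₀ < L := eventually_gt_atTop _
    filter_upwards [e0.prod_mk e1] with p ⟨⟨hp0, hp⟩, hp'⟩
    rw [lt_min_iff] at hp
    rw [max_lt_iff] at hp'
    exact eventually_period_bounds hk hpos hneg hroots hp0 hp.1 hp'.1 hK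
      (fun t ht ht' => h0 ⟨ht, ht'.trans hp.2⟩) (fun t ht => h1 t (hp'.2.trans ht).le)
  refine tendsto_order.2 ⟨fun y hy => ?_, fun y hy => ?_⟩
  · obtain ⟨p, ⟨M, hp⟩, hpy⟩ := (hgood.and (hU.eventually_const_lt hy)).exists
    filter_upwards [hp] with C hC using hpy.trans_le hC.1
  · obtain ⟨p, ⟨M, hp⟩, hpy⟩ := (hgood.and (hUB.eventually_lt_const hy)).exists
    have hlim := ((tendsto_sqrt_div_sqrt_sub M).mul_const
      (arctan (k p.2)⁻¹ - arctan (k p.1)⁻¹)).add_const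
      (2 * K / √(p.1 ^ 2 * (1 + k p.1 ^ 2)) + 2 * K / √(p.2 ^ 2 * (1 + k p.2 ^ 2)))
    rw [one_mul] at hlim
    filter_upwards [hp, hlim.eventually_lt_const hpy] with C hC hC' using hC.2.trans_lt hC'

theorem tendsto_rpow_neg_nhdsGT_zero_atTop {y : ℝ} (hy : 0 < y) :
    Tendsto (fun t : ℝ => t ^ (-y)) (nhdsWithin 0 (Ioi 0)) atTop := by
  refine ((tendsto_rpow_atTop hy).comp tendsto_inv_nhdsGT_zero).congr' ?_
  filter_upwards [self_mem_nhdsWithin] with t ht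
  simp only [Function.comp_apply]
  rw [inv_rpow (le_of_lt ht), rpow_neg (le_of_lt ht)]

theorem hasDerivAt_rpow_neg_add_rpow {p s H t : ℝ} (hH : 0 < H) (ht : 0 < t) :
    HasDerivAt (fun u : ℝ => (u ^ (-p) + H) ^ s)
      (-(p * s * (t ^ (-p) / (t ^ (-p) + H)) * (t ^ (-p) + H) ^ s / t)) t := by
  have hb : 0 < t ^ (-p) + H := by positivity
  refine (((hasDerivAt_rpow_const (Or.inl ht.ne')).add_const H).rpow_const
    (Or.inl hb.ne')).congr_deriv ?_
  rw [rpow_sub_one ht.ne', rpow_sub_one hb.ne']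
  field_simp

theorem tendsto_half_period_rpow {p s H v₀ c₀ : ℝ} (hs : 0 < s) (hp : 1 < p) (hps : 1 < p * s)
    (hH : 0 < H) (hv₀ : 0 < v₀) {k : ℝ → ℝ} (hkdef : ∀ t, k t = (t ^ (-p) + H) ^ s)
    {t₁ t₂ : ℝ → ℝ}
    (hroots : ∀ C, c₀ < C → 0 < t₁ C ∧ t₁ C < v₀ ∧ v₀ < t₂ C ∧
      C - t₁ C ^ 2 * (1 + k (t₁ C) ^ 2) = 0 ∧ C - t₂ C ^ 2 * (1 + k (t₂ C) ^ 2) = 0 ∧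
      ∀ t ∈ Ioo (t₁ C) (t₂ C), 0 < C - t ^ 2 * (1 + k t ^ 2)) :
    Tendsto (fun C => ∫ t in t₁ C..t₂ C, √C * t * k t /
      ((C - t ^ 2) * √(C - t ^ 2 * (1 + k t ^ 2)))) atTop (nhds (arctan (H ^ s)⁻¹)) := by
  set r := p * s with hr
  set h : ℝ → ℝ := fun t => t ^ (-p) / (t ^ (-p) + H) with hh
  have hkfun : k = fun t => (t ^ (-p) + H) ^ s := funext hkdef
  have hh0 : ∀ t, 0 < t → 0 ≤ h t := fun t ht => by simp only [hh]; positivity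
  have hh1 : ∀ t, 0 < t → h t ≤ 1 := fun t ht => by
    have : 0 < t ^ (-p) := by positivity
    exact (div_le_one (by positivity)).2 (by linarith)
  have hpos : ∀ t, 0 < t → 0 < k t := fun t ht => by rw [hkdef]; positivity
  have hbase0 : Tendsto (fun t : ℝ => t ^ (-p) + H) (nhdsWithin 0 (Ioi 0)) atTop :=
    tendsto_atTop_add_const_right _ _ (tendsto_rpow_neg_nhdsGT_zero_atTop (by linarith))
  have hk0 : Tendsto k (nhdsWithin 0 (Ioi 0)) atTop := by
    rw [hkfun]
    exact (tendsto_rpow_atTop hs).comp hbase0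
  have hk1 : Tendsto k atTop (nhds (H ^ s)) := by
    rw [hkfun]
    have := ((tendsto_rpow_neg_atTop (by linarith : 0 < p)).add_const H).rpow_const (p := s)
      (Or.inr hs.le)
    rwa [zero_add] at this
  have hG0 : Tendsto (fun t => t * k t) (nhdsWithin 0 (Ioi 0)) atTop := by
    refine tendsto_atTop_mono' _ ?_
      (tendsto_rpow_neg_nhdsGT_zero_atTop (by linarith : 0 < r - 1))
    filter_upwards [self_mem_nhdsWithin] with t ht
    replace ht : 0 < t := ht
    calc t ^ (-(r - 1)) = t * (t ^ (-p)) ^ s := by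
          rw [← rpow_mul ht.le, show -(r - 1) = -p * s + 1 by rw [hr]; ring,
            rpow_add_one ht.ne', mul_comm]
      _ ≤ t * k t := by
          rw [hkdef]
          gcongr
          linarith
  have hlim0 : Tendsto (fun t => r * h t * (k t ^ 2 / (1 + k t ^ 2))) (nhdsWithin 0 (Ioi 0))
      (nhds r) := by
    have e1 : Tendsto h (nhdsWithin 0 (Ioi 0)) (nhds 1) := by
      have : Tendsto (fun t : ℝ => 1 - H / (t ^ (-p) + H)) (nhdsWithin 0 (Ioi 0))
          (nhds (1 - 0)) := (tendsto_const_nhds.div_atTop hbase0).const_sub 1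
      rw [sub_zero] at this
      refine this.congr' ?_
      filter_upwards [self_mem_nhdsWithin] with t ht
      replace ht : 0 < t := ht
      simp only [hh]
      field_simp
      ring
    have e2 : Tendsto (fun t => k t ^ 2 / (1 + k t ^ 2)) (nhdsWithin 0 (Ioi 0)) (nhds 1) := by
      have : Tendsto (fun t => 1 - 1 / (1 + k t ^ 2)) (nhdsWithin 0 (Ioi 0)) (nhds (1 - 0)) :=
        (tendsto_const_nhds.div_atTop (tendsto_atTop_add_const_left _ _
          ((tendsto_pow_atTop two_ne_zero).comp hk0))).const_sub 1
      rw [sub_zero] at this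
      refine this.congr fun t => ?_
      field_simp
      ring
    simpa using (e1.const_mul r).mul e2
  have hlim1 : Tendsto (fun t => r * (h t * t)) atTop (nhds 0) := by
    have : Tendsto (fun t => h t * t) atTop (nhds 0) := by
      have e : Tendsto (fun t : ℝ => t ^ (-(p - 1)) / H) atTop (nhds 0) := by
        simpa using (tendsto_rpow_neg_atTop (by linarith : 0 < p - 1)).div_const H
      refine tendsto_of_tendsto_of_tendsto_of_le_of_le' tendsto_const_nhds e ?_ ?_
      · filter_upwards [eventually_gt_atTop 0] with t ht using mul_nonneg (hh0 t ht) ht.le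
      · filter_upwards [eventually_gt_atTop 0] with t ht
        rw [show -(p - 1) = -p + 1 by ring, rpow_add_one ht.ne']
        simp only [hh]
        rw [div_mul_eq_mul_div]
        have : 0 < t ^ (-p) := by positivity
        gcongr
        linarith
    simpa using this.const_mul r
  have hsq : ∀ t, k t * √(1 + k t ^ 2) ≤ 1 + k t ^ 2 := fun t => by
    have h1 := sq_sqrt (show 0 ≤ 1 + k t ^ 2 by positivity)
    nlinarith [sq_nonneg (k t - √(1 + k t ^ 2))]
  refine tendsto_half_period (k' := fun t => -(r * h t * k t / t)) (K := r / (r - 1))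
    (fun t ht => ?_) hpos (fun t ht => ?_) hv₀ hroots (div_nonneg (by linarith) (by linarith))
    (by positivity) hk0 hk1 hG0 ?_ ?_
  · have := hasDerivAt_rpow_neg_add_rpow (p := p) (s := s) hH ht
    rw [hkfun]
    exact this
  · have := hh0 t ht
    have := hpos t ht
    have : 0 < r := by linarith
    exact neg_nonpos.2 (by positivity)
  · filter_upwards [self_mem_nhdsWithin, Ioo_mem_nhdsGT one_pos,
      hlim0.eventually_const_lt (by linarith : (r + 1) / 2 < r)] with t ht ht1 hl
    replace ht : 0 < t := ht
    have e1 : -(-(r * h t * k t / t)) * t ^ 2 * √(1 + k t ^ 2) =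
        r * (h t * t) * (k t * √(1 + k t ^ 2)) := by field_simp
    have e2 : -(1 + k t ^ 2 + t * k t * -(r * h t * k t / t)) =
        (r * h t * (k t ^ 2 / (1 + k t ^ 2)) - 1) * (1 + k t ^ 2) := by
      field_simp
      ring
    rw [e1, e2]
    have hr0 : 0 < r - 1 := by linarith
    calc r * (h t * t) * (k t * √(1 + k t ^ 2)) ≤ r * (1 * 1) * (1 + k t ^ 2) := by
          have := hpos t ht
          have := hh0 t ht
          gcongr
          · exact hh1 t ht
          · exact ht1.2.le
          · exact hsq t
      _ = 2 * (r / (r - 1)) * (((r + 1) / 2 - 1) * (1 + k t ^ 2)) := by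
          field_simp
          ring
      _ ≤ _ := by gcongr
  · filter_upwards [eventually_ge_atTop 1,
      hlim1.eventually_lt_const (by norm_num : (0 : ℝ) < 1 / 2)] with t ht1 hl
    have ht : 0 < t := by linarith
    have e1 : -(-(r * h t * k t / t)) * t ^ 2 * √(1 + k t ^ 2) =
        r * (h t * t) * (k t * √(1 + k t ^ 2)) := by field_simp
    have e2 : 1 + k t ^ 2 + t * k t * -(r * h t * k t / t) =
        1 + k t ^ 2 - r * h t * k t ^ 2 := by
      field_simp
      ring
    rw [e1, e2]
    have hr0 : 0 < r - 1 := by linarith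
    have hK : 1 ≤ r / (r - 1) := by rw [one_le_div hr0]; linarith
    have hrh : r * h t ≤ 1 / 2 := by
      refine le_trans ?_ hl.le
      have := hh0 t ht
      gcongr
      exact le_mul_of_one_le_right this ht1
    have hk2 : r * h t * k t ^ 2 ≤ 1 / 2 * k t ^ 2 := by gcongr
    calc r * (h t * t) * (k t * √(1 + k t ^ 2)) ≤ 1 / 2 * (1 + k t ^ 2) := by
          have := hpos t ht
          gcongr
          exact hsq t
      _ ≤ 2 * 1 * (1 + k t ^ 2 - r * h t * k t ^ 2) := by nlinarith [sq_nonneg (k t)]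
      _ ≤ _ := by
          gcongr
          nlinarith [sq_nonneg (k t)]

/-- Formula (5.21)/(5.13): for `n > m ≥ 1` and `H > 0`, the period
`P(H,m,n,C) = 2∫_{t₁(C)}^{t₂(C)} √C t (t^{-n}+H)^{1/m} / ((C-t²)√(q_C(t))) dt`
tends to `2 arctan(1/H^{1/m})` as `C → +∞`, where `v₀` is the unique positive critical
point of `q_C(v) = C - v²(v^{-n}+H)^{2/m} - v²` (independent of `C`),
`c₀ = v₀²(v₀^{-n}+H)^{2/m} + v₀²`, and `t₁(C) < v₀ < t₂(C)` are the two positive zeros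
of `q_C` for `C > c₀`. -/
theorem limit_of_period_at_infinity (n m : ℕ) (hm : 1 ≤ m) (hmn : m < n)
    (H : ℝ) (hH : 0 < H)
    (v₀ : ℝ) (hv₀ : 0 < v₀)
    (hcrit : ∀ C : ℝ,
      deriv (fun u : ℝ => C - u ^ 2 * (u ^ (-(n : ℝ)) + H) ^ ((2 : ℝ) / m) - u ^ 2) v₀ = 0)
    (huniq : ∀ C v : ℝ, 0 < v →
      deriv (fun u : ℝ => C - u ^ 2 * (u ^ (-(n : ℝ)) + H) ^ ((2 : ℝ) / m) - u ^ 2) v = 0 →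
      v = v₀)
    (t₁ t₂ : ℝ → ℝ)
    (hroots : ∀ C : ℝ, v₀ ^ 2 * (v₀ ^ (-(n : ℝ)) + H) ^ ((2 : ℝ) / m) + v₀ ^ 2 < C →
      0 < t₁ C ∧ t₁ C < v₀ ∧ v₀ < t₂ C ∧
      C - (t₁ C) ^ 2 * ((t₁ C) ^ (-(n : ℝ)) + H) ^ ((2 : ℝ) / m) - (t₁ C) ^ 2 = 0 ∧
      C - (t₂ C) ^ 2 * ((t₂ C) ^ (-(n : ℝ)) + H) ^ ((2 : ℝ) / m) - (t₂ C) ^ 2 = 0 ∧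
      ∀ t ∈ Set.Ioo (t₁ C) (t₂ C),
        0 < C - t ^ 2 * (t ^ (-(n : ℝ)) + H) ^ ((2 : ℝ) / m) - t ^ 2) :
    Filter.Tendsto (fun C : ℝ =>
        2 * ∫ t in (t₁ C)..(t₂ C),
          Real.sqrt C * t * (t ^ (-(n : ℝ)) + H) ^ ((1 : ℝ) / m) /
            ((C - t ^ 2) *
              Real.sqrt (C - t ^ 2 * (t ^ (-(n : ℝ)) + H) ^ ((2 : ℝ) / m) - t ^ 2)))
      Filter.atTop
      (nhds (2 * Real.arctan (1 / H ^ ((1 : ℝ) / m)))) := by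
  have hm0 : (0 : ℝ) < m := by exact_mod_cast hm
  have hmn' : (m : ℝ) < n := by exact_mod_cast hmn
  have hm1 : (1 : ℝ) ≤ m := by exact_mod_cast hm
  set k : ℝ → ℝ := fun t => (t ^ (-(n : ℝ)) + H) ^ ((1 : ℝ) / m) with hk
  have hsq : ∀ t : ℝ, 0 < t → (t ^ (-(n : ℝ)) + H) ^ ((2 : ℝ) / m) = k t ^ 2 := fun t ht => by
    rw [hk, ← rpow_mul_natCast (by positivity)]
    congr 1
    push_cast
    ring
  have hq : ∀ C t : ℝ, 0 < t → C - t ^ 2 * (t ^ (-(n : ℝ)) + H) ^ ((2 : ℝ) / m) - t ^ 2 =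
      C - t ^ 2 * (1 + k t ^ 2) := fun C t ht => by
    rw [hsq t ht]
    ring
  have hroots' : ∀ C, v₀ ^ 2 * (v₀ ^ (-(n : ℝ)) + H) ^ ((2 : ℝ) / m) + v₀ ^ 2 < C →
      0 < t₁ C ∧ t₁ C < v₀ ∧ v₀ < t₂ C ∧
      C - t₁ C ^ 2 * (1 + k (t₁ C) ^ 2) = 0 ∧ C - t₂ C ^ 2 * (1 + k (t₂ C) ^ 2) = 0 ∧
      ∀ t ∈ Ioo (t₁ C) (t₂ C), 0 < C - t ^ 2 * (1 + k t ^ 2) := fun C hC => by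
    obtain ⟨h1, h2, h3, h4, h5, h6⟩ := hroots C hC
    rw [hq C _ h1] at h4
    rw [hq C _ (hv₀.trans h3)] at h5
    exact ⟨h1, h2, h3, h4, h5, fun t ht => hq C t (h1.trans ht.1) ▸ h6 t ht⟩
  have hlim := tendsto_half_period_rpow (p := n) (s := 1 / m) (by positivity) (by linarith)
    (by rwa [mul_one_div, one_lt_div hm0]) hH hv₀ (k := k) (fun _ => rfl) hroots'
  rw [one_div (H ^ _)]
  refine (hlim.const_mul 2).congr' ?_
  filter_upwards [eventually_gt_atTop (v₀ ^ 2 * (v₀ ^ (-(n : ℝ)) + H) ^ ((2 : ℝ) / m) + v₀ ^ 2)]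
    with C hC
  obtain ⟨h1, h2, h3, -⟩ := hroots C hC
  congr 1
  refine intervalIntegral.integral_congr fun t ht => ?_
  rw [uIcc_of_le (h2.trans h3).le] at ht
  simp only [hq C t (h1.trans_le ht.1), hk]
end

section
/- Let n ≥ 5 be an integer, H > 0 a real number, m = 4, and define q_C(v) = C − v²(v^{−n}+H)^{1/2} − v² for v > 0, with unique positive critical point v₀ and c₀ = v₀²(v₀^{−n}+H)^{1/2} + v₀². For C > c₀ let t₁(C) < v₀ < t₂(C) be the two positive zeros of q_C and define P(H,4,n,C) = 2∫_{t₁(C)}^{t₂(C)} √C·t·(t^{−n}+H)^{1/4}/((C−t²)·√(q_C(t))) dt. Then lim_{C→c₀⁺} P(H,4,n,C) = 2π/(n(n−4)H+4)^{1/4}. -/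
open Real Set Filter MeasureTheory

/-- The arcsine density is integrable on `[0, 1]`. -/
lemma intervalIntegrable_one_div_sqrt_one_sub_sq :
    IntervalIntegrable (fun y : ℝ => 1 / √(1 - y ^ 2)) volume 0 1 := by
  refine intervalIntegral.intervalIntegrable_deriv_of_nonneg
    (g := arcsin) continuous_arcsin.continuousOn (fun x hx => ?_) (fun x _ => by positivity)
  simp only [zero_le_one, inf_of_le_left, sup_of_le_right, mem_Ioo] at hx
  exact hasDerivAt_arcsin (by linarith) (by linarith)

lemma integral_one_div_sqrt_one_sub_sq :
    ∫ y in (0 : ℝ)..1, 1 / √(1 - y ^ 2) = π / 2 := by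
  rw [intervalIntegral.integral_eq_sub_of_hasDerivAt_of_le zero_le_one
    continuous_arcsin.continuousOn (fun x hx => ?_) intervalIntegrable_one_div_sqrt_one_sub_sq]
  · simp
  · exact hasDerivAt_arcsin (by linarith [hx.1]) (by linarith [hx.2])

section NondegenerateMinimum

open scoped Topology

variable {f f' : ℝ → ℝ} {κ : ℝ}

lemma tendsto_deriv_div_id (hf' : HasDerivAt f' (2 * κ) 0) (h0 : f' 0 = 0) :
    Tendsto (fun x => f' x / x) (𝓝[>] 0) (𝓝 (2 * κ)) := by
  have h := (hasDerivAt_iff_tendsto_slope.1 hf').mono_left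
    (nhdsWithin_mono 0 (fun x (hx : 0 < x) => hx.ne'))
  refine h.congr fun x => ?_
  simp [slope_def_field, h0]

lemma exists_monotoneOn_sub_sq (hκ : 0 < κ) (hf : ∀ᶠ x in 𝓝 0, HasDerivAt f (f' x) x)
    (hf' : HasDerivAt f' (2 * κ) 0) (h0 : f' 0 = 0) :
    ∃ δ > 0, MonotoneOn (fun x => f x - κ / 2 * x ^ 2) (Icc 0 δ) := by
  have h1 : ∀ᶠ x in 𝓝[>] (0 : ℝ), κ < f' x / x :=
    (tendsto_deriv_div_id hf' h0).eventually_const_lt (by linarith)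
  rw [eventually_nhdsWithin_iff] at h1
  obtain ⟨ε, hε, hball⟩ := Metric.eventually_nhds_iff.1 (hf.and h1)
  have hd : ∀ x ∈ Icc 0 (ε / 2),
      HasDerivAt (fun x => f x - κ / 2 * x ^ 2) (f' x - κ * x) x := by
    intro x hx
    have hx' : dist x 0 < ε := by
      rw [Real.dist_eq, sub_zero, abs_of_nonneg hx.1]; linarith [hx.2]
    exact ((hball hx').1.sub ((hasDerivAt_pow 2 x).const_mul (κ / 2))).congr_deriv
      (by push_cast; ring)
  refine ⟨ε / 2, by positivity, monotoneOn_of_deriv_nonneg (convex_Icc _ _)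
    (fun x hx => (hd x hx).continuousAt.continuousWithinAt)
    (fun x hx => (hd x (interior_subset hx)).differentiableAt.differentiableWithinAt) ?_⟩
  intro x hx
  rw [(hd x (interior_subset hx)).deriv]
  rw [interior_Icc] at hx
  have hx' : dist x 0 < ε := by
    rw [Real.dist_eq, sub_zero, abs_of_pos hx.1]; linarith [hx.2]
  have := (hball hx').2 hx.1
  rw [lt_div_iff₀ hx.1] at this
  linarith

lemma tendsto_sub_div_sq (hf : ∀ᶠ x in 𝓝 0, HasDerivAt f (f' x) x)
    (hf' : HasDerivAt f' (2 * κ) 0) (h0 : f' 0 = 0) :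
    Tendsto (fun x => (f x - f 0) / x ^ 2) (𝓝[>] 0) (𝓝 κ) := by
  refine HasDerivAt.lhopital_zero_nhdsGT (f' := f') (g' := fun x => 2 * x)
    ?_ (.of_forall fun x => by simpa using hasDerivAt_pow 2 x) ?_ ?_ ?_ ?_
  · filter_upwards [nhdsWithin_le_nhds hf] with x hx using hx.sub_const _
  · filter_upwards [self_mem_nhdsWithin] with x (hx : 0 < x)
    positivity
  · have : Tendsto f (𝓝[>] 0) (𝓝 (f 0)) := hf.self_of_nhds.continuousAt.continuousWithinAt
    simpa using this.sub_const (f 0)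
  · exact ((continuous_pow 2).tendsto' (0 : ℝ) 0 (by simp)).mono_left nhdsWithin_le_nhds
  · have := (tendsto_deriv_div_id hf' h0).div_const 2
    rw [mul_div_cancel_left₀ _ two_ne_zero] at this
    exact this.congr fun x => by rw [div_div, mul_comm]

/-- One-sided small-oscillation limit: if `f` has a nondegenerate minimum at `0` with
`f'' 0 = 2κ`, then `∫ x in 0..a, A x / √(f a - f x)` tends to `A₀ π / (2 √κ)` as `a → 0⁺`,
whenever the amplitude `A` tends to `A₀`. -/
lemma tendsto_integral_div_sqrt_sub (hκ : 0 < κ) (hfm : Measurable f)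
    (hf : ∀ᶠ x in 𝓝 0, HasDerivAt f (f' x) x)
    (hf' : HasDerivAt f' (2 * κ) 0) (h0 : f' 0 = 0)
    {l : Filter ℝ} [l.IsCountablyGenerated] {a : ℝ → ℝ} (ha : Tendsto a l (𝓝[>] 0))
    {A : ℝ → ℝ → ℝ} {A₀ : ℝ} (hAm : ∀ i, Measurable (A i))
    (hA : Tendsto (fun p : ℝ × ℝ => A p.1 p.2) (l ×ˢ 𝓝 0) (𝓝 A₀)) :
    (∀ᶠ i in l, IntervalIntegrable (fun x => A i x / √(f (a i) - f x)) volume 0 (a i)) ∧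
    Tendsto (fun i => ∫ x in 0..a i, A i x / √(f (a i) - f x)) l
      (𝓝 (A₀ * π / (2 * √κ))) := by
  obtain ⟨δ, hδ, hmono⟩ := exists_monotoneOn_sub_sq hκ hf hf' h0
  have ha0 : Tendsto a l (𝓝 0) := ha.mono_right nhdsWithin_le_nhds
  have hapos : ∀ᶠ i in l, 0 < a i := ha.eventually self_mem_nhdsWithin
  have haδ : ∀ᶠ i in l, a i < δ := ha0.eventually_lt_const hδ
  set G : ℝ → ℝ → ℝ := fun i y => a i * (A i (a i * y) / √(f (a i) - f (a i * y))) with hG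
  have hGm : ∀ i, Measurable (G i) := by
    intro i
    have := hAm i
    simp only [hG]
    fun_prop
  set K : ℝ := (|A₀| + 1) / √(κ / 2) with hK
  have hbi : IntervalIntegrable (fun y : ℝ => K * (1 / √(1 - y ^ 2))) volume 0 1 :=
    intervalIntegrable_one_div_sqrt_one_sub_sq.const_mul K
  have hbound : ∀ᶠ i in l, ∀ y ∈ uIoc (0 : ℝ) 1, ‖G i y‖ ≤ K * (1 / √(1 - y ^ 2)) := by
    have hA1 : ∀ᶠ p : ℝ × ℝ in l ×ˢ 𝓝 0, |A p.1 p.2| < |A₀| + 1 :=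
      hA.abs.eventually_lt_const (by linarith)
    obtain ⟨P, hP, Q, hQ, hPQ⟩ := eventually_prod_iff.1 hA1
    obtain ⟨ε, hε, hball⟩ := Metric.eventually_nhds_iff.1 hQ
    filter_upwards [hP, hapos, haδ, ha0.eventually_lt_const hε] with i hPi hai hiδ hiε y hy
    rw [uIoc_of_le zero_le_one] at hy
    rcases hy.2.eq_or_lt with rfl | hy1
    · simp [hG]
    have hay : 0 < a i * y := mul_pos hai hy.1
    have hay' : a i * y < a i := by nlinarith
    have hAi : |A i (a i * y)| < |A₀| + 1 := hPQ hPi <| hball <| by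
      rw [Real.dist_eq, sub_zero, abs_of_pos hay]; linarith
    have hm := hmono (a := a i * y) ⟨hay.le, by linarith⟩ (b := a i) ⟨hai.le, hiδ.le⟩ hay'.le
    have hpos : 0 < 1 - y ^ 2 := by nlinarith [hy.1]
    have hle : κ / 2 * (a i ^ 2 * (1 - y ^ 2)) ≤ f (a i) - f (a i * y) := by
      simp only at hm; nlinarith
    have hs : √(κ / 2) * (a i * √(1 - y ^ 2)) ≤ √(f (a i) - f (a i * y)) := by
      refine le_trans (le_of_eq ?_) (Real.sqrt_le_sqrt hle)
      rw [Real.sqrt_mul (by positivity), Real.sqrt_mul (by positivity), Real.sqrt_sq hai.le]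
    have hs0 : 0 < √(1 - y ^ 2) := Real.sqrt_pos.2 hpos
    have hk0 : 0 < √(κ / 2) := Real.sqrt_pos.2 (by positivity)
    have hq0 : 0 < √(κ / 2) * (a i * √(1 - y ^ 2)) := by positivity
    calc ‖G i y‖ = a i * (|A i (a i * y)| / √(f (a i) - f (a i * y))) := by
          simp only [hG, norm_mul, norm_div, Real.norm_eq_abs, abs_of_pos hai,
            abs_of_nonneg (Real.sqrt_nonneg _)]
      _ ≤ a i * ((|A₀| + 1) / (√(κ / 2) * (a i * √(1 - y ^ 2)))) := by gcongr
      _ = K * (1 / √(1 - y ^ 2)) := by rw [hK]; field_simp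
  have hlim : ∀ y ∈ Ioo (0 : ℝ) 1, Tendsto (fun i => G i y) l
      (𝓝 (A₀ / √κ * (1 / √(1 - y ^ 2)))) := by
    intro y hy
    have hpos : 0 < 1 - y ^ 2 := by nlinarith [hy.1, hy.2]
    have hay0 : Tendsto (fun i => a i * y) l (𝓝 0) := by simpa using ha0.mul_const y
    have hay : Tendsto (fun i => a i * y) l (𝓝[>] 0) :=
      tendsto_nhdsWithin_iff.2 ⟨hay0, hapos.mono fun i hi => mul_pos hi hy.1⟩
    have hq := tendsto_sub_div_sq hf hf' h0
    have h1 : Tendsto (fun i => (f (a i) - f (a i * y)) / a i ^ 2) l (𝓝 (κ * (1 - y ^ 2))) := by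
      have := (hq.comp ha).sub ((hq.comp hay).const_mul (y ^ 2))
      rw [show κ - y ^ 2 * κ = κ * (1 - y ^ 2) by ring] at this
      refine this.congr' ?_
      filter_upwards [hapos] with i hi
      have := hy.1
      simp only [Function.comp]
      field_simp
      ring
    have h2 : Tendsto (fun i => A i (a i * y)) l (𝓝 A₀) :=
      hA.comp (tendsto_id.prodMk hay0)
    have h3 := h2.div h1.sqrt (by positivity)
    rw [Real.sqrt_mul hκ.le, ← div_div] at h3
    rw [mul_one_div]
    refine h3.congr' ?_
    filter_upwards [hapos] with i hi
    simp only [hG, Pi.div_apply]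
    rw [Real.sqrt_div' _ (by positivity), Real.sqrt_sq hi.le]
    rw [div_div_eq_mul_div]; ring
  have hGlim : Tendsto (fun i => ∫ y in (0 : ℝ)..1, G i y) l (𝓝 (A₀ * π / (2 * √κ))) := by
    have := intervalIntegral.tendsto_integral_filter_of_dominated_convergence (μ := volume)
      (f := fun y => A₀ / √κ * (1 / √(1 - y ^ 2))) (F := G) (a := 0) (b := 1) (l := l)
      (fun y : ℝ => K * (1 / √(1 - y ^ 2)))
      (.of_forall fun i => (hGm i).aestronglyMeasurable)
      (hbound.mono fun i hi => .of_forall hi) hbi ?_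
    · rw [intervalIntegral.integral_const_mul, integral_one_div_sqrt_one_sub_sq] at this
      convert this using 2
      ring
    · filter_upwards [(measure_eq_zero_iff_ae_notMem.1 (Real.volume_singleton (a := 1)))]
        with y hy hy'
      rw [uIoc_of_le zero_le_one] at hy'
      exact hlim y ⟨hy'.1, lt_of_le_of_ne hy'.2 hy⟩
  constructor
  · filter_upwards [hbound, hapos] with i hi hai
    have hGi : IntervalIntegrable (G i) volume 0 1 :=
      hbi.mono_fun' (hGm i).aestronglyMeasurable
        ((ae_restrict_mem measurableSet_uIoc).mono hi)
    have h := hGi.const_mul (a i)⁻¹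
    have h' : IntervalIntegrable
        (fun y => (fun x => A i x / √(f (a i) - f x)) (a i * y)) volume (0 / a i) (a i / a i) := by
      rw [zero_div, div_self hai.ne']
      refine h.congr fun y _ => ?_
      simp only [hG]
      rw [inv_mul_cancel_left₀ hai.ne']
    exact (IntervalIntegrable.comp_mul_left_iff hai.ne').1 h'
  · refine hGlim.congr fun i => ?_
    simp only [hG]
    rw [intervalIntegral.integral_const_mul, ← smul_eq_mul,
      intervalIntegral.smul_integral_comp_mul_left (fun x => A i x / √(f (a i) - f x)) (a i)]
    simp

lemma tendsto_nhdsGT_of_forall_lt (hκ : 0 < κ) (hf : ∀ᶠ x in 𝓝 0, HasDerivAt f (f' x) x)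
    (hf' : HasDerivAt f' (2 * κ) 0) (h0 : f' 0 = 0) {b : ℝ → ℝ}
    (hb : ∀ C, f 0 < C → 0 < b C ∧ ∀ x ∈ Ioo 0 (b C), f x < C) :
    Tendsto b (𝓝[>] f 0) (𝓝[>] 0) := by
  obtain ⟨δ, hδ, hmono⟩ := exists_monotoneOn_sub_sq hκ hf hf' h0
  have hpos : ∀ᶠ C in 𝓝[>] f 0, b C ∈ Ioi (0 : ℝ) := by
    filter_upwards [self_mem_nhdsWithin] with C hC using (hb C hC).1
  refine tendsto_nhdsWithin_iff.2 ⟨tendsto_order.2 ⟨fun x hx => ?_, fun ε hε => ?_⟩, hpos⟩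
  · exact hpos.mono fun C hC => lt_trans hx hC
  · set η := min (ε / 2) δ with hη
    have hη0 : 0 < η := lt_min (by linarith) hδ
    have hηε : η < ε := (min_le_left _ _).trans_lt (by linarith)
    have hfη : f 0 < f η := by
      have := hmono (a := 0) ⟨le_rfl, hδ.le⟩ (b := η) ⟨hη0.le, min_le_right _ _⟩ hη0.le
      have : 0 < κ / 2 * η ^ 2 := by positivity
      simp only at *
      linarith
    filter_upwards [self_mem_nhdsWithin, nhdsWithin_le_nhds (Iio_mem_nhds hfη)]
      with C hC (hCη : C < f η)
    refine lt_of_le_of_lt (not_lt.1 fun hlt => ?_) hηε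
    exact absurd ((hb C hC).2 η ⟨hη0, hlt⟩) hCη.not_gt

/-- Small-oscillation limit in a potential well: if `f` has a nondegenerate minimum at `v₀` with
`f'' v₀ = 2κ` and `t₁ C < v₀ < t₂ C` are the ends of the component of `{f < C}` around `v₀`, then
`∫ t in t₁ C..t₂ C, A C t / √(C - f t)` tends to `A₀ π / √κ` as `C` decreases to `f v₀`. -/
lemma tendsto_integral_potential_well (hκ : 0 < κ) (hfm : Measurable f) {v₀ : ℝ}
    (hf : ∀ᶠ x in 𝓝 v₀, HasDerivAt f (f' x) x)
    (hf' : HasDerivAt f' (2 * κ) v₀) (h0 : f' v₀ = 0) {t₁ t₂ : ℝ → ℝ}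
    (ht : ∀ C, f v₀ < C → t₁ C < v₀ ∧ v₀ < t₂ C ∧ f (t₁ C) = C ∧ f (t₂ C) = C ∧
      ∀ t ∈ Ioo (t₁ C) (t₂ C), f t < C)
    {A : ℝ → ℝ → ℝ} {A₀ : ℝ} (hAm : ∀ i, Measurable (A i))
    (hA : Tendsto (fun p : ℝ × ℝ => A p.1 p.2) (𝓝[>] f v₀ ×ˢ 𝓝 v₀) (𝓝 A₀)) :
    Tendsto (fun C => ∫ t in t₁ C..t₂ C, A C t / √(C - f t)) (𝓝[>] f v₀)
      (𝓝 (A₀ * π / √κ)) := by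
  have tadd : Tendsto (fun x : ℝ => v₀ + x) (𝓝 0) (𝓝 v₀) :=
    (continuous_const.add continuous_id).tendsto' _ _ (by simp)
  have tsub : Tendsto (fun x : ℝ => v₀ - x) (𝓝 0) (𝓝 v₀) :=
    (continuous_const.sub continuous_id).tendsto' _ _ (by simp)
  have hfR : ∀ᶠ x in 𝓝 (0 : ℝ), HasDerivAt (fun x => f (v₀ + x)) (f' (v₀ + x)) x :=
    (tadd.eventually hf).mono fun x hx => hx.comp_const_add v₀ x
  have hfR' : HasDerivAt (fun x => f' (v₀ + x)) (2 * κ) 0 :=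
    HasDerivAt.comp_const_add v₀ 0 (by simpa using hf')
  have hfL : ∀ᶠ x in 𝓝 (0 : ℝ), HasDerivAt (fun x => f (v₀ - x)) (-f' (v₀ - x)) x :=
    (tsub.eventually hf).mono fun x hx => hx.comp_const_sub v₀ x
  have hfL' : HasDerivAt (fun x => -f' (v₀ - x)) (2 * κ) 0 := by
    have := (HasDerivAt.comp_const_sub v₀ 0 (f := f') (f' := 2 * κ) (by simpa using hf')).neg
    exact this.congr_deriv (by ring)
  have hbR : Tendsto (fun C => t₂ C - v₀) (𝓝[>] f v₀) (𝓝[>] 0) := by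
    have := tendsto_nhdsGT_of_forall_lt (b := fun C => t₂ C - v₀) hκ hfR hfR' (by simpa using h0)
      (fun C hC => by
        obtain ⟨h1, h2, -, -, h5⟩ := ht C (by simpa using hC)
        exact ⟨by linarith, fun x hx => h5 _ ⟨by linarith [hx.1], by linarith [hx.2]⟩⟩)
    simpa using this
  have hbL : Tendsto (fun C => v₀ - t₁ C) (𝓝[>] f v₀) (𝓝[>] 0) := by
    have := tendsto_nhdsGT_of_forall_lt (b := fun C => v₀ - t₁ C) hκ hfL hfL' (by simpa using h0)
      (fun C hC => by
        obtain ⟨h1, h2, -, -, h5⟩ := ht C (by simpa using hC)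
        exact ⟨by linarith, fun x hx => h5 _ ⟨by linarith [hx.2], by linarith [hx.1]⟩⟩)
    simpa using this
  obtain ⟨hRi, hRt⟩ := tendsto_integral_div_sqrt_sub hκ (hfm.comp (measurable_const_add v₀))
    hfR hfR' (by simpa using h0) hbR (A := fun C x => A C (v₀ + x))
    (fun C => (hAm C).comp (measurable_const_add v₀))
    (hA.comp (tendsto_id.prodMap tadd))
  obtain ⟨hLi, hLt⟩ := tendsto_integral_div_sqrt_sub hκ (hfm.comp (measurable_const_sub v₀))
    hfL hfL' (by simpa using h0) hbL (A := fun C x => A C (v₀ - x))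
    (fun C => (hAm C).comp (measurable_const_sub v₀))
    (hA.comp (tendsto_id.prodMap tsub))
  have hsum := hLt.add hRt
  rw [show A₀ * π / (2 * √κ) + A₀ * π / (2 * √κ) = A₀ * π / √κ by ring] at hsum
  refine hsum.congr' ?_
  filter_upwards [self_mem_nhdsWithin, hRi, hLi] with C hC hR hL
  obtain ⟨-, -, h3, h4, -⟩ := ht C hC
  simp only [Function.comp, add_sub_cancel, sub_sub_cancel, h3, h4] at hR hL ⊢
  have hR' : IntervalIntegrable (fun t => A C t / √(C - f t)) volume v₀ (t₂ C) := by
    rw [← IntervalIntegrable.comp_add_left_iff (c := v₀)]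
    simpa using hR
  have hL' : IntervalIntegrable (fun t => A C t / √(C - f t)) volume (t₁ C) v₀ := by
    simpa using (hL.comp_sub_left v₀).symm
  rw [← intervalIntegral.integral_add_adjacent_intervals hL' hR',
    intervalIntegral.integral_comp_sub_left (fun t => A C t / √(C - f t)),
    intervalIntegral.integral_comp_add_left (fun t => A C t / √(C - f t))]
  simp

end NondegenerateMinimum

section Potential

open scoped Topology

variable {r H v : ℝ}

lemma hasDerivAt_sqrt_rpow_neg_add (hH : 0 < H) (hv : 0 < v) :
    HasDerivAt (fun u : ℝ => (u ^ (-r) + H) ^ ((1 : ℝ) / 2))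
      (-(r / 2 * ((v ^ (-r) + H) ^ ((1 : ℝ) / 2) - H / (v ^ (-r) + H) ^ ((1 : ℝ) / 2))) / v) v := by
  have hp : 0 < v ^ (-r) := rpow_pos_of_pos hv _
  have hg : 0 < v ^ (-r) + H := by linarith
  refine (((hasDerivAt_rpow_const (p := -r) (.inl hv.ne')).add_const H).rpow_const
    (p := 1 / 2) (.inl hg.ne')).congr_deriv ?_
  rw [rpow_sub_one hv.ne', rpow_sub_one hg.ne']
  have hs : 0 < (v ^ (-r) + H) ^ ((1 : ℝ) / 2) := rpow_pos_of_pos hg _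
  have hss : v ^ (-r) + H = ((v ^ (-r) + H) ^ ((1 : ℝ) / 2)) ^ 2 := by
    rw [← rpow_natCast, ← rpow_mul hg.le]; norm_num
  generalize (v ^ (-r) + H) ^ ((1 : ℝ) / 2) = s at *
  rw [hss, show v ^ (-r) = s ^ 2 - H by linarith]
  field_simp

/-- The derivative of the potential `u ↦ u² (u^{-r} + H)^{1/2} + u²` on the positive reals. -/
noncomputable def potentialDeriv (r H v : ℝ) : ℝ :=
  v * ((2 - r / 2) * (v ^ (-r) + H) ^ ((1 : ℝ) / 2)
    + r * H / 2 / (v ^ (-r) + H) ^ ((1 : ℝ) / 2) + 2)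

lemma hasDerivAt_potential_s11 (hH : 0 < H) (hv : 0 < v) :
    HasDerivAt (fun u : ℝ => u ^ 2 * (u ^ (-r) + H) ^ ((1 : ℝ) / 2) + u ^ 2)
      (potentialDeriv r H v) v := by
  refine (((hasDerivAt_pow 2 v).mul (hasDerivAt_sqrt_rpow_neg_add (r := r) hH hv)).add
    (hasDerivAt_pow 2 v)).congr_deriv ?_
  have hs : 0 < (v ^ (-r) + H) ^ ((1 : ℝ) / 2) := by positivity
  rw [potentialDeriv]
  field_simp
  push_cast
  ring

/-- At a critical point, `s = (v^{-r} + H)^{1/2}` is a root of `(r - 4) s² - 4 s - r H`. -/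
lemma quadratic_of_potentialDeriv_eq_zero (hH : 0 < H) (hv : 0 < v)
    (h : potentialDeriv r H v = 0) :
    (r - 4) * ((v ^ (-r) + H) ^ ((1 : ℝ) / 2)) ^ 2
      = 4 * (v ^ (-r) + H) ^ ((1 : ℝ) / 2) + r * H := by
  have hs : 0 < (v ^ (-r) + H) ^ ((1 : ℝ) / 2) := by positivity
  rw [potentialDeriv, mul_eq_zero, or_iff_right hv.ne'] at h
  field_simp at h
  linarith

lemma hasDerivAt_potentialDeriv (hH : 0 < H) (hv : 0 < v) (h : potentialDeriv r H v = 0) :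
    HasDerivAt (potentialDeriv r H)
      (2 * (((v ^ (-r) + H) ^ ((1 : ℝ) / 2) + 1) / (v ^ (-r) + H) ^ ((1 : ℝ) / 2)
        * ((r - 4) * (v ^ (-r) + H) ^ ((1 : ℝ) / 2) - 2))) v := by
  have hs : 0 < (v ^ (-r) + H) ^ ((1 : ℝ) / 2) := by positivity
  have hq := quadratic_of_potentialDeriv_eq_zero hH hv h
  have hd := hasDerivAt_sqrt_rpow_neg_add (r := r) hH hv
  refine ((hasDerivAt_id v).mul (((hd.const_mul (2 - r / 2)).add
    ((hasDerivAt_const v (r * H / 2)).div hd hs.ne')).add_const 2)).congr_deriv ?_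
  simp only [id, Pi.add_apply, Pi.div_apply]
  generalize (v ^ (-r) + H) ^ ((1 : ℝ) / 2) = s at *
  have hH' : r * H = (r - 4) * s ^ 2 - 4 * s := by linarith
  field_simp
  linear_combination (2 * s ^ 2 + r * s ^ 2 - (r - 4) * s ^ 2
    - (r * H + ((r - 4) * s ^ 2 - 4 * s))) * hH'

end Potential



/-- Formula (5.20): for `m = 4`, `n ≥ 5` and `H > 0`, the period
`P(H,4,n,C) = 2∫_{t₁(C)}^{t₂(C)} √C t (t^{-n}+H)^{1/4} / ((C-t²)√(q_C(t))) dt`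
tends to `2π/(n(n-4)H+4)^{1/4}` as `C → c₀⁺`, where `v₀` is the unique positive
critical point of `q_C(v) = C - v²(v^{-n}+H)^{1/2} - v²`,
`c₀ = v₀²(v₀^{-n}+H)^{1/2} + v₀²`, and `t₁(C) < v₀ < t₂(C)` are the two positive
zeros of `q_C` for `C > c₀`. -/
theorem limit_of_period_m4 (n : ℕ) (hn : 5 ≤ n) (H : ℝ) (hH : 0 < H)
    (v₀ : ℝ) (hv₀ : 0 < v₀)
    (hcrit : ∀ C : ℝ,
      deriv (fun u : ℝ => C - u ^ 2 * (u ^ (-(n : ℝ)) + H) ^ ((1 : ℝ) / 2) - u ^ 2) v₀ = 0)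
    (huniq : ∀ C v : ℝ, 0 < v →
      deriv (fun u : ℝ => C - u ^ 2 * (u ^ (-(n : ℝ)) + H) ^ ((1 : ℝ) / 2) - u ^ 2) v = 0 →
      v = v₀)
    (t₁ t₂ : ℝ → ℝ)
    (hroots : ∀ C : ℝ, v₀ ^ 2 * (v₀ ^ (-(n : ℝ)) + H) ^ ((1 : ℝ) / 2) + v₀ ^ 2 < C →
      0 < t₁ C ∧ t₁ C < v₀ ∧ v₀ < t₂ C ∧
      C - (t₁ C) ^ 2 * ((t₁ C) ^ (-(n : ℝ)) + H) ^ ((1 : ℝ) / 2) - (t₁ C) ^ 2 = 0 ∧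
      C - (t₂ C) ^ 2 * ((t₂ C) ^ (-(n : ℝ)) + H) ^ ((1 : ℝ) / 2) - (t₂ C) ^ 2 = 0 ∧
      ∀ t ∈ Set.Ioo (t₁ C) (t₂ C),
        0 < C - t ^ 2 * (t ^ (-(n : ℝ)) + H) ^ ((1 : ℝ) / 2) - t ^ 2) :
    Filter.Tendsto (fun C : ℝ =>
        2 * ∫ t in (t₁ C)..(t₂ C),
          Real.sqrt C * t * (t ^ (-(n : ℝ)) + H) ^ ((1 : ℝ) / 4) /
            ((C - t ^ 2) *
              Real.sqrt (C - t ^ 2 * (t ^ (-(n : ℝ)) + H) ^ ((1 : ℝ) / 2) - t ^ 2)))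
      (nhdsWithin (v₀ ^ 2 * (v₀ ^ (-(n : ℝ)) + H) ^ ((1 : ℝ) / 2) + v₀ ^ 2)
        (Set.Ioi (v₀ ^ 2 * (v₀ ^ (-(n : ℝ)) + H) ^ ((1 : ℝ) / 2) + v₀ ^ 2)))
      (nhds (2 * π / ((n : ℝ) * ((n : ℝ) - 4) * H + 4) ^ ((1 : ℝ) / 4))) := by
  have hn' : (5 : ℝ) ≤ n := by exact_mod_cast hn
  generalize (n : ℝ) = r at *
  have hcr : potentialDeriv r H v₀ = 0 := by
    have h := hcrit 0
    have hd := (hasDerivAt_potential_s11 (r := r) hH hv₀).const_sub 0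
    simp only [← sub_sub] at hd
    rw [hd.deriv] at h
    simpa using h
  have hdd := hasDerivAt_potentialDeriv hH hv₀ hcr
  have hq := quadratic_of_potentialDeriv_eq_zero hH hv₀ hcr
  have hg : 0 < v₀ ^ (-r) + H := by positivity
  have hroot : (v₀ ^ (-r) + H) ^ ((1 : ℝ) / 4) = √((v₀ ^ (-r) + H) ^ ((1 : ℝ) / 2)) := by
    rw [Real.sqrt_eq_rpow, ← rpow_mul hg.le]; norm_num
  set F : ℝ → ℝ := fun u => u ^ 2 * (u ^ (-r) + H) ^ ((1 : ℝ) / 2) + u ^ 2 with hF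
  set s : ℝ := (v₀ ^ (-r) + H) ^ ((1 : ℝ) / 2) with hs_def
  have hs : 0 < s := by positivity
  have hrs : 0 < (r - 4) * s - 2 := by nlinarith [mul_pos (show 0 < r by linarith) hH]
  have hFv : v₀ ^ 2 * s + v₀ ^ 2 = F v₀ := rfl
  have hsub : F v₀ - v₀ ^ 2 = v₀ ^ 2 * s := by rw [← hFv]; ring
  have hA : Filter.Tendsto
      (fun p : ℝ × ℝ => √p.1 * p.2 * (p.2 ^ (-r) + H) ^ ((1 : ℝ) / 4) / (p.1 - p.2 ^ 2))
      (nhdsWithin (F v₀) (Ioi (F v₀)) ×ˢ nhds v₀)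
      (nhds (√(F v₀) * v₀ * √s / (v₀ ^ 2 * s))) := by
    rw [← hroot, ← hsub]
    refine Filter.Tendsto.mono_left ?_ (Filter.prod_mono_left _ nhdsWithin_le_nhds)
    rw [← nhds_prod_eq]
    have h1 : ContinuousAt (fun p : ℝ × ℝ => p.2 ^ (-r)) (F v₀, v₀) :=
      continuousAt_snd.rpow_const (.inl hv₀.ne')
    have h2 : ContinuousAt (fun p : ℝ × ℝ => (p.2 ^ (-r) + H) ^ ((1 : ℝ) / 4)) (F v₀, v₀) :=
      (h1.add_const H).rpow_const (.inl hg.ne')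
    have h3 : ContinuousAt (fun p : ℝ × ℝ => √p.1 * p.2) (F v₀, v₀) := by fun_prop
    have h4 : ContinuousAt (fun p : ℝ × ℝ => p.1 - p.2 ^ 2) (F v₀, v₀) := by fun_prop
    exact (h3.mul h2).div h4 (by simp only [hsub]; positivity)
  have key := tendsto_integral_potential_well (f := F) (t₁ := t₁) (t₂ := t₂)
    (A := fun C t => √C * t * (t ^ (-r) + H) ^ ((1 : ℝ) / 4) / (C - t ^ 2))
    (by positivity) (by simp only [hF]; fun_prop)
    ((eventually_gt_nhds hv₀).mono fun x hx => hasDerivAt_potential_s11 hH hx)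
    hdd hcr (fun C hC => by
      obtain ⟨-, h1, h2, h3, h4, h5⟩ := hroots C hC
      refine ⟨h1, h2, ?_, ?_, fun t ht => ?_⟩
      · simp only [hF]; linarith
      · simp only [hF]; linarith
      · have := h5 t ht
        simp only [hF]; linarith)
    (fun C => by fun_prop) hA
  rw [hFv]
  have hD : (r * (r - 4) * H + 4) ^ ((1 : ℝ) / 4) = √((r - 4) * s - 2) := by
    rw [show r * (r - 4) * H + 4 = ((r - 4) * s - 2) ^ (2 : ℝ) by
      rw [rpow_two]; linear_combination (-(r - 4)) * hq, ← rpow_mul hrs.le, Real.sqrt_eq_rpow]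
    norm_num
  have hval : 2 * (√(F v₀) * v₀ * √s / (v₀ ^ 2 * s) * π / √((s + 1) / s * ((r - 4) * s - 2)))
      = 2 * π / (r * (r - 4) * H + 4) ^ ((1 : ℝ) / 4) := by
    rw [hD, ← hFv, show v₀ ^ 2 * s + v₀ ^ 2 = v₀ ^ 2 * (s + 1) by ring,
      Real.sqrt_mul (by positivity), Real.sqrt_sq hv₀.le, Real.sqrt_mul (by positivity),
      Real.sqrt_div (by positivity)]
    have e1 : 0 < √((r - 4) * s - 2) := Real.sqrt_pos.2 hrs
    have e2 : 0 < √(s + 1) := Real.sqrt_pos.2 (by linarith)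
    have e3 : 0 < √s := Real.sqrt_pos.2 hs
    field_simp
    rw [Real.sq_sqrt hs.le]
  rw [← hval]
  refine (key.const_mul 2).congr fun C => ?_
  simp only [hF, div_div, sub_sub]
end

section
/- Let n ≥ 5 and k ≥ 3 be integers and let H be a real number with 1/(tan(π/k))⁴ < H < (k⁴−4)/(n(n−4)). Define q_C(v) = C − v²(v^{−n}+H)^{1/2} − v² for v > 0, let v₀ be its unique positive critical point and c₀ = v₀²(v₀^{−n}+H)^{1/2}+v₀², and for C > c₀ let t₁(C) < v₀ < t₂(C) be the two positive zeros of q_C and P(H,4,n,C) = 2∫_{t₁(C)}^{t₂(C)} √C·t·(t^{−n}+H)^{1/4}/((C−t²)·√(q_C(t))) dt. Then there exists C > c₀ such that P(H,4,n,C) = 2π/k. -/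
open Real Set Filter MeasureTheory
open scoped Topology

/-- A function with a single nondegenerate minimum on `(0,∞)` becomes `f v + z²` in a suitable
`C¹` coordinate `z ∈ ℝ`. -/
theorem exists_morse_coordinate {f f' : ℝ → ℝ} {v B : ℝ} (hv : 0 < v) (hB : 0 < B)
    (hf : ∀ t, 0 < t → HasDerivAt f (f' t) t) (hf'c : ∀ t, 0 < t → ContinuousAt f' t)
    (hneg : ∀ t, 0 < t → t < v → f' t < 0) (hpos : ∀ t, v < t → 0 < f' t)
    (hf'' : HasDerivAt f' B v)
    (hsurj : ∀ C, f v < C → ∃ s t, 0 < s ∧ s < v ∧ v < t ∧ f s = C ∧ f t = C) :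
    ∃ φ φ' : ℝ → ℝ, Continuous φ' ∧ (∀ z, HasDerivAt φ (φ' z) z) ∧ (∀ z, 0 < φ z) ∧
      (∀ z, 0 < φ' z) ∧ StrictMono φ ∧ (∀ t, 0 < t → ∃ z, φ z = t) ∧
      (∀ z, f (φ z) = f v + z ^ 2) ∧ φ 0 = v ∧ φ' 0 = (√(B / 2))⁻¹ := by
  have hf'v : f' v = 0 := by
    apply le_antisymm
    · refine le_of_tendsto (x := 𝓝[<] v) ((hf'c v hv).tendsto.mono_left nhdsWithin_le_nhds) ?_
      filter_upwards [Ioo_mem_nhdsLT hv] with t ht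
      exact (hneg t ht.1 ht.2).le
    · refine ge_of_tendsto (x := 𝓝[>] v) ((hf'c v hv).tendsto.mono_left nhdsWithin_le_nhds) ?_
      filter_upwards [self_mem_nhdsWithin] with t ht
      exact (hpos t ht).le
  have hanti : StrictAntiOn f (Ioc 0 v) := by
    apply strictAntiOn_of_deriv_neg (convex_Ioc 0 v)
    · intro t ht
      exact (hf t ht.1).continuousAt.continuousWithinAt
    · intro t ht
      rw [interior_Ioc] at ht
      rw [(hf t ht.1).deriv]
      exact hneg t ht.1 ht.2
  have hmono : StrictMonoOn f (Ici v) := by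
    apply strictMonoOn_of_deriv_pos (convex_Ici v)
    · intro t ht
      exact (hf t (hv.trans_le ht)).continuousAt.continuousWithinAt
    · intro t ht
      rw [interior_Ici] at ht
      rw [(hf t (hv.trans ht)).deriv]
      exact hpos t ht
  have hmin : ∀ t, 0 < t → t ≠ v → f v < f t := by
    intro t ht htv
    rcases lt_or_gt_of_ne htv with h | h
    · exact hanti ⟨ht, h.le⟩ ⟨hv, le_rfl⟩ h
    · exact hmono (mem_Ici.2 le_rfl) (mem_Ici.2 h.le) h
  set Q : ℝ → ℝ := fun t => (f t - f v) / (t - v) ^ 2 with hQ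
  have hQpos : ∀ t, 0 < t → t ≠ v → 0 < Q t := by
    intro t ht htv
    have := hmin t ht htv
    have h2 : t - v ≠ 0 := sub_ne_zero.2 htv
    simp only [hQ]
    have : 0 < f t - f v := by linarith
    positivity
  have hslope : Tendsto (fun t => f' t / (t - v)) (𝓝[≠] v) (𝓝 B) := by
    have h := hasDerivAt_iff_tendsto_slope.1 hf''
    refine h.congr fun t => ?_
    rw [slope_def_field, hf'v, sub_zero]
  have hpos_ev : ∀ᶠ t in 𝓝[≠] v, 0 < t :=
    (lt_mem_nhds hv).filter_mono nhdsWithin_le_nhds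
  have hne_ev : ∀ᶠ t in 𝓝[≠] v, t ≠ v := self_mem_nhdsWithin
  have hQlim : Tendsto Q (𝓝[≠] v) (𝓝 (B / 2)) := by
    apply HasDerivAt.lhopital_zero_nhdsNE (f' := f') (g' := fun t => 2 * (t - v))
    · filter_upwards [hpos_ev] with t ht
      exact (hf t ht).sub_const _
    · filter_upwards with t
      have := ((hasDerivAt_id t).sub_const v).pow 2
      exact this.congr_deriv (by simp)
    · filter_upwards [hne_ev] with t ht
      have := sub_ne_zero.2 ht
      positivity
    · have : ContinuousAt (fun t => f t - f v) v := (hf v hv).continuousAt.sub continuousAt_const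
      have h := this.tendsto.mono_left (nhdsWithin_le_nhds (s := {v}ᶜ))
      simpa using h
    · have : ContinuousAt (fun t : ℝ => (t - v) ^ 2) v := by fun_prop
      have h := this.tendsto.mono_left (nhdsWithin_le_nhds (s := {v}ᶜ))
      simpa using h
    · have h := hslope.div_const 2
      refine h.congr fun t => ?_
      rw [div_div, mul_comm]
  have hsqrtlim : Tendsto (fun t => √(Q t)) (𝓝[≠] v) (𝓝 (√(B / 2))) :=
    (continuous_sqrt.tendsto _).comp hQlim
  set Z : ℝ → ℝ := fun t => (t - v) * √(Q t) with hZ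
  have hs : 0 < √(B / 2) := sqrt_pos.2 (by positivity)
  have hZsq : ∀ t, 0 < t → Z t ^ 2 = f t - f v := by
    intro t ht
    by_cases htv : t = v
    · simp [hZ, htv]
    · have h2 : t - v ≠ 0 := sub_ne_zero.2 htv
      simp only [hZ]
      rw [mul_pow, sq_sqrt (hQpos t ht htv).le]
      simp only [hQ]
      field_simp
  set Z' : ℝ → ℝ := fun t => if t = v then √(B / 2) else f' t / (2 * Z t) with hZ'
  have hZd : ∀ t, 0 < t → HasDerivAt Z (Z' t) t := by
    intro t ht
    by_cases htv : t = v
    · subst htv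
      rw [hasDerivAt_iff_tendsto_slope]
      simp only [hZ', if_true]
      refine hsqrtlim.congr' ?_
      filter_upwards [hne_ev] with s hs
      have := sub_ne_zero.2 hs
      rw [slope_def_field]
      simp only [hZ]
      field_simp
      simp
    · have h2 : t - v ≠ 0 := sub_ne_zero.2 htv
      have hQd : HasDerivAt Q ((f' t * (t - v) ^ 2 - (f t - f v) * (2 * (t - v))) /
          ((t - v) ^ 2) ^ 2) t := by
        have h3 := ((hasDerivAt_id t).sub_const v).pow 2
        have h4 := ((hf t ht).sub_const (f v)).div h3 (by simpa using h2)
        exact h4.congr_deriv (by simp)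
      have hq := hQpos t ht htv
      have h5 := ((hasDerivAt_id t).sub_const v).mul (hQd.sqrt hq.ne')
      simp only [hZ', if_neg htv]
      refine h5.congr_deriv ?_
      have hsq : 0 < √(Q t) := sqrt_pos.2 hq
      have h6 : f t - f v = √(Q t) ^ 2 * (t - v) ^ 2 := by
        rw [sq_sqrt hq.le]
        simp only [hQ]
        field_simp
      rw [h6]
      simp only [hZ, id]
      field_simp
      ring
  have hZ'pos : ∀ t, 0 < t → 0 < Z' t := by
    intro t ht
    by_cases htv : t = v
    · simp only [hZ', if_pos htv, hs]
    · simp only [hZ', if_neg htv, hZ]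
      have hsq : 0 < √(Q t) := sqrt_pos.2 (hQpos t ht htv)
      rcases lt_or_gt_of_ne htv with h | h
      · apply div_pos_of_neg_of_neg (hneg t ht h)
        have : (t - v) * √(Q t) < 0 := mul_neg_of_neg_of_pos (by linarith) hsq
        linarith
      · have h1 := hpos t h
        have : 0 < t - v := by linarith
        positivity
  have hZ'c : ∀ t, 0 < t → ContinuousAt Z' t := by
    intro t ht
    by_cases htv : t = v
    · subst htv
      rw [continuousAt_iff_punctured_nhds]
      have h := hslope.div (hsqrtlim.const_mul 2) (by positivity)
      have e : Z' t = B / (2 * √(B / 2)) := by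
        simp only [hZ', if_true]
        rw [eq_div_iff (by positivity)]
        have := mul_self_sqrt (show 0 ≤ B / 2 by positivity)
        linarith
      rw [e]
      refine h.congr' ?_
      filter_upwards [hne_ev, hpos_ev] with s hs hs0
      have := sub_ne_zero.2 hs
      have hsq : 0 < √(Q s) := sqrt_pos.2 (hQpos s hs0 hs)
      simp only [hZ', if_neg hs, hZ, Pi.div_apply]
      field_simp
    · have h1 : ContinuousAt (fun s => f' s / (2 * Z s)) t := by
        apply (hf'c t ht).div (continuousAt_const.mul (hZd t ht).continuousAt)
        have hsq : 0 < √(Q t) := sqrt_pos.2 (hQpos t ht htv)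
        have h2 : t - v ≠ 0 := sub_ne_zero.2 htv
        exact mul_ne_zero two_ne_zero (mul_ne_zero h2 hsq.ne')
      refine h1.congr ?_
      filter_upwards [isOpen_ne.mem_nhds htv] with s hs
      simp only [hZ', if_neg hs]
  have hZmono : StrictMonoOn Z (Ioi 0) := by
    apply strictMonoOn_of_deriv_pos (convex_Ioi 0)
    · intro t ht
      exact (hZd t ht).continuousAt.continuousWithinAt
    · intro t ht
      rw [interior_Ioi] at ht
      rw [(hZd t ht).deriv]
      exact hZ'pos t ht
  have hZv : Z v = 0 := by simp [hZ]
  have hZsurj : ∀ z, ∃ t, 0 < t ∧ Z t = z := by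
    intro z
    rcases lt_trichotomy z 0 with h | h | h
    · obtain ⟨s, t, hs0, hsv, -, hs, -⟩ := hsurj (f v + z ^ 2) (by nlinarith)
      refine ⟨s, hs0, ?_⟩
      have h1 : Z s < 0 := hZv ▸ hZmono hs0 hv hsv
      have h2 := hZsq s hs0
      rw [hs, add_sub_cancel_left, sq_eq_sq_iff_abs_eq_abs, abs_of_neg h1, abs_of_neg h] at h2
      linarith
    · exact ⟨v, hv, by rw [hZv, h]⟩
    · obtain ⟨s, t, -, -, hvt, -, hs⟩ := hsurj (f v + z ^ 2) (by nlinarith)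
      refine ⟨t, hv.trans hvt, ?_⟩
      have h1 : 0 < Z t := hZv ▸ hZmono hv (hv.trans hvt) hvt
      have h2 := hZsq t (hv.trans hvt)
      rwa [hs, add_sub_cancel_left, sq_eq_sq_iff_abs_eq_abs, abs_of_pos h1, abs_of_pos h] at h2
  choose φ hφ0 hφ using hZsurj
  have hφmono : StrictMono φ := by
    intro a b hab
    rw [← hZmono.lt_iff_lt (hφ0 a) (hφ0 b), hφ, hφ]
    exact hab
  have hφZ : ∀ t, 0 < t → φ (Z t) = t := fun t ht =>
    hZmono.injOn (hφ0 _) ht (hφ _)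
  have hφc : Continuous φ := by
    have h1 : Monotone (fun z => Real.log (φ z)) := fun a b hab =>
      Real.log_le_log (hφ0 a) (hφmono.monotone hab)
    have h2 : Function.Surjective (fun z => Real.log (φ z)) := fun y =>
      ⟨Z (Real.exp y), by simp [hφZ _ (Real.exp_pos y)]⟩
    have h3 := Real.continuous_exp.comp (h1.continuous_of_surjective h2)
    refine h3.congr fun z => ?_
    simp [Real.exp_log (hφ0 z)]
  have hφ00 : φ 0 = v := by rw [← hZv, hφZ v hv]
  refine ⟨φ, fun z => (Z' (φ z))⁻¹, ?_, ?_, hφ0,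
    fun z => inv_pos.2 (hZ'pos _ (hφ0 z)), hφmono, fun t ht => ⟨Z t, hφZ t ht⟩, ?_, hφ00, ?_⟩
  · rw [continuous_iff_continuousAt]
    intro z
    exact ((hZ'c _ (hφ0 z)).comp hφc.continuousAt).inv₀ (hZ'pos _ (hφ0 z)).ne'
  · intro z
    exact HasDerivAt.of_local_left_inverse hφc.continuousAt (hZd _ (hφ0 z))
      (hZ'pos _ (hφ0 z)).ne' (Eventually.of_forall hφ)
  · intro z
    have := hZsq _ (hφ0 z)
    rw [hφ] at this
    linarith
  · simp only [hφ00, hZ', if_true]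

/-- In a coordinate with `f (φ z) = c + z²`, the substitution `z = r sin θ` removes the
square-root singularities at both ends of the sublevel interval `f < c + r²`. -/
theorem integral_div_sqrt_sublevel {f φ φ' W : ℝ → ℝ} {c r : ℝ}
    (hφ' : Continuous φ') (hφ : ∀ z, HasDerivAt φ (φ' z) z) (hpos : ∀ z, 0 < φ' z)
    (hmono : StrictMono φ) (hf : ∀ z, f (φ z) = c + z ^ 2) (hr : 0 < r)
    (hW : Continuous fun θ => W (φ (r * sin θ))) :
    IntervalIntegrable (fun t => W t / √(c + r ^ 2 - f t)) volume (φ (-r)) (φ r) ∧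
      ∫ t in φ (-r)..φ r, W t / √(c + r ^ 2 - f t) =
        ∫ θ in -(π / 2)..π / 2, φ' (r * sin θ) * W (φ (r * sin θ)) := by
  have hφc : Continuous φ := continuous_iff_continuousAt.2 fun z => (hφ z).continuousAt
  have hle : φ (-r) ≤ φ r := hmono.monotone (by linarith)
  have hle' : -(π / 2) ≤ π / 2 := by linarith [pi_pos]
  set s : Set ℝ := Ioo (-(π / 2)) (π / 2) with hs
  have himage : (fun θ => φ (r * sin θ)) '' s = Ioo (φ (-r)) (φ r) := by
    ext y
    constructor
    · rintro ⟨θ, hθ, rfl⟩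
      have h1 : sin θ < 1 := by
        rw [← sin_pi_div_two]
        exact strictMonoOn_sin ⟨hθ.1.le, hθ.2.le⟩ ⟨hle', le_rfl⟩ hθ.2
      have h2 : -1 < sin θ := by
        rw [← sin_pi_div_two, ← sin_neg]
        exact strictMonoOn_sin ⟨le_rfl, hle'⟩ ⟨hθ.1.le, hθ.2.le⟩ hθ.1
      exact ⟨hmono (by nlinarith), hmono (by nlinarith)⟩
    · rintro ⟨hy1, hy2⟩
      obtain ⟨z, -, rfl⟩ := intermediate_value_Icc (by linarith : -r ≤ r) hφc.continuousOn
        ⟨hy1.le, hy2.le⟩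
      have h1 := hmono.lt_iff_lt.1 hy1
      have h2 := hmono.lt_iff_lt.1 hy2
      have h3 : -1 < z / r := by rw [lt_div_iff₀ hr]; linarith
      have h4 : z / r < 1 := by rw [div_lt_iff₀ hr]; linarith
      refine ⟨arcsin (z / r), ⟨neg_pi_div_two_lt_arcsin.2 h3, arcsin_lt_pi_div_two.2 h4⟩, ?_⟩
      simp only [sin_arcsin h3.le h4.le]
      rw [mul_div_cancel₀ _ hr.ne']
  have hderiv : ∀ θ ∈ s, HasDerivWithinAt (fun θ => φ (r * sin θ))
      (φ' (r * sin θ) * (r * cos θ)) s θ := fun θ _ =>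
    ((hφ (r * sin θ)).comp θ ((hasDerivAt_sin θ).const_mul r)).hasDerivWithinAt
  have hinj : InjOn (fun θ => φ (r * sin θ)) s := by
    intro a ha b hb hab
    have h1 : r * sin a = r * sin b := hmono.injective hab
    exact strictMonoOn_sin.injOn ⟨ha.1.le, ha.2.le⟩ ⟨hb.1.le, hb.2.le⟩
      (mul_left_cancel₀ hr.ne' h1)
  have hcongr : EqOn (fun θ => |φ' (r * sin θ) * (r * cos θ)| •
      (W (φ (r * sin θ)) / √(c + r ^ 2 - f (φ (r * sin θ)))))
      (fun θ => φ' (r * sin θ) * W (φ (r * sin θ))) s := by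
    intro θ hθ
    have hc : 0 < cos θ := cos_pos_of_mem_Ioo hθ
    have hrc : 0 < r * cos θ := mul_pos hr hc
    have h1 : c + r ^ 2 - f (φ (r * sin θ)) = (r * cos θ) ^ 2 := by
      rw [hf]
      linear_combination r ^ 2 * (-sin_sq_add_cos_sq θ)
    simp only [h1, sqrt_sq hrc.le, abs_of_pos (mul_pos (hpos _) hrc), smul_eq_mul]
    field_simp
  have hcont : Continuous fun θ => φ' (r * sin θ) * W (φ (r * sin θ)) :=
    (hφ'.comp (by fun_prop : Continuous fun θ => r * sin θ)).mul hW
  constructor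
  · rw [intervalIntegrable_iff_integrableOn_Ioo_of_le hle, ← himage,
      integrableOn_image_iff_integrableOn_abs_deriv_smul measurableSet_Ioo hderiv hinj,
      integrableOn_congr_fun hcongr measurableSet_Ioo]
    exact hcont.integrableOn_Icc.mono_set Ioo_subset_Icc_self
  · rw [intervalIntegral.integral_of_le hle, intervalIntegral.integral_of_le hle',
      integral_Ioc_eq_integral_Ioo, integral_Ioc_eq_integral_Ioo, ← himage,
      integral_image_eq_integral_abs_deriv_smul measurableSet_Ioo hderiv hinj]
    exact setIntegral_congr_fun measurableSet_Ioo hcongr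

/-- The square root `√(t^{-N} + H)`, as a real power. -/
noncomputable def profile (N H t : ℝ) : ℝ := (t ^ (-N) + H) ^ ((1 : ℝ) / 2)

/-- The integrand of the period function for `m = 4`. -/
noncomputable def periodIntegrand (N H C t : ℝ) : ℝ :=
  √C * t * √(profile N H t) / ((C - t ^ 2) * √(C - t ^ 2 * profile N H t - t ^ 2))

section profile

variable {N H C t : ℝ}

theorem profile_pos (hH : 0 < H) (ht : 0 < t) : 0 < profile N H t := by
  unfold profile
  have := rpow_pos_of_pos ht (-N)
  positivity

theorem profile_sq (hH : 0 < H) (ht : 0 < t) : profile N H t ^ 2 = t ^ (-N) + H := by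
  have := rpow_pos_of_pos ht (-N)
  unfold profile
  rw [← sqrt_eq_rpow, sq_sqrt (by positivity)]

theorem sqrt_profile (hH : 0 < H) (ht : 0 < t) :
    √(profile N H t) = (t ^ (-N) + H) ^ ((1 : ℝ) / 4) := by
  have := rpow_pos_of_pos ht (-N)
  unfold profile
  rw [sqrt_eq_rpow, ← rpow_mul (by positivity)]
  norm_num

theorem sqrt_lt_profile (hH : 0 < H) (ht : 0 < t) : √H < profile N H t := by
  have := rpow_pos_of_pos ht (-N)
  rw [sqrt_lt' (profile_pos hH ht), profile_sq hH ht]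
  linarith

theorem hasDerivAt_profile_s14 (hH : 0 < H) (ht : 0 < t) :
    HasDerivAt (profile N H) (-(N * (profile N H t ^ 2 - H)) / (2 * t * profile N H t)) t := by
  have hx := rpow_pos_of_pos ht (-N)
  have h1 := (hasDerivAt_rpow_const (p := -N) (Or.inl ht.ne')).add_const H
  have h2 := h1.sqrt (by positivity)
  have e : profile N H = fun y => √(y ^ (-N) + H) := by
    funext y
    rw [sqrt_eq_rpow, profile]
  have h3 : √(t ^ (-N) + H) = profile N H t := by rw [e]
  rw [h3] at h2
  rw [profile_sq hH ht, add_sub_cancel_right]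
  rw [← e] at h2
  refine h2.congr_deriv ?_
  have hp := profile_pos (N := N) hH ht
  rw [rpow_sub_one ht.ne']
  field_simp

theorem profile_strictAntiOn (hN : 0 < N) (hH : 0 < H) :
    StrictAntiOn (profile N H) (Ioi 0) := by
  intro a ha b hb hab
  have ha' : (0 : ℝ) < a := ha
  have hb' : (0 : ℝ) < b := hb
  refine lt_of_pow_lt_pow_left₀ 2 (profile_pos hH ha').le ?_
  rw [profile_sq hH ha', profile_sq hH hb']
  have := rpow_lt_rpow_of_neg ha' hab (neg_lt_zero.2 hN)
  linarith

theorem hasDerivAt_sq_mul_profile_add_sq (hH : 0 < H) (ht : 0 < t) :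
    HasDerivAt (fun t => t ^ 2 * profile N H t + t ^ 2)
      (t / (2 * profile N H t) *
        (N * H + 4 * profile N H t - (N - 4) * profile N H t ^ 2)) t := by
  have hp := profile_pos (N := N) hH ht
  have h := ((hasDerivAt_pow 2 t).mul (hasDerivAt_profile_s14 (N := N) hH ht)).add (hasDerivAt_pow 2 t)
  refine h.congr_deriv ?_
  field_simp
  ring

/-- A primitive comparable with the period integrand near both ends of its interval. -/
noncomputable def periodPrimitive (N H C t : ℝ) : ℝ :=
  -arctan √((C - t ^ 2 * profile N H t - t ^ 2) /
    (√H * (C - t ^ 2) + t ^ 2 * profile N H t))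

theorem sub_sq_pos (hH : 0 < H) (ht : 0 < t) (hq : 0 ≤ C - t ^ 2 * profile N H t - t ^ 2) :
    0 < C - t ^ 2 := by
  have hp := profile_pos (N := N) hH ht
  have : 0 < t ^ 2 * profile N H t := by positivity
  linarith

theorem hasDerivAt_periodPrimitive (hH : 0 < H) (ht : 0 < t)
    (hq : 0 < C - t ^ 2 * profile N H t - t ^ 2) :
    HasDerivAt (periodPrimitive N H C)
      (t * (4 * profile N H t ^ 2 * C - N * (profile N H t ^ 2 - H) * (C - t ^ 2)) /
        (4 * profile N H t * (C - t ^ 2) *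
          (√(√H * (C - t ^ 2) + t ^ 2 * profile N H t) *
            √(C - t ^ 2 * profile N H t - t ^ 2)))) t := by
  have hp := profile_pos (N := N) hH ht
  have hu := sub_sq_pos hH ht hq.le
  have hD : 0 < √H * (C - t ^ 2) + t ^ 2 * profile N H t := by positivity
  have d2 := hasDerivAt_pow 2 t
  have dp := hasDerivAt_profile_s14 (N := N) hH ht
  have dq := ((d2.mul dp).const_sub C).sub d2
  have dD := ((d2.const_sub C).const_mul √H).add (d2.mul dp)
  have h := ((dq.div dD hD.ne').sqrt (div_pos hq hD).ne').arctan.neg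
  refine h.congr_deriv ?_
  simp only [Pi.div_apply, Pi.mul_apply, Pi.sub_apply, Pi.add_apply]
  rw [sqrt_div hq.le, div_pow, sq_sqrt hq.le, sq_sqrt hD.le]
  set q := C - t ^ 2 * profile N H t - t ^ 2 with hqdef
  set D := √H * (C - t ^ 2) + t ^ 2 * profile N H t with hDdef
  set y := profile N H t
  have hsq : 0 < √q := sqrt_pos.2 hq
  have hsD : 0 < √D := sqrt_pos.2 hD
  have hsum : q + D = (1 + √H) * (C - t ^ 2) := by rw [hqdef, hDdef]; ring
  have h1 : 1 + q / D = (1 + √H) * (C - t ^ 2) / D := by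
    rw [← hsum]; field_simp; ring
  rw [h1]
  have hD2 : D = √D ^ 2 := (sq_sqrt hD.le).symm
  have hH1 : 0 < 1 + √H := by positivity
  have key : ((-(↑2 * t ^ (2 - 1) * y + t ^ 2 * (-(N * (y ^ 2 - H)) / (2 * t * y))) -
      ↑2 * t ^ (2 - 1)) * D - q * (√H * -(↑2 * t ^ (2 - 1)) + (↑2 * t ^ (2 - 1) * y +
      t ^ 2 * (-(N * (y ^ 2 - H)) / (2 * t * y))))) =
      -((1 + √H) * t * (4 * y ^ 2 * C - N * (y ^ 2 - H) * (C - t ^ 2)) / (2 * y)) := by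
    rw [hqdef, hDdef]
    field_simp
    ring
  push_cast
  rw [key]
  field_simp
  rw [sq_sqrt hD.le]
  ring

theorem continuousOn_periodPrimitive {s : Set ℝ} (hH : 0 < H) (hs : ∀ t ∈ s, 0 < t)
    (hq : ∀ t ∈ s, 0 ≤ C - t ^ 2 * profile N H t - t ^ 2) :
    ContinuousOn (periodPrimitive N H C) s := by
  intro t hts
  have ht := hs t hts
  have hp := profile_pos (N := N) hH ht
  have hu := sub_sq_pos hH ht (hq t hts)
  have hD : 0 < √H * (C - t ^ 2) + t ^ 2 * profile N H t := by positivity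
  have dp := (hasDerivAt_profile_s14 (N := N) hH ht).continuousAt
  apply ContinuousAt.continuousWithinAt
  unfold periodPrimitive
  have h1 : ContinuousAt (fun t => (C - t ^ 2 * profile N H t - t ^ 2) /
      (√H * (C - t ^ 2) + t ^ 2 * profile N H t)) t :=
    ContinuousAt.div (by fun_prop) (by fun_prop) hD.ne'
  exact (continuous_arctan.continuousAt.comp (continuous_sqrt.continuousAt.comp h1)).neg

theorem neg_periodPrimitive_le (hH : 0 < H) (ht : 0 < t)
    (hq : 0 ≤ C - t ^ 2 * profile N H t - t ^ 2) :
    -periodPrimitive N H C t ≤ arctan (√√H)⁻¹ := by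
  have hp := profile_pos (N := N) hH ht
  have hu := sub_sq_pos hH ht hq
  have hD : 0 < √H * (C - t ^ 2) + t ^ 2 * profile N H t := by positivity
  unfold periodPrimitive
  rw [neg_neg, ← sqrt_inv]
  apply arctan_mono
  apply sqrt_le_sqrt
  have ha : 0 < √H := sqrt_pos.2 hH
  rw [inv_eq_one_div, div_le_div_iff₀ hD ha]
  have : 0 < t ^ 2 * profile N H t := by positivity
  nlinarith [mul_pos this ha]

/-- To the right, the integrand is at most a constant times the derivative of the primitive. -/
theorem integral_periodIntegrand_right_le {T e M : ℝ} (hH : 0 < H) (hN : 0 ≤ N) (hT : 0 < T)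
    (hTe : T ≤ e) (hM : 0 ≤ M)
    (hMp : ∀ t, T ≤ t → 4 * profile N H t ^ 2 ≤
      M * (4 * profile N H t ^ 2 - N * (profile N H t ^ 2 - H)))
    (hq : ∀ t ∈ Ico T e, 0 < C - t ^ 2 * profile N H t - t ^ 2)
    (hqe : C - e ^ 2 * profile N H e - e ^ 2 = 0)
    (hint : IntervalIntegrable (periodIntegrand N H C) volume T e) :
    ∫ t in T..e, periodIntegrand N H C t ≤ M * arctan (√√H)⁻¹ := by
  have hq' : ∀ t ∈ Icc T e, 0 ≤ C - t ^ 2 * profile N H t - t ^ 2 := by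
    intro t ht
    rcases ht.2.eq_or_lt with h | h
    · rw [h, hqe]
    · exact (hq t ⟨ht.1, h⟩).le
  have hpos : ∀ t ∈ Icc T e, 0 < t := fun t ht => hT.trans_le ht.1
  have h := intervalIntegral.integral_le_sub_of_hasDeriv_right_of_le hTe
    ((continuousOn_periodPrimitive hH hpos hq').const_smul M)
    (fun t ht => ((hasDerivAt_periodPrimitive hH (hT.trans ht.1)
      (hq t ⟨ht.1.le, ht.2⟩)).const_smul M).hasDerivWithinAt)
    ((intervalIntegrable_iff_integrableOn_Icc_of_le hTe).1 hint) ?_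
  · refine h.trans ?_
    have h0 : periodPrimitive N H C e = 0 := by simp [periodPrimitive, hqe]
    have h1 := neg_periodPrimitive_le hH hT (hq' T ⟨le_rfl, hTe⟩)
    simp only [Pi.smul_apply, smul_eq_mul, h0]
    nlinarith
  · intro t ht
    have ht0 := hT.trans ht.1
    have hqt := hq t ⟨ht.1.le, ht.2⟩
    have hp := profile_pos (N := N) hH ht0
    have hu := sub_sq_pos hH ht0 hqt.le
    have hD : 0 < √H * (C - t ^ 2) + t ^ 2 * profile N H t := by positivity
    have hMt := hMp t ht.1.le
    have hay := (sqrt_lt_profile (N := N) hH ht0).le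
    have hx : 0 ≤ profile N H t ^ 2 - H := by
      rw [profile_sq hH ht0, add_sub_cancel_right]
      exact (rpow_pos_of_pos ht0 _).le
    have hC : 0 < C := by nlinarith [sq_nonneg t]
    have hsD : √C * √(profile N H t) * √(√H * (C - t ^ 2) + t ^ 2 * profile N H t) ≤
        C * profile N H t := by
      rw [← sqrt_mul hC.le, ← sqrt_mul (by positivity), sqrt_le_left (by positivity), mul_pow]
      have : √H * (C - t ^ 2) + t ^ 2 * profile N H t ≤ C * profile N H t := by nlinarith
      nlinarith [mul_pos hC hp]
    have hsq : 0 < √(C - t ^ 2 * profile N H t - t ^ 2) := sqrt_pos.2 hqt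
    have hsD0 : 0 < √(√H * (C - t ^ 2) + t ^ 2 * profile N H t) := sqrt_pos.2 hD
    unfold periodIntegrand
    generalize √(C - t ^ 2 * profile N H t - t ^ 2) = Q at *
    generalize √(√H * (C - t ^ 2) + t ^ 2 * profile N H t) = E at *
    generalize profile N H t = y at *
    generalize hw : C - t ^ 2 = u at *
    have huC : u ≤ C := by rw [← hw]; nlinarith [sq_nonneg t]
    rw [smul_eq_mul, mul_div_assoc', div_le_div_iff₀ (by positivity) (by positivity)]
    have h3 : 4 * y * (√C * √y * E) ≤ M * (4 * y ^ 2 * C - N * (y ^ 2 - H) * u) := by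
      have h4 : 4 * y * (√C * √y * E) ≤ 4 * y ^ 2 * C := by nlinarith
      have h5 : M * (N * (y ^ 2 - H) * u) ≤ M * (N * (y ^ 2 - H) * C) := by gcongr
      nlinarith
    have h6 : 0 ≤ t * u * Q := by positivity
    nlinarith [mul_le_mul_of_nonneg_left h3 h6]

/-- To the left, the integrand is at most a small constant times minus the derivative of the
primitive. -/
theorem integral_periodIntegrand_left_le {s τ ε : ℝ} (hH : 0 < H) (hC : 1 ≤ C) (hs : 0 < s)
    (hsτ : s ≤ τ)
    (hε : ∀ t, 0 < t → t ≤ τ → √H / profile N H t + t ^ 2 ≤ ε ^ 2) (hε0 : 0 < ε)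
    (hNp : ∀ t, 0 < t → t ≤ τ → 9 / 2 * profile N H t ^ 2 ≤
      N * (profile N H t ^ 2 - H) * (1 - t ^ 2))
    (hN : 0 ≤ N)
    (hq : ∀ t ∈ Ioc s τ, 0 < C - t ^ 2 * profile N H t - t ^ 2)
    (hqs : C - s ^ 2 * profile N H s - s ^ 2 = 0)
    (hint : IntervalIntegrable (periodIntegrand N H C) volume s τ) :
    ∫ t in s..τ, periodIntegrand N H C t ≤ 8 * ε * (π / 2) := by
  have hq' : ∀ t ∈ Icc s τ, 0 ≤ C - t ^ 2 * profile N H t - t ^ 2 := by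
    intro t ht
    rcases ht.1.eq_or_lt with h | h
    · rw [← h, hqs]
    · exact (hq t ⟨h, ht.2⟩).le
  have hpos : ∀ t ∈ Icc s τ, 0 < t := fun t ht => hs.trans_le ht.1
  have h := intervalIntegral.integral_le_sub_of_hasDeriv_right_of_le hsτ
    ((continuousOn_periodPrimitive hH hpos hq').const_smul (-(8 * ε)))
    (fun t ht => ((hasDerivAt_periodPrimitive hH (hs.trans ht.1)
      (hq t ⟨ht.1, ht.2.le⟩)).const_smul (-(8 * ε))).hasDerivWithinAt)
    ((intervalIntegrable_iff_integrableOn_Icc_of_le hsτ).1 hint) ?_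
  · refine h.trans ?_
    have h0 : periodPrimitive N H C s = 0 := by simp [periodPrimitive, hqs]
    have h1 : -periodPrimitive N H C τ ≤ π / 2 := by
      unfold periodPrimitive
      rw [neg_neg]
      exact (arctan_lt_pi_div_two _).le
    simp only [Pi.smul_apply, smul_eq_mul, h0]
    nlinarith
  · intro t ht
    have ht0 := hs.trans ht.1
    have hqt := hq t ⟨ht.1, ht.2.le⟩
    have hp := profile_pos (N := N) hH ht0
    have hu := sub_sq_pos hH ht0 hqt.le
    have hD : 0 < √H * (C - t ^ 2) + t ^ 2 * profile N H t := by positivity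
    have hεt := hε t ht0 ht.2.le
    have hNt := hNp t ht0 ht.2.le
    have hx : 0 ≤ profile N H t ^ 2 - H := by
      rw [profile_sq hH ht0, add_sub_cancel_right]
      exact (rpow_pos_of_pos ht0 _).le
    have hC0 : 0 < C := by linarith
    have hsD : √C * √(profile N H t) * √(√H * (C - t ^ 2) + t ^ 2 * profile N H t) ≤
        C * profile N H t * ε := by
      rw [← sqrt_mul hC0.le, ← sqrt_mul (by positivity), sqrt_le_left (by positivity)]
      have h1 : √H * (C - t ^ 2) + t ^ 2 * profile N H t ≤ C * profile N H t * ε ^ 2 := by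
        have h2 : √H + t ^ 2 * profile N H t ≤ profile N H t * ε ^ 2 := by
          calc √H + t ^ 2 * profile N H t
              = profile N H t * (√H / profile N H t + t ^ 2) := by field_simp
            _ ≤ _ := by gcongr
        have h3 : 0 ≤ √H * t ^ 2 := by positivity
        have h4 : 0 ≤ t ^ 2 * profile N H t := by positivity
        nlinarith [mul_le_mul_of_nonneg_left h2 hC0.le]
      nlinarith [mul_pos hC0 hp]
    have hsq : 0 < √(C - t ^ 2 * profile N H t - t ^ 2) := sqrt_pos.2 hqt
    have hsD0 : 0 < √(√H * (C - t ^ 2) + t ^ 2 * profile N H t) := sqrt_pos.2 hD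
    unfold periodIntegrand
    generalize √(C - t ^ 2 * profile N H t - t ^ 2) = Q at *
    generalize √(√H * (C - t ^ 2) + t ^ 2 * profile N H t) = E at *
    generalize profile N H t = y at *
    generalize hw : C - t ^ 2 = u at *
    have huC : C * (1 - t ^ 2) ≤ u := by rw [← hw]; nlinarith [sq_nonneg t]
    rw [smul_eq_mul, mul_div_assoc', div_le_div_iff₀ (by positivity) (by positivity)]
    have h3 : 4 * y * (√C * √y * E) ≤
        -(8 * ε) * (4 * y ^ 2 * C - N * (y ^ 2 - H) * u) := by
      have h4 : 4 * y * (√C * √y * E) ≤ 4 * y ^ 2 * C * ε := by nlinarith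
      have h5 : N * (y ^ 2 - H) * (C * (1 - t ^ 2)) ≤ N * (y ^ 2 - H) * u := by gcongr
      have h7 : 9 / 2 * y ^ 2 * C ≤ N * (y ^ 2 - H) * u := by nlinarith
      nlinarith
    have h6 : 0 ≤ t * u * Q := by positivity
    nlinarith [mul_le_mul_of_nonneg_left h3 h6]

end profile

/-- For large `C` the half period is below any bound exceeding `arctan (H^{-1/4})`. -/
theorem exists_forall_integral_periodIntegrand_lt {N H v L : ℝ} (hN : 5 ≤ N) (hH : 0 < H)
    (hv : 0 < v) (hL : arctan (√√H)⁻¹ < L) :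
    ∃ C₀, ∀ C s e, C₀ ≤ C → 0 < s → s < v → v < e →
      C - s ^ 2 * profile N H s - s ^ 2 = 0 → C - e ^ 2 * profile N H e - e ^ 2 = 0 →
      (∀ t ∈ Ioo s e, 0 < C - t ^ 2 * profile N H t - t ^ 2) →
      IntervalIntegrable (periodIntegrand N H C) volume s e →
      ∫ t in s..e, periodIntegrand N H C t < L := by
  have hN0 : 0 < N := by linarith
  have hA : 0 < arctan (√√H)⁻¹ := arctan_pos.2 (by positivity)
  set A := arctan (√√H)⁻¹
  obtain ⟨M, hM1, hMA⟩ : ∃ M, 1 < M ∧ M * A < L := by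
    refine ⟨(L + A) / (2 * A), ?_, ?_⟩
    · rw [lt_div_iff₀ (by positivity)]; linarith
    · rw [div_mul_eq_mul_div, div_lt_iff₀ (by positivity)]; nlinarith
  have hM0 : 0 < M := by linarith
  set δ := L - M * A with hδdef
  have hδ : 0 < δ := by linarith
  obtain ⟨T, hTv, hT⟩ : ∃ T, v < T ∧ T ^ (-N) < (M - 1) * (4 * H) / (M * N) := by
    have h1 : 0 < (M - 1) * (4 * H) / (M * N) := by
      have : 0 < M - 1 := by linarith
      positivity
    exact ((eventually_gt_atTop v).and
      ((tendsto_rpow_neg_atTop hN0).eventually (gt_mem_nhds h1))).exists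
  have hT0 : 0 < T := hv.trans hTv
  have hMp : ∀ t, T ≤ t → 4 * profile N H t ^ 2 ≤
      M * (4 * profile N H t ^ 2 - N * (profile N H t ^ 2 - H)) := by
    intro t ht
    have h1 : t ^ (-N) ≤ T ^ (-N) := rpow_le_rpow_of_nonpos hT0 ht (by linarith)
    have h2 := rpow_pos_of_pos (hT0.trans_le ht) (-N)
    have h3 := h1.trans_lt hT
    rw [lt_div_iff₀ (by positivity)] at h3
    rw [profile_sq hH (hT0.trans_le ht), add_sub_cancel_right]
    nlinarith
  obtain ⟨ε, hε0, hεδ⟩ : ∃ ε, 0 < ε ∧ 8 * ε * (π / 2) = δ / 4 := by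
    refine ⟨δ / (16 * π), by positivity, ?_⟩
    field_simp
    norm_num
  obtain ⟨τ, hτ0, hτv, hτ⟩ : ∃ τ, 0 < τ ∧ τ < v ∧ ∀ t, 0 < t → t ≤ τ →
      (2 * √H / ε ^ 2) ^ 2 ≤ t ^ (-N) ∧ 18 * H ≤ t ^ (-N) ∧ t ^ 2 ≤ ε ^ 2 / 2 ∧
        t ^ 2 ≤ 1 / 20 ∧ t < v := by
    have h1 : Tendsto (fun t : ℝ => t ^ (-N)) (𝓝[>] 0) atTop := by
      have := (tendsto_rpow_atTop hN0).comp tendsto_inv_nhdsGT_zero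
      refine this.congr' ?_
      filter_upwards [self_mem_nhdsWithin] with t ht
      have ht' : (0 : ℝ) < t := ht
      simp [inv_rpow ht'.le, rpow_neg ht'.le]
    have h2 : Tendsto (fun t : ℝ => t ^ 2) (𝓝[>] 0) (𝓝 0) := by
      have : ContinuousAt (fun t : ℝ => t ^ 2) 0 := by fun_prop
      have := this.tendsto.mono_left (nhdsWithin_le_nhds (s := Ioi 0))
      simpa using this
    have h3 := (h1.eventually_ge_atTop ((2 * √H / ε ^ 2) ^ 2)).and
      ((h1.eventually_ge_atTop (18 * H)).and
        ((h2.eventually (ge_mem_nhds (show (0 : ℝ) < ε ^ 2 / 2 by positivity))).and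
          ((h2.eventually (ge_mem_nhds (show (0 : ℝ) < 1 / 20 by norm_num))).and
            ((gt_mem_nhds hv).filter_mono nhdsWithin_le_nhds))))
    obtain ⟨τ, hτ0, hτ⟩ := mem_nhdsGT_iff_exists_Ioc_subset.1 h3
    exact ⟨τ, hτ0, (hτ ⟨hτ0, le_rfl⟩).2.2.2.2, fun t h0 h1 => hτ ⟨h0, h1⟩⟩
  have hεp : ∀ t, 0 < t → t ≤ τ → √H / profile N H t + t ^ 2 ≤ ε ^ 2 := by
    intro t h0 ht
    obtain ⟨h1, -, h2, -, -⟩ := hτ t h0 ht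
    have hp := profile_pos (N := N) hH h0
    have h3 : 2 * √H / ε ^ 2 ≤ profile N H t := by
      refine le_of_sq_le_sq ?_ hp.le
      rw [profile_sq hH h0]
      linarith
    rw [div_le_iff₀ (by positivity)] at h3
    have : √H / profile N H t ≤ ε ^ 2 / 2 := by
      rw [div_le_iff₀ hp]; linarith
    linarith
  have hNp : ∀ t, 0 < t → t ≤ τ → 9 / 2 * profile N H t ^ 2 ≤
      N * (profile N H t ^ 2 - H) * (1 - t ^ 2) := by
    intro t h0 ht
    obtain ⟨-, h1, -, h2, -⟩ := hτ t h0 ht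
    rw [profile_sq hH h0, add_sub_cancel_right]
    have h3 := rpow_pos_of_pos h0 (-N)
    have h4 : 5 * t ^ (-N) * (19 / 20) ≤ N * t ^ (-N) * (1 - t ^ 2) := by
      gcongr
      linarith
    linarith
  have hyτ := profile_pos (N := N) hH hτ0
  set B := T ^ 2 * profile N H τ + T ^ 2 with hB
  have hB0 : 0 < B := by positivity
  have hle : ∀ t, τ ≤ t → t ≤ T →
      profile N H t ≤ profile N H τ ∧ t ^ 2 * profile N H t + t ^ 2 ≤ B := by
    intro t h1 h2
    have h0 : 0 < t := hτ0.trans_le h1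
    have h3 := (profile_strictAntiOn hN0 hH).antitoneOn hτ0 h0 h1
    have h4 := profile_pos (N := N) hH h0
    exact ⟨h3, by rw [hB]; gcongr⟩
  set K := 4 * T * √(profile N H τ) with hK
  have hK0 : 0 < K := by positivity
  refine ⟨1 + 2 * B + 4 * K * T / δ, ?_⟩
  intro C s e hC hs hsv hve hqs hqe hq hint
  have hKT : 0 < 4 * K * T / δ := by positivity
  have hC1 : 1 ≤ C := by linarith
  have hCB : 2 * B ≤ C := by linarith
  have hCK : 4 * K * T / δ ≤ C := by linarith
  have hsτ : s < τ := by
    by_contra! h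
    linarith [(hle s h (hsv.trans hTv).le).2]
  have hTe : T < e := by
    by_contra! h
    linarith [(hle e (hτv.trans hve).le h).2]
  have hτT : τ < T := hτv.trans hTv
  have hi1 : IntervalIntegrable (periodIntegrand N H C) volume s τ :=
    hint.mono_set (by
      rw [uIcc_of_le hsτ.le, uIcc_of_le (by linarith)]
      exact Icc_subset_Icc le_rfl (by linarith))
  have hi2 : IntervalIntegrable (periodIntegrand N H C) volume τ T :=
    hint.mono_set (by
      rw [uIcc_of_le hτT.le, uIcc_of_le (by linarith)]
      exact Icc_subset_Icc (by linarith) (by linarith))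
  have hi3 : IntervalIntegrable (periodIntegrand N H C) volume T e :=
    hint.mono_set (by
      rw [uIcc_of_le hTe.le, uIcc_of_le (by linarith)]
      exact Icc_subset_Icc (by linarith) le_rfl)
  have hleft := integral_periodIntegrand_left_le hH hC1 hs hsτ.le hεp hε0 hNp hN0.le
    (fun t ht => hq t ⟨ht.1, by linarith [ht.2]⟩) hqs hi1
  have hright := integral_periodIntegrand_right_le hH hN0.le hT0 hTe.le hM0.le hMp
    (fun t ht => hq t ⟨by linarith [ht.1], ht.2⟩) hqe hi3
  have hmid : ∫ t in τ..T, periodIntegrand N H C t ≤ ∫ t in τ..T, K / C := by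
    refine intervalIntegral.integral_mono_on hτT.le hi2 (by simp) ?_
    intro t ht
    have h0 : 0 < t := hτ0.trans_le ht.1
    obtain ⟨h1, h2⟩ := hle t ht.1 ht.2
    have hp := profile_pos (N := N) hH h0
    have h3 : 0 ≤ t ^ 2 * profile N H t := by positivity
    have h4 : √C / 2 ≤ √(C - t ^ 2 * profile N H t - t ^ 2) := by
      apply le_sqrt_of_sq_le
      rw [div_pow, sq_sqrt (by linarith)]
      linarith
    have h5 : C / 2 ≤ C - t ^ 2 := by linarith
    have h6 : 0 < √C := sqrt_pos.2 (by linarith)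
    have h7 : 0 ≤ C - t ^ 2 := by linarith
    calc periodIntegrand N H C t
        ≤ √C * T * √(profile N H τ) / ((C / 2) * (√C / 2)) := by
          unfold periodIntegrand
          gcongr
          exact ht.2
      _ = K / C := by rw [hK]; field_simp; norm_num
  have hmid' : ∫ t in τ..T, K / C ≤ δ / 4 := by
    rw [intervalIntegral.integral_const, smul_eq_mul, mul_div_assoc', div_le_iff₀ (by linarith)]
    rw [div_le_iff₀ hδ] at hCK
    nlinarith
  have hsplit : ∫ t in s..e, periodIntegrand N H C t =
      (∫ t in s..τ, periodIntegrand N H C t) + (∫ t in τ..T, periodIntegrand N H C t) +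
        ∫ t in T..e, periodIntegrand N H C t := by
    rw [intervalIntegral.integral_add_adjacent_intervals hi1 hi2,
      intervalIntegral.integral_add_adjacent_intervals (hi1.trans hi2) hi3]
  rw [hsplit]
  linarith

theorem hasDerivAt_deriv_sq_mul_profile_add_sq {N H v : ℝ} (hH : 0 < H) (hv : 0 < v)
    (hcrit : N * H + 4 * profile N H v - (N - 4) * profile N H v ^ 2 = 0) :
    HasDerivAt (fun t => t / (2 * profile N H t) *
        (N * H + 4 * profile N H t - (N - 4) * profile N H t ^ 2))
      (2 * ((1 + profile N H v) * ((N - 4) * profile N H v - 2) / profile N H v)) v := by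
  have hp := profile_pos (N := N) hH hv
  have dp := hasDerivAt_profile_s14 (N := N) hH hv
  have h := ((hasDerivAt_id v).div (dp.const_mul 2) (by positivity)).mul
    (((dp.const_mul 4).const_add (N * H)).sub ((dp.pow 2).const_mul (N - 4)))
  refine h.congr_deriv ?_
  simp only [Pi.div_apply, Pi.sub_apply, Pi.pow_apply, id]
  rw [hcrit, mul_zero, zero_add]
  have hx : N * (profile N H v ^ 2 - H) = 4 * profile N H v ^ 2 + 4 * profile N H v := by
    linarith
  rw [hx]
  field_simp
  ring

/-- The value of the half period in the limit of small oscillations. -/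
theorem small_oscillation_limit {v y m : ℝ} (hv : 0 < v) (hy : 0 < y) (hm : 0 < m) :
    (√((1 + y) * m / y))⁻¹ *
      (√(v ^ 2 * y + v ^ 2) * v * √y / (v ^ 2 * y + v ^ 2 - v ^ 2)) = (√m)⁻¹ := by
  have h1 : √(v ^ 2 * y + v ^ 2) = v * √(1 + y) := by
    rw [show v ^ 2 * y + v ^ 2 = v ^ 2 * (1 + y) by ring, sqrt_mul (sq_nonneg v), sqrt_sq hv.le]
  have hsy : 0 < √y := sqrt_pos.2 hy
  have hsm : 0 < √m := sqrt_pos.2 hm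
  have hs1 : 0 < √(1 + y) := sqrt_pos.2 (by linarith)
  rw [h1, sqrt_div (by positivity), sqrt_mul (by positivity), add_sub_cancel_right]
  field_simp
  rw [sq_sqrt hy.le]

theorem arctan_inv_fourth_root_lt {H x : ℝ} (hx0 : 0 < x) (hx : x < π / 2)
    (h : 1 / tan x ^ 4 < H) : arctan (√√H)⁻¹ < x := by
  have ht : 0 < tan x := tan_pos_of_pos_of_lt_pi_div_two hx0 hx
  have hH : 0 < H := lt_trans (by positivity) h
  have hs : 0 < √√H := by positivity
  rw [← arctan_tan (by linarith) hx]
  apply arctan_strictMono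
  rw [inv_lt_iff_one_lt_mul₀ hs]
  refine lt_of_pow_lt_pow_left₀ 4 (by positivity) ?_
  have h4 : √√H ^ 4 = H := by
    rw [show √√H ^ 4 = (√√H ^ 2) ^ 2 by ring, sq_sqrt (sqrt_nonneg H), sq_sqrt hH.le]
  rw [mul_pow, h4, one_pow]
  rw [div_lt_iff₀ (by positivity)] at h
  linarith


/-- Analytic core of Theorem 5.1: for `n ≥ 5`, `k ≥ 3` and
`1/(tan(π/k))⁴ < H < (k⁴-4)/(n(n-4))`, there exists `C > c₀` such that the period
`P(H,4,n,C) = 2∫_{t₁(C)}^{t₂(C)} √C t (t^{-n}+H)^{1/4} / ((C-t²)√(q_C(t))) dt`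
equals `2π/k`.  Here `q_C(v) = C - v²(v^{-n}+H)^{1/2} - v²`, `v₀` is its unique
positive critical point (independent of `C`), `c₀ = v₀²(v₀^{-n}+H)^{1/2} + v₀²`,
and `t₁(C) < v₀ < t₂(C)` are the two positive zeros of `q_C` for `C > c₀`. -/
theorem exists_period_m4 (n k : ℕ) (hn : 5 ≤ n) (hk : 3 ≤ k) (H : ℝ)
    (h1 : 1 / Real.tan (π / k) ^ 4 < H)
    (h2 : H < ((k : ℝ) ^ 4 - 4) / ((n : ℝ) * ((n : ℝ) - 4)))
    (v₀ : ℝ) (hv₀ : 0 < v₀)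
    (hcrit : ∀ C : ℝ,
      deriv (fun u : ℝ => C - u ^ 2 * (u ^ (-(n : ℝ)) + H) ^ ((1 : ℝ) / 2) - u ^ 2) v₀ = 0)
    (huniq : ∀ C v : ℝ, 0 < v →
      deriv (fun u : ℝ => C - u ^ 2 * (u ^ (-(n : ℝ)) + H) ^ ((1 : ℝ) / 2) - u ^ 2) v = 0 →
      v = v₀)
    (t₁ t₂ : ℝ → ℝ)
    (hroots : ∀ C : ℝ, v₀ ^ 2 * (v₀ ^ (-(n : ℝ)) + H) ^ ((1 : ℝ) / 2) + v₀ ^ 2 < C →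
      0 < t₁ C ∧ t₁ C < v₀ ∧ v₀ < t₂ C ∧
      C - (t₁ C) ^ 2 * ((t₁ C) ^ (-(n : ℝ)) + H) ^ ((1 : ℝ) / 2) - (t₁ C) ^ 2 = 0 ∧
      C - (t₂ C) ^ 2 * ((t₂ C) ^ (-(n : ℝ)) + H) ^ ((1 : ℝ) / 2) - (t₂ C) ^ 2 = 0 ∧
      ∀ t ∈ Set.Ioo (t₁ C) (t₂ C),
        0 < C - t ^ 2 * (t ^ (-(n : ℝ)) + H) ^ ((1 : ℝ) / 2) - t ^ 2) :
    ∃ C : ℝ, v₀ ^ 2 * (v₀ ^ (-(n : ℝ)) + H) ^ ((1 : ℝ) / 2) + v₀ ^ 2 < C ∧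
      2 * ∫ t in (t₁ C)..(t₂ C),
          Real.sqrt C * t * (t ^ (-(n : ℝ)) + H) ^ ((1 : ℝ) / 4) /
            ((C - t ^ 2) *
              Real.sqrt (C - t ^ 2 * (t ^ (-(n : ℝ)) + H) ^ ((1 : ℝ) / 2) - t ^ 2)) =
        2 * π / k := by
  have hN : (5 : ℝ) ≤ n := by exact_mod_cast hn
  have hK : (3 : ℝ) ≤ k := by exact_mod_cast hk
  generalize (n : ℝ) = N at *
  generalize (k : ℝ) = κ at *
  have hκ0 : 0 < κ := by linarith
  have hx0 : 0 < π / κ := by positivity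
  have hx : π / κ < π / 2 := div_lt_div_of_pos_left pi_pos (by norm_num) (by linarith)
  have hH : 0 < H := lt_of_le_of_lt (by positivity) h1
  have hA := arctan_inv_fourth_root_lt hx0 hx h1
  simp only [← profile.eq_def] at hcrit hroots ⊢
  clear h1 huniq
  set y := profile N H v₀ with hy
  have hy0 : 0 < y := profile_pos hH hv₀
  have hp0 : N * H + 4 * y - (N - 4) * y ^ 2 = 0 := by
    have h := hcrit 0
    have hd : HasDerivAt (fun u : ℝ => 0 - u ^ 2 * profile N H u - u ^ 2)
        (-(v₀ / (2 * y) * (N * H + 4 * y - (N - 4) * y ^ 2))) v₀ := by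
      refine (hasDerivAt_sq_mul_profile_add_sq hH hv₀).neg.congr_of_eventuallyEq
        (Eventually.of_forall fun u => ?_)
      simp only [Pi.neg_apply]
      ring
    rw [hd.deriv, neg_eq_zero] at h
    exact (mul_eq_zero.1 h).resolve_left (by positivity)
  have hNy : 4 < (N - 4) * y := by
    have : 0 < N * H := by positivity
    nlinarith
  set m := (N - 4) * y - 2 with hm
  have hm0 : 0 < m := by linarith
  have hmκ : m < κ ^ 2 := by
    have h3 : 0 < N * (N - 4) := mul_pos (by linarith) (by linarith)
    rw [lt_div_iff₀ h3] at h2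
    refine lt_of_pow_lt_pow_left₀ 2 (by positivity) ?_
    have : m ^ 2 = 4 + N * (N - 4) * H := by
      rw [hm]
      linear_combination (-(N - 4)) * hp0
    rw [this]
    linarith
  set c := v₀ ^ 2 * y + v₀ ^ 2 with hc
  have hfactor : ∀ t, N * H + 4 * profile N H t - (N - 4) * profile N H t ^ 2 =
      -((profile N H t - y) * ((N - 4) * profile N H t + ((N - 4) * y - 4))) := fun t => by
    linear_combination hp0
  have hanti := profile_strictAntiOn (N := N) (by linarith) hH
  have hfd := fun t (ht : 0 < t) => hasDerivAt_sq_mul_profile_add_sq (N := N) hH ht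
  obtain ⟨φ, φ', hφ'c, hφ, hφ0, hφ'0, hφm, hφs, hfφ, hφv, hφ'v⟩ := exists_morse_coordinate
    (f := fun t => t ^ 2 * profile N H t + t ^ 2) (v := v₀)
    (B := 2 * ((1 + y) * m / y)) hv₀ (by positivity) hfd
    (by
      intro t ht
      have dp := (hasDerivAt_profile_s14 (N := N) hH ht).continuousAt
      have hp := profile_pos (N := N) hH ht
      exact (continuousAt_id.div (by fun_prop) (by positivity)).mul (by fun_prop))
    (by
      intro t ht htv
      have hp := profile_pos (N := N) hH ht
      have h3 : y < profile N H t := hanti ht hv₀ htv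
      rw [hfactor]
      have h4 : 0 < (N - 4) * profile N H t := mul_pos (by linarith) hp
      have h5 : 0 < (profile N H t - y) * ((N - 4) * profile N H t + ((N - 4) * y - 4)) :=
        mul_pos (by linarith) (by linarith)
      exact mul_neg_of_pos_of_neg (by positivity) (by linarith))
    (by
      intro t htv
      have ht := hv₀.trans htv
      have hp := profile_pos (N := N) hH ht
      have h3 : profile N H t < y := hanti hv₀ ht htv
      rw [hfactor]
      have h4 : 0 < (N - 4) * profile N H t := mul_pos (by linarith) hp
      have h5 : 0 < (y - profile N H t) * ((N - 4) * profile N H t + ((N - 4) * y - 4)) :=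
        mul_pos (by linarith) (by linarith)
      exact mul_pos (by positivity) (by linarith))
    (hasDerivAt_deriv_sq_mul_profile_add_sq hH hv₀ hp0)
    (by
      intro C hC
      obtain ⟨a1, a2, a3, a4, a5, -⟩ := hroots C hC
      exact ⟨t₁ C, t₂ C, a1, a2, a3, by linarith, by linarith⟩)
  have hφc : Continuous φ := continuous_iff_continuousAt.2 fun z => (hφ z).continuousAt
  simp only [← hy, ← hc] at hfφ
  set W : ℝ → ℝ → ℝ := fun C t => √C * t * √(profile N H t) / (C - t ^ 2) with hW
  have hYc : Continuous fun z => profile N H (φ z) := continuous_iff_continuousAt.2 fun z =>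
    (hasDerivAt_profile_s14 (N := N) hH (hφ0 z)).continuousAt.comp hφc.continuousAt
  have hWc : Continuous fun p : ℝ × ℝ => W (c + p.1 ^ 2) (φ (p.1 * sin p.2)) := by
    have hYp : Continuous fun p : ℝ × ℝ => profile N H (φ (p.1 * sin p.2)) :=
      hYc.comp (by fun_prop : Continuous fun p : ℝ × ℝ => p.1 * sin p.2)
    refine Continuous.div (by fun_prop) (by fun_prop) fun p => ?_
    have h3 := hfφ (p.1 * sin p.2)
    have h4 : 0 < φ (p.1 * sin p.2) ^ 2 * profile N H (φ (p.1 * sin p.2)) :=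
      mul_pos (pow_pos (hφ0 _) 2) (profile_pos hH (hφ0 _))
    have h5 : (p.1 * sin p.2) ^ 2 ≤ p.1 ^ 2 := by
      rw [mul_pow]
      nlinarith [sin_sq_le_one p.2, sq_nonneg p.1]
    have : 0 < c + p.1 ^ 2 - φ (p.1 * sin p.2) ^ 2 := by linarith
    exact this.ne'
  set G : ℝ → ℝ := fun r =>
    ∫ θ in -(π / 2)..π / 2, φ' (r * sin θ) * W (c + r ^ 2) (φ (r * sin θ)) with hG
  have hGc : Continuous G := by
    apply intervalIntegral.continuous_parametric_intervalIntegral_of_continuous'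
    exact Continuous.mul (by fun_prop) hWc
  have hends : ∀ r, 0 < r → t₁ (c + r ^ 2) = φ (-r) ∧ t₂ (c + r ^ 2) = φ r := by
    intro r hr
    obtain ⟨a1, a2, a3, a4, a5, -⟩ := hroots (c + r ^ 2) (by nlinarith)
    obtain ⟨z₁, hz₁⟩ := hφs _ a1
    obtain ⟨z₂, hz₂⟩ := hφs _ ((a1.trans a2).trans a3)
    have b1 := hfφ z₁
    have b2 := hfφ z₂
    rw [← hz₁, ← hφv, hφm.lt_iff_lt] at a2
    rw [← hz₂, ← hφv, hφm.lt_iff_lt] at a3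
    rw [hz₁] at b1
    rw [hz₂] at b2
    have e1 : z₁ = -r := by
      have : z₁ ^ 2 = r ^ 2 := by linarith
      rcases sq_eq_sq_iff_eq_or_eq_neg.1 this with h | h
      · linarith
      · exact h
    have e2 : z₂ = r := by
      have : z₂ ^ 2 = r ^ 2 := by linarith
      rcases sq_eq_sq_iff_eq_or_eq_neg.1 this with h | h
      · exact h
      · linarith
    exact ⟨by rw [← hz₁, e1], by rw [← hz₂, e2]⟩
  have hperiod : ∀ r, 0 < r →
      IntervalIntegrable (periodIntegrand N H (c + r ^ 2)) volume
        (t₁ (c + r ^ 2)) (t₂ (c + r ^ 2)) ∧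
      ∫ t in t₁ (c + r ^ 2)..t₂ (c + r ^ 2), periodIntegrand N H (c + r ^ 2) t = G r := by
    intro r hr
    obtain ⟨e1, e2⟩ := hends r hr
    have h := integral_div_sqrt_sublevel (f := fun t => t ^ 2 * profile N H t + t ^ 2)
      (W := W (c + r ^ 2)) hφ'c hφ hφ'0 hφm hfφ hr
      (hWc.comp (by fun_prop : Continuous fun θ : ℝ => (r, θ)))
    have e : periodIntegrand N H (c + r ^ 2) = fun t => W (c + r ^ 2) t /
        √(c + r ^ 2 - (t ^ 2 * profile N H t + t ^ 2)) := by
      funext t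
      rw [periodIntegrand, hW, div_div, sub_sub]
    rw [e1, e2, e]
    exact h
  have hG0 : π / κ < G 0 := by
    have h3 : G 0 = π * (√m)⁻¹ := by
      simp only [hG, zero_mul, intervalIntegral.integral_const, smul_eq_mul, hφv, hφ'v]
      rw [mul_div_cancel_left₀ _ (two_ne_zero), zero_pow two_ne_zero, add_zero,
        hW, ← small_oscillation_limit hv₀ hy0 hm0]
      ring
    rw [h3, ← div_eq_mul_inv]
    apply div_lt_div_of_pos_left pi_pos (sqrt_pos.2 hm0)
    rwa [sqrt_lt' hκ0]
  obtain ⟨C₀, hC₀⟩ := exists_forall_integral_periodIntegrand_lt hN hH hv₀ hA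
  obtain ⟨R, hR0, hR⟩ : ∃ R, 0 < R ∧ C₀ ≤ c + R ^ 2 := by
    refine ⟨√(|C₀ - c| + 1), by positivity, ?_⟩
    rw [sq_sqrt (by positivity)]
    linarith [le_abs_self (C₀ - c)]
  have hGR : G R < π / κ := by
    obtain ⟨hi, he⟩ := hperiod R hR0
    obtain ⟨a1, a2, a3, a4, a5, a6⟩ := hroots (c + R ^ 2) (by nlinarith)
    rw [← he]
    exact hC₀ _ _ _ hR a1 a2 a3 a4 a5 a6 hi
  obtain ⟨r, ⟨hr0, -⟩, hr⟩ := intermediate_value_Icc' hR0.le hGc.continuousOn ⟨hGR.le, hG0.le⟩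
  have hr' : 0 < r := hr0.lt_of_ne (by rintro rfl; exact hG0.ne' hr)
  have hcr : c < c + r ^ 2 := by nlinarith
  refine ⟨c + r ^ 2, hcr, ?_⟩
  obtain ⟨a1, a2, a3, -⟩ := hroots _ hcr
  rw [mul_div_assoc, ← hr, ← (hperiod r hr').2]
  congr 1
  apply intervalIntegral.integral_congr
  intro t ht
  rw [uIcc_of_le (by linarith)] at ht
  simp only [periodIntegrand, sqrt_profile hH (a1.trans_le ht.1)]
end

section
/- Let n > m ≥ 1 be integers and define q_C(v) = C − v^{2−2n/m} − v² for v > 0 (the case H = 0), with unique positive critical point v₀ = ((n−m)/m)^{m/(2n)} and c₀ = ((n−m)/m)^{m/n}·n/(n−m). For C > c₀ let t₁(C) < v₀ < t₂(C) be the two positive zeros of q_C and define P(0,m,n,C) = 2∫_{t₁(C)}^{t₂(C)} √C·t·t^{−n/m}/((C−t²)·√(q_C(t))) dt. Then lim_{C→c₀⁺} P(0,m,n,C) = √2·π. -/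
open Real Set Filter MeasureTheory

/-- The inverse square root of `(t - a) (b - t)` is integrable on `[a, b]`, with integral `π`. -/
lemma intervalIntegral_inv_sqrt_mul_sub {a b : ℝ} (hab : a < b) :
    IntervalIntegrable (fun t => 1 / √((t - a) * (b - t))) volume a b ∧
      ∫ t in a..b, 1 / √((t - a) * (b - t)) = π := by
  have hd : 0 < b - a := sub_pos.2 hab
  have hcont : Continuous fun t : ℝ => arcsin ((2 * t - a - b) / (b - a)) := by fun_prop
  have hderiv : ∀ x ∈ Ioo a b, HasDerivAt (fun t : ℝ => arcsin ((2 * t - a - b) / (b - a)))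
      (1 / √((x - a) * (b - x))) x := by
    rintro x ⟨hax, hxb⟩
    have hneg : (2 * x - a - b) / (b - a) ≠ -1 := by
      rw [Ne, div_eq_iff hd.ne']
      intro h
      linarith
    have hpos : (2 * x - a - b) / (b - a) ≠ 1 := by
      rw [Ne, div_eq_iff hd.ne']
      intro h
      linarith
    have hinner : HasDerivAt (fun t : ℝ => (2 * t - a - b) / (b - a)) (2 * 1 / (b - a)) x :=
      ((((hasDerivAt_id x).const_mul 2).sub_const a).sub_const b).div_const (b - a)
    refine ((hasDerivAt_arcsin hneg hpos).comp x hinner).congr_deriv ?_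
    have hsq : 1 - ((2 * x - a - b) / (b - a)) ^ 2 =
        (2 / (b - a)) ^ 2 * ((x - a) * (b - x)) := by
      field_simp
      ring
    have hs : √((x - a) * (b - x)) ≠ 0 :=
      (sqrt_pos.2 (mul_pos (sub_pos.2 hax) (sub_pos.2 hxb))).ne'
    rw [hsq, sqrt_mul (by positivity), sqrt_sq (by positivity)]
    field_simp
  have hint : IntervalIntegrable (fun t => 1 / √((t - a) * (b - t))) volume a b := by
    refine intervalIntegral.intervalIntegrable_deriv_of_nonneg hcont.continuousOn
      (fun x hx => hderiv x ?_) (fun x _ => by positivity)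
    rwa [min_eq_left hab.le, max_eq_right hab.le] at hx
  refine ⟨hint, ?_⟩
  rw [intervalIntegral.integral_eq_sub_of_hasDerivAt_of_le hab.le hcont.continuousOn hderiv hint]
  have hb : (2 * b - a - b) / (b - a) = 1 := by
    rw [div_eq_iff hd.ne']
    ring
  have ha : (2 * a - a - b) / (b - a) = -1 := by
    rw [div_eq_iff hd.ne']
    ring
  rw [ha, hb, arcsin_one, arcsin_neg_one]
  ring

/-- A function taking the value `C` at `a` and `b`, with second derivative at least `2 * l`,
lies below the parabola with the same boundary values and second derivative `2 * l`. -/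
lemma mul_le_sub_of_le_deriv2 {g g' g'' : ℝ → ℝ} {a b C l : ℝ}
    (hg : ∀ x ∈ Icc a b, HasDerivAt g (g' x) x) (hg' : ∀ x ∈ Icc a b, HasDerivAt g' (g'' x) x)
    (hl : ∀ x ∈ Icc a b, 2 * l ≤ g'' x) (ha : g a = C) (hb : g b = C) :
    ∀ t ∈ Icc a b, l * ((t - a) * (b - t)) ≤ C - g t := by
  intro t ht
  have hab : a ≤ b := ht.1.trans ht.2
  have h1 : ∀ x ∈ Icc a b, HasDerivAt (fun t => g t + l * ((t - a) * (b - t)))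
      (g' x + l * (a + b - 2 * x)) x := fun x hx => by
    have := (hg x hx).add
      ((((hasDerivAt_id x).sub_const a).mul ((hasDerivAt_id x).const_sub b)).const_mul l)
    refine this.congr_deriv ?_
    simp only [id]
    ring
  have h2 : ∀ x ∈ Icc a b, HasDerivAt (fun x => g' x + l * (a + b - 2 * x))
      (g'' x - 2 * l) x := fun x hx => by
    have := (hg' x hx).add ((((hasDerivAt_id x).const_mul 2).const_sub (a + b)).const_mul l)
    refine this.congr_deriv ?_
    ring
  have hconv : ConvexOn ℝ (Icc a b) fun t => g t + l * ((t - a) * (b - t)) :=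
    convexOn_of_hasDerivWithinAt2_nonneg (convex_Icc a b)
      (fun x hx => (h1 x hx).continuousAt.continuousWithinAt)
      (fun x hx => (h1 x (interior_subset hx)).hasDerivWithinAt)
      (fun x hx => (h2 x (interior_subset hx)).hasDerivWithinAt)
      (fun x hx => sub_nonneg.2 (hl x (interior_subset hx)))
  have := hconv.le_max_of_mem_Icc (left_mem_Icc.2 hab) (right_mem_Icc.2 hab) ht
  simp only [sub_self, zero_mul, mul_zero, add_zero, ha, hb, max_self] at this
  linarith

/-- The integral of `F C t / √(C - g t)` over an interval that shrinks to a nondegenerate critical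
point `v` of `g` and has `g = C` at its endpoints tends to `L * π / √(g'' v / 2)`, where `L` is the
limit of `F`. -/
theorem tendsto_integral_div_sqrt_sub_s16 {g g' g'' : ℝ → ℝ} {v L : ℝ} {l : Filter ℝ}
    {F : ℝ → ℝ → ℝ} {t₁ t₂ : ℝ → ℝ}
    (hg : ∀ᶠ x in nhds v, HasDerivAt g (g' x) x)
    (hg' : ∀ᶠ x in nhds v, HasDerivAt g' (g'' x) x)
    (hg'' : ContinuousAt g'' v) (hpos : 0 < g'' v)
    (hgm : Measurable g) (hFm : ∀ C, Measurable (F C))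
    (hF : Tendsto (fun p : ℝ × ℝ => F p.1 p.2) (l ×ˢ nhds v) (nhds L))
    (ht₁ : Tendsto t₁ l (nhds v)) (ht₂ : Tendsto t₂ l (nhds v))
    (hlt : ∀ᶠ C in l, t₁ C < t₂ C)
    (hgt₁ : ∀ᶠ C in l, g (t₁ C) = C) (hgt₂ : ∀ᶠ C in l, g (t₂ C) = C) :
    Tendsto (fun C => ∫ t in (t₁ C)..(t₂ C), F C t / √(C - g t)) l
      (nhds (L / √(g'' v / 2) * π)) := by
  set k := g'' v / 2 with hk
  have hk0 : 0 < k := by positivity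
  rw [Metric.tendsto_nhds]
  intro ε hε
  have hcont : Tendsto (fun p : ℝ × ℝ => p.1 / √p.2) (nhds L ×ˢ nhds k) (nhds (L / √k)) := by
    rw [← nhds_prod_eq]
    have hs : √((L, k) : ℝ × ℝ).2 ≠ 0 := (sqrt_pos.2 hk0).ne'
    exact (show ContinuousAt (fun p : ℝ × ℝ => p.1 / √p.2) (L, k) from
      continuousAt_fst.div continuousAt_snd.sqrt hs)
  obtain ⟨pL, hpL, pk, hpk, hbox⟩ := eventually_prod_iff.1
    (hcont.eventually (Metric.ball_mem_nhds (L / √k) (show 0 < ε / (2 * π) by positivity)))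
  obtain ⟨δ, hδ, hδk⟩ := Metric.eventually_nhds_iff.1 (hpk.and (eventually_gt_nhds hk0))
  obtain ⟨pC, hpC, pt, hpt, hFbox⟩ := eventually_prod_iff.1 (hF.eventually hpL)
  have hg''near : ∀ᶠ x in nhds v, 2 * (k - δ / 2) ≤ g'' x ∧ g'' x ≤ 2 * (k + δ / 2) := by
    filter_upwards [hg''.eventually (Metric.ball_mem_nhds (g'' v) hδ)] with x hx
    have hx' := abs_lt.1 (show |g'' x - g'' v| < δ from hx)
    constructor <;> linarith [hx'.1, hx'.2]
  have hIcc : ∀ᶠ C in l, ∀ t ∈ Icc (t₁ C) (t₂ C), pt t ∧ HasDerivAt g (g' t) t ∧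
      HasDerivAt g' (g'' t) t ∧ 2 * (k - δ / 2) ≤ g'' t ∧ g'' t ≤ 2 * (k + δ / 2) :=
    (ht₁.Icc ht₂).eventually (eventually_smallSets_forall.2
      (hpt.and (hg.and (hg'.and hg''near))))
  filter_upwards [hIcc, hpC, hlt, hgt₁, hgt₂] with C hC hpC hab ha hb
  set a := t₁ C
  set b := t₂ C
  obtain ⟨hwint, hwpi⟩ := intervalIntegral_inv_sqrt_mul_sub hab
  have hbound : ∀ t ∈ Ioc a b, ‖F C t / √(C - g t) - L / √k * (1 / √((t - a) * (b - t)))‖ ≤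
      ε / (2 * π) * (1 / √((t - a) * (b - t))) := by
    rintro t ⟨hat, htb⟩
    rcases htb.eq_or_lt with rfl | htb
    · simp [hb]
    have htI : t ∈ Icc a b := ⟨hat.le, htb.le⟩
    have hlow := mul_le_sub_of_le_deriv2 (fun x hx => (hC x hx).2.1)
      (fun x hx => (hC x hx).2.2.1) (fun x hx => (hC x hx).2.2.2.1) ha hb t htI
    have hupp := mul_le_sub_of_le_deriv2 (l := -(k + δ / 2)) (C := -C)
      (fun x hx => (hC x hx).2.1.neg) (fun x hx => (hC x hx).2.2.1.neg)
      (fun x hx => by linarith [(hC x hx).2.2.2.2])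
      (by simpa using ha) (by simpa using hb) t htI
    simp only [Pi.neg_apply] at hupp
    have hw : 0 < (t - a) * (b - t) := mul_pos (sub_pos.2 hat) (sub_pos.2 htb)
    set w := (t - a) * (b - t)
    have hS : |(C - g t) / w - k| < δ := by
      have h1 : k - δ / 2 ≤ (C - g t) / w := (le_div_iff₀ hw).2 hlow
      have h2 : (C - g t) / w ≤ k + δ / 2 := (div_le_iff₀ hw).2 (by linarith)
      rw [abs_lt]
      constructor <;> linarith
    obtain ⟨hpkS, hS0⟩ := hδk hS
    have hclose : |F C t / √((C - g t) / w) - L / √k| < ε / (2 * π) :=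
      hbox (hFbox hpC (hC t htI).1) hpkS
    have hfac : F C t / √(C - g t) = F C t / √((C - g t) / w) * (1 / √w) := by
      rw [mul_one_div, div_div, ← sqrt_mul hS0.le, div_mul_cancel₀ _ hw.ne']
    rw [hfac, ← sub_mul, norm_mul, Real.norm_eq_abs, Real.norm_of_nonneg (by positivity)]
    gcongr
  have hae : ∀ᵐ t ∂volume, t ∈ Ioc a b →
      ‖F C t / √(C - g t) - L / √k * (1 / √((t - a) * (b - t)))‖ ≤
        ε / (2 * π) * (1 / √((t - a) * (b - t))) := Eventually.of_forall hbound
  have hdint : IntervalIntegrable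
      (fun t => F C t / √(C - g t) - L / √k * (1 / √((t - a) * (b - t)))) volume a b := by
    refine (hwint.const_mul (ε / (2 * π))).mono_fun' ?_ ?_
    · have hm := hFm C
      exact Measurable.aestronglyMeasurable (by fun_prop)
    · rw [uIoc_of_le hab.le]
      exact (ae_restrict_iff' measurableSet_Ioc).2 hae
  have hsplit : ∫ t in a..b, F C t / √(C - g t) =
      (∫ t in a..b, (F C t / √(C - g t) - L / √k * (1 / √((t - a) * (b - t))))) +
        L / √k * π := by
    rw [← hwpi, ← intervalIntegral.integral_const_mul,
      ← intervalIntegral.integral_add hdint (hwint.const_mul _)]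
    simp
  have hnorm := intervalIntegral.norm_integral_le_of_norm_le hab.le hae (hwint.const_mul _)
  rw [intervalIntegral.integral_const_mul, hwpi] at hnorm
  rw [dist_eq_norm, hsplit, add_sub_cancel_right]
  refine hnorm.trans_lt ?_
  have : ε / (2 * π) * π = ε / 2 := by field_simp
  linarith

/-- Solutions of `g t = C` on the side of `v` where `g` increases tend to `v` as `C` decreases to
`g v`. -/
lemma tendsto_root_of_strictMonoOn {g r : ℝ → ℝ} {v : ℝ} (hg : StrictMonoOn g (Ici v))
    (hr : ∀ C, g v < C → v < r C ∧ g (r C) = C) :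
    Tendsto r (nhdsWithin (g v) (Ioi (g v))) (nhds v) := by
  refine tendsto_order.2 ⟨fun y hy => ?_, fun y hy => ?_⟩
  · filter_upwards [self_mem_nhdsWithin] with C hC using hy.trans (hr C hC).1
  · filter_upwards [Ioo_mem_nhdsGT (hg self_mem_Ici hy.le hy)] with C hC
    obtain ⟨hv, hrC⟩ := hr C hC.1
    exact (hg.lt_iff_lt hv.le hy.le).1 (hrC.trans_lt hC.2)

/-- Solutions of `g t = C` on the side of `v` where `g` decreases tend to `v` as `C` decreases to
`g v`. -/
lemma tendsto_root_of_strictAntiOn {g r : ℝ → ℝ} {u v : ℝ} (huv : u < v)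
    (hg : StrictAntiOn g (Ioc u v))
    (hr : ∀ C, g v < C → u < r C ∧ r C < v ∧ g (r C) = C) :
    Tendsto r (nhdsWithin (g v) (Ioi (g v))) (nhds v) := by
  refine tendsto_order.2 ⟨fun y hy => ?_, fun y hy => ?_⟩
  · have hz : max y ((u + v) / 2) ∈ Ioo u v :=
      ⟨lt_max_of_lt_right (by linarith), max_lt hy (by linarith)⟩
    have hz' : max y ((u + v) / 2) ∈ Ioc u v := ⟨hz.1, hz.2.le⟩
    filter_upwards [Ioo_mem_nhdsGT (hg hz' (right_mem_Ioc.2 huv) hz.2)] with C hC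
    obtain ⟨hu, hv, hrC⟩ := hr C hC.1
    exact (le_max_left _ _).trans_lt
      ((hg.lt_iff_gt ⟨hu, hv.le⟩ hz').1 (hrC.trans_lt hC.2))
  · filter_upwards [self_mem_nhdsWithin] with C hC using (hr C hC).2.1.trans hy

/-- The derivative of `x ^ p + x ^ 2` on the positive reals. -/
lemma hasDerivAt_rpow_add_sq (p : ℝ) {x : ℝ} (hx : 0 < x) :
    HasDerivAt (fun t : ℝ => t ^ p + t ^ 2) (p * x ^ (p - 1) + 2 * x) x := by
  refine ((hasDerivAt_rpow_const (Or.inl hx.ne')).add (hasDerivAt_pow 2 x)).congr_deriv ?_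
  simp

/-- The second derivative of `x ^ p + x ^ 2` on the positive reals. -/
lemma hasDerivAt_deriv_rpow_add_sq (p : ℝ) {x : ℝ} (hx : 0 < x) :
    HasDerivAt (fun t : ℝ => p * t ^ (p - 1) + 2 * t) (p * (p - 1) * x ^ (p - 2) + 2) x := by
  have := ((hasDerivAt_rpow_const (p := p - 1) (Or.inl hx.ne')).const_mul p).add
    ((hasDerivAt_id x).const_mul 2)
  refine this.congr_deriv ?_
  rw [show p - 1 - 1 = p - 2 by ring]
  ring

lemma mul_rpow_sub_one_add_two_mul (p : ℝ) {x : ℝ} (hx : 0 < x) :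
    p * x ^ (p - 1) + 2 * x = x * (p * x ^ (p - 2) + 2) := by
  rw [show p - 1 = p - 2 + 1 by ring, rpow_add_one hx.ne']
  ring

/-- `t ^ p + t ^ 2` with `p < 0` increases to the right of its critical point. -/
lemma strictMonoOn_rpow_add_sq {p v : ℝ} (hp : p < 0) (hv : 0 < v)
    (hcrit : p * v ^ (p - 2) = -2) :
    StrictMonoOn (fun t : ℝ => t ^ p + t ^ 2) (Ici v) := by
  refine strictMonoOn_of_hasDerivWithinAt_pos (f' := fun x => p * x ^ (p - 1) + 2 * x)
    (convex_Ici v)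
    (fun x hx => (hasDerivAt_rpow_add_sq p (hv.trans_le hx)).continuousAt.continuousWithinAt)
    (fun x hx => (hasDerivAt_rpow_add_sq p (hv.trans_le
      (interior_subset hx))).hasDerivWithinAt) (fun x hx => ?_)
  rw [interior_Ici] at hx
  have hx0 : 0 < x := hv.trans hx
  have hlt : x ^ (p - 2) < v ^ (p - 2) := rpow_lt_rpow_of_neg hv hx (by linarith)
  rw [mul_rpow_sub_one_add_two_mul p hx0]
  exact mul_pos hx0 (by nlinarith)

/-- `t ^ p + t ^ 2` with `p < 0` decreases between `0` and its critical point. -/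
lemma strictAntiOn_rpow_add_sq {p v : ℝ} (hp : p < 0)
    (hcrit : p * v ^ (p - 2) = -2) :
    StrictAntiOn (fun t : ℝ => t ^ p + t ^ 2) (Ioc 0 v) := by
  refine strictAntiOn_of_hasDerivWithinAt_neg (f' := fun x => p * x ^ (p - 1) + 2 * x)
    (convex_Ioc 0 v)
    (fun x hx => (hasDerivAt_rpow_add_sq p hx.1).continuousAt.continuousWithinAt)
    (fun x hx => (hasDerivAt_rpow_add_sq p (interior_subset hx).1).hasDerivWithinAt)
    (fun x hx => ?_)
  rw [interior_Ioc] at hx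
  have hlt : v ^ (p - 2) < x ^ (p - 2) := rpow_lt_rpow_of_neg hx.1 hx.2 (by linarith)
  rw [mul_rpow_sub_one_add_two_mul p hx.1]
  exact mul_neg_of_pos_of_neg hx.1 (by nlinarith)

/-- The case `H = 0`: the period
`P(0,m,n,C) = 2∫_{t₁(C)}^{t₂(C)} √C t t^{-n/m} / ((C-t²)√(q_C(t))) dt`
tends to `√2 π` as `C → c₀⁺`, where `q_C(v) = C - v^{2-2n/m} - v²`,
`v₀ = ((n-m)/m)^{m/(2n)}` is its unique positive critical point,
`c₀ = ((n-m)/m)^{m/n}·n/(n-m)`, and `t₁(C) < v₀ < t₂(C)` are the two positive zeros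
of `q_C` for `C > c₀`. -/
theorem limit_of_period_H0 (n m : ℕ) (hm : 1 ≤ m) (hmn : m < n)
    (t₁ t₂ : ℝ → ℝ)
    (hroots : ∀ C : ℝ,
      (((n : ℝ) - m) / m) ^ ((m : ℝ) / n) * ((n : ℝ) / ((n : ℝ) - m)) < C →
      0 < t₁ C ∧ t₁ C < (((n : ℝ) - m) / m) ^ ((m : ℝ) / (2 * n)) ∧
      (((n : ℝ) - m) / m) ^ ((m : ℝ) / (2 * n)) < t₂ C ∧
      C - (t₁ C) ^ ((2 : ℝ) - 2 * (n : ℝ) / m) - (t₁ C) ^ 2 = 0 ∧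
      C - (t₂ C) ^ ((2 : ℝ) - 2 * (n : ℝ) / m) - (t₂ C) ^ 2 = 0 ∧
      ∀ t ∈ Set.Ioo (t₁ C) (t₂ C), 0 < C - t ^ ((2 : ℝ) - 2 * (n : ℝ) / m) - t ^ 2) :
    Filter.Tendsto (fun C : ℝ =>
        2 * ∫ t in (t₁ C)..(t₂ C),
          Real.sqrt C * t * t ^ (-(n : ℝ) / m) /
            ((C - t ^ 2) * Real.sqrt (C - t ^ ((2 : ℝ) - 2 * (n : ℝ) / m) - t ^ 2)))
      (nhdsWithin ((((n : ℝ) - m) / m) ^ ((m : ℝ) / n) * ((n : ℝ) / ((n : ℝ) - m)))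
        (Set.Ioi ((((n : ℝ) - m) / m) ^ ((m : ℝ) / n) * ((n : ℝ) / ((n : ℝ) - m)))))
      (nhds (Real.sqrt 2 * π)) := by
  have hM : (0 : ℝ) < m := by exact_mod_cast hm
  have hNM : (0 : ℝ) < (n : ℝ) - m := sub_pos.2 (by exact_mod_cast hmn)
  have hN : (0 : ℝ) < n := by linarith
  set N := (n : ℝ)
  set M := (m : ℝ)
  have hρ : 0 < (N - M) / M := by positivity
  set v : ℝ := ((N - M) / M) ^ (M / (2 * N)) with hv_def
  have hv : 0 < v := rpow_pos_of_pos hρ _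
  set p : ℝ := 2 - 2 * N / M with hp_def
  have hp : p = -2 * ((N - M) / M) := by
    rw [hp_def]
    field_simp
    ring
  have hp0 : p < 0 := by
    rw [hp]
    linarith
  have hvsq : v ^ 2 = ((N - M) / M) ^ (M / N) := by
    rw [hv_def, ← rpow_natCast, ← rpow_mul hρ.le]
    congr 1
    push_cast
    field_simp
  have hvp2 : v ^ (p - 2) = M / (N - M) := by
    rw [hv_def, ← rpow_mul hρ.le, show M / (2 * N) * (p - 2) = -1 by rw [hp_def]; field_simp; ring,
      rpow_neg_one, inv_div]
  set A : ℝ := v ^ (-N / M) with hA_def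
  have hA : 0 < A := rpow_pos_of_pos hv _
  have hAsq : A ^ 2 = M / (N - M) := by
    rw [← hvp2, hA_def, ← rpow_natCast, ← rpow_mul hv.le]
    congr 1
    rw [hp_def]
    push_cast
    ring
  have hcrit : p * v ^ (p - 2) = -2 := by
    rw [hvp2, hp]
    field_simp
  have hvp : v ^ p = v ^ 2 * A ^ 2 := by
    rw [hAsq, ← hvp2, ← rpow_natCast, ← rpow_add hv]
    congr 1
    push_cast
    ring
  have hgv : v ^ p + v ^ 2 = ((N - M) / M) ^ (M / N) * (N / (N - M)) := by
    rw [hvp, hAsq, ← hvsq]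
    field_simp
    ring
  rw [← hgv] at hroots ⊢
  set c := v ^ p + v ^ 2 with hc_def
  have hcA : c = (v * A) ^ 2 * (N / M) := by
    rw [hc_def, hvp, mul_pow, hAsq]
    field_simp
    ring
  have ht₁ : Tendsto t₁ (nhdsWithin c (Ioi c)) (nhds v) :=
    tendsto_root_of_strictAntiOn hv (strictAntiOn_rpow_add_sq hp0 hcrit) fun C hC =>
      ⟨(hroots C hC).1, (hroots C hC).2.1, by linarith [(hroots C hC).2.2.2.1]⟩
  have ht₂ : Tendsto t₂ (nhdsWithin c (Ioi c)) (nhds v) :=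
    tendsto_root_of_strictMonoOn (strictMonoOn_rpow_add_sq hp0 hv hcrit) fun C hC =>
      ⟨(hroots C hC).2.2.1, by linarith [(hroots C hC).2.2.2.2.1]⟩
  have hg''v : p * (p - 1) * v ^ (p - 2) + 2 = 4 * (N / M) := by
    rw [mul_right_comm, hcrit, hp]
    field_simp
    ring
  have hcv : c - v ^ 2 = (v * A) ^ 2 := by
    rw [hc_def, hvp]
    ring
  have hF : ContinuousAt (fun q : ℝ × ℝ => √q.1 * q.2 * q.2 ^ (-N / M) / (q.1 - q.2 ^ 2))
      (c, v) := by
    have hne : ((c, v) : ℝ × ℝ).1 - ((c, v) : ℝ × ℝ).2 ^ 2 ≠ 0 := by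
      rw [hcv]
      positivity
    exact ((continuousAt_fst.sqrt.mul continuousAt_snd).mul
      (continuousAt_snd.rpow_const (Or.inl hv.ne'))).div
        (continuousAt_fst.sub (continuousAt_snd.pow 2)) hne
  have hmain := tendsto_integral_div_sqrt_sub_s16
    (F := fun C t => √C * t * t ^ (-N / M) / (C - t ^ 2))
    (g := fun t => t ^ p + t ^ 2) (l := nhdsWithin c (Ioi c))
    ((eventually_gt_nhds hv).mono fun x hx => hasDerivAt_rpow_add_sq p hx)
    ((eventually_gt_nhds hv).mono fun x hx => hasDerivAt_deriv_rpow_add_sq p hx)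
    ((continuousAt_const.mul (continuousAt_id.rpow_const (Or.inl hv.ne'))).add continuousAt_const)
    (by
      show 0 < p * (p - 1) * v ^ (p - 2) + 2
      rw [hg''v]
      positivity)
    (by fun_prop) (fun C => by fun_prop)
    (hF.tendsto.mono_left (by
      rw [nhds_prod_eq]
      exact prod_mono nhdsWithin_le_nhds le_rfl)) ht₁ ht₂
    (by filter_upwards [self_mem_nhdsWithin] with C hC
        exact (hroots C hC).2.1.trans (hroots C hC).2.2.1)
    (by filter_upwards [self_mem_nhdsWithin] with C hC
        linarith [(hroots C hC).2.2.2.1])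
    (by filter_upwards [self_mem_nhdsWithin] with C hC
        linarith [(hroots C hC).2.2.2.2.1])
  have hval : 2 * (√c * v * A / (c - v ^ 2) /
      √((p * (p - 1) * v ^ (p - 2) + 2) / 2) * π) = √2 * π := by
    have hsc : √c = v * A * √(N / M) := by
      rw [hcA, sqrt_mul (by positivity), sqrt_sq (by positivity)]
    have hk : √((p * (p - 1) * v ^ (p - 2) + 2) / 2) = √2 * √(N / M) := by
      rw [hg''v, ← sqrt_mul (by norm_num)]
      congr 1
      ring
    have hs : √(N / M) ≠ 0 := (sqrt_pos.2 (by positivity)).ne'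
    have h2 : √2 ^ 2 = (2 : ℝ) := sq_sqrt (by norm_num)
    rw [hk, hsc, hcv]
    field_simp
    linarith
  rw [← hval]
  refine (hmain.const_mul 2).congr fun C => ?_
  simp only [div_div, sub_sub]
end
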